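/- Let (L,d,λ) be a weak Lie 3-algebra over a commutative ring k in which 2 and 3 are invertible. Then its skew-symmetrization (L,d,λ̄2,λ̄3,λ̄4) is a (semi-strict) Lie 3-algebra: λ̄2, λ̄3, λ̄4 are skew-symmetric (λ̄n^σ = sgn(σ)·λ̄n for all σ ∈ Sn, n = 2,3,4) and satisfy the Leibniz 3-algebra equations (L1)–(L4). -/

import Mathlib

namespace WL3

open Finset

/-! ## Graded multilinear maps -/

/-- Cast along an equality of degrees. -/
def gcast {M : ℤ → Type} {i j : ℤ} (h : i = j) (x : M i) : M j := h ▸ x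

/-- A degree-`r`, arity-`m` map between ℤ-graded types, given by its components on
homogeneous tuples: its component at degrees `d` maps `L (d 1) ⊗ ⋯ ⊗ L (d m)` to
`M (r + d 1 + ⋯ + d m)`. -/
abbrev MMap (L M : ℤ → Type) (m : ℕ) (r : ℤ) : Type :=
  ∀ d : Fin m → ℤ, (∀ j, L (d j)) → M (r + ∑ j, d j)

variable {L M N : ℤ → Type}

/-- Cast an `MMap` along equalities of arities and degrees. -/
def mcast {m m' : ℕ} {r r' : ℤ} (hm : m = m') (hr : r = r') (μ : MMap L M m r) :
    MMap L M m' r' := by subst hm; subst hr; exact μ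

/-- Koszul sign of the permutation `σ` acting on a tuple of homogeneous elements of
degrees `d`: `∏_{i<j, σ i > σ j} (-1)^(d i · d j)`. -/
def koszulSign {m : ℕ} (d : Fin m → ℤ) (σ : Equiv.Perm (Fin m)) : ℤ :=
  ∏ p ∈ Finset.univ.filter (fun p : Fin m × Fin m => p.1 < p.2 ∧ σ p.2 < σ p.1),
    (-1 : ℤ) ^ (d p.1 * d p.2).natAbs

/-- The action `μ ↦ μ^σ`, `μ^σ(x₁,…,x_m) = ε(σ;x)·μ(x_{σ⁻¹1},…,x_{σ⁻¹m})`. -/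
def pa [∀ i, AddCommGroup (M i)] {m : ℕ} {r : ℤ} (σ : Equiv.Perm (Fin m)) (μ : MMap L M m r) :
    MMap L M m r := fun d x =>
  koszulSign d σ •
    gcast (by rw [Equiv.sum_comp σ.symm d])
      (μ (fun j => d (σ.symm j)) (fun j => x (σ.symm j)))

/-- Degrees of the outer map in a partial composition. -/
def outDeg (m₁ m₂ n : ℕ) (s : ℤ) (d : Fin (m₁ + n + m₂) → ℤ) : Fin (m₁ + 1 + m₂) → ℤ :=
  Fin.append
    (Fin.append (fun j : Fin m₁ => d (Fin.castAdd m₂ (Fin.castAdd n j)))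
      (fun _ : Fin 1 => s + ∑ j : Fin n, d (Fin.castAdd m₂ (Fin.natAdd m₁ j))))
    (fun j : Fin m₂ => d (Fin.natAdd (m₁ + n) j))

theorem outDeg_left (m₁ m₂ n : ℕ) (s : ℤ) (d : Fin (m₁ + n + m₂) → ℤ) (j : Fin m₁) :
    outDeg m₁ m₂ n s d (Fin.castAdd m₂ (Fin.castAdd 1 j))
      = d (Fin.castAdd m₂ (Fin.castAdd n j)) := by
  simp [outDeg, Fin.append_left]

theorem outDeg_mid (m₁ m₂ n : ℕ) (s : ℤ) (d : Fin (m₁ + n + m₂) → ℤ) (j : Fin 1) :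
    outDeg m₁ m₂ n s d (Fin.castAdd m₂ (Fin.natAdd m₁ j))
      = s + ∑ j : Fin n, d (Fin.castAdd m₂ (Fin.natAdd m₁ j)) := by
  simp [outDeg, Fin.append_left, Fin.append_right]

theorem outDeg_right (m₁ m₂ n : ℕ) (s : ℤ) (d : Fin (m₁ + n + m₂) → ℤ) (j : Fin m₂) :
    outDeg m₁ m₂ n s d (Fin.natAdd (m₁ + 1) j) = d (Fin.natAdd (m₁ + n) j) := by
  simp [outDeg, Fin.append_right]

theorem outDeg_sum (m₁ m₂ n : ℕ) (r s : ℤ) (d : Fin (m₁ + n + m₂) → ℤ) :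
    r + ∑ j, outDeg m₁ m₂ n s d j = (r + s) + ∑ j, d j := by
  simp [outDeg, Fin.sum_univ_add, Fin.append_left, Fin.append_right]
  ring

/-- Partial (operadic) composition `μ ∘_{m₁+1} ν` of `μ` (of arity `m₁ + 1 + m₂`) with `ν`
inserted in the slot `m₁ + 1`, with the Koszul sign `(-1)^(|ν|·(d 1 + ⋯ + d m₁))`. -/
def pcomp [∀ i, AddCommGroup (L i)] [∀ i, AddCommGroup (M i)] (m₁ m₂ : ℕ) {n : ℕ} {r s : ℤ}
    (μ : MMap L M (m₁ + 1 + m₂) r) (ν : MMap L L n s) : MMap L M (m₁ + n + m₂) (r + s) :=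
  fun d x =>
    ((-1 : ℤ) ^ (s * ∑ j : Fin m₁, d (Fin.castAdd m₂ (Fin.castAdd n j))).natAbs) •
    gcast (outDeg_sum m₁ m₂ n r s d)
      (μ (outDeg m₁ m₂ n s d)
        (fun j => Fin.addCases (motive := fun t => L (outDeg m₁ m₂ n s d t))
          (fun j' => Fin.addCases (motive := fun t => L (outDeg m₁ m₂ n s d (Fin.castAdd m₂ t)))
            (fun j1 => gcast (outDeg_left m₁ m₂ n s d j1).symm
              (x (Fin.castAdd m₂ (Fin.castAdd n j1))))
            (fun j0 => gcast (outDeg_mid m₁ m₂ n s d j0).symm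
              (ν (fun j2 => d (Fin.castAdd m₂ (Fin.natAdd m₁ j2)))
                 (fun j2 => x (Fin.castAdd m₂ (Fin.natAdd m₁ j2)))))
            j')
          (fun j3 => gcast (outDeg_right m₁ m₂ n s d j3).symm (x (Fin.natAdd (m₁ + n) j3)))
          j))

/-- Composition `μ ∘ g` of an arity-1 map with an arity-`a` map. -/
def comp₁ {a : ℕ} {r s : ℤ} (μ : MMap M N 1 r) (g : MMap L M a s) : MMap L N a (r + s) :=
  fun d x =>
    gcast (by rw [Fin.sum_univ_one]; ring)
      (μ (fun _ : Fin 1 => s + ∑ j, d j) (fun _ => g d x))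

theorem sum2 (a b : ℕ) (r s₁ s₂ : ℤ) (d : Fin (a + b) → ℤ) :
    r + ∑ t : Fin 2, ![s₁ + ∑ j : Fin a, d (Fin.castAdd b j),
                       s₂ + ∑ j : Fin b, d (Fin.natAdd a j)] t
      = (r + (s₁ + s₂)) + ∑ j, d j := by
  simp [Fin.sum_univ_two, Fin.sum_univ_add]
  ring

/-- Full composition `μ ∘ (g₁, g₂)` with Koszul signs. -/
def comp₂ [∀ i, AddCommGroup (N i)] {a b : ℕ} {r s₁ s₂ : ℤ}
    (μ : MMap M N 2 r) (g₁ : MMap L M a s₁) (g₂ : MMap L M b s₂) :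
    MMap L N (a + b) (r + (s₁ + s₂)) :=
  fun d x =>
    ((-1 : ℤ) ^ (s₂ * ∑ j : Fin a, d (Fin.castAdd b j)).natAbs) •
    gcast (sum2 a b r s₁ s₂ d)
      (μ ![s₁ + ∑ j : Fin a, d (Fin.castAdd b j), s₂ + ∑ j : Fin b, d (Fin.natAdd a j)]
        (Fin.cons (gcast (by simp) (g₁ (fun j => d (Fin.castAdd b j)) (fun j => x (Fin.castAdd b j))))
          (fun _ : Fin 1 => gcast (by simp) (g₂ (fun j => d (Fin.natAdd a j)) (fun j => x (Fin.natAdd a j))))))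

theorem sum3 (a b c : ℕ) (r s₁ s₂ s₃ : ℤ) (d : Fin (a + b + c) → ℤ) :
    r + ∑ t : Fin 3, ![s₁ + ∑ j : Fin a, d (Fin.castAdd c (Fin.castAdd b j)),
                       s₂ + ∑ j : Fin b, d (Fin.castAdd c (Fin.natAdd a j)),
                       s₃ + ∑ j : Fin c, d (Fin.natAdd (a + b) j)] t
      = (r + (s₁ + s₂ + s₃)) + ∑ j, d j := by
  simp [Fin.sum_univ_three, Fin.sum_univ_add]
  ring

/-- Full composition `μ ∘ (g₁, g₂, g₃)` with Koszul signs. -/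
def comp₃ [∀ i, AddCommGroup (N i)] {a b c : ℕ} {r s₁ s₂ s₃ : ℤ}
    (μ : MMap M N 3 r) (g₁ : MMap L M a s₁) (g₂ : MMap L M b s₂) (g₃ : MMap L M c s₃) :
    MMap L N (a + b + c) (r + (s₁ + s₂ + s₃)) :=
  fun d x =>
    ((-1 : ℤ) ^ (s₂ * (∑ j : Fin a, d (Fin.castAdd c (Fin.castAdd b j)))
        + s₃ * ((∑ j : Fin a, d (Fin.castAdd c (Fin.castAdd b j)))
          + ∑ j : Fin b, d (Fin.castAdd c (Fin.natAdd a j)))).natAbs) •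
    gcast (sum3 a b c r s₁ s₂ s₃ d)
      (μ ![s₁ + ∑ j : Fin a, d (Fin.castAdd c (Fin.castAdd b j)),
           s₂ + ∑ j : Fin b, d (Fin.castAdd c (Fin.natAdd a j)),
           s₃ + ∑ j : Fin c, d (Fin.natAdd (a + b) j)]
        (Fin.cons (gcast (by simp)
            (g₁ (fun j => d (Fin.castAdd c (Fin.castAdd b j)))
                (fun j => x (Fin.castAdd c (Fin.castAdd b j)))))
          (Fin.cons (gcast (by simp)
              (g₂ (fun j => d (Fin.castAdd c (Fin.natAdd a j)))
                  (fun j => x (Fin.castAdd c (Fin.natAdd a j)))))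
            (fun _ : Fin 1 => gcast (by simp)
              (g₃ (fun j => d (Fin.natAdd (a + b) j))
                  (fun j => x (Fin.natAdd (a + b) j)))))))

theorem sum4 (a b c e : ℕ) (r s₁ s₂ s₃ s₄ : ℤ) (d : Fin (a + b + c + e) → ℤ) :
    r + ∑ t : Fin 4, ![s₁ + ∑ j : Fin a, d (Fin.castAdd e (Fin.castAdd c (Fin.castAdd b j))),
                       s₂ + ∑ j : Fin b, d (Fin.castAdd e (Fin.castAdd c (Fin.natAdd a j))),
                       s₃ + ∑ j : Fin c, d (Fin.castAdd e (Fin.natAdd (a + b) j)),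
                       s₄ + ∑ j : Fin e, d (Fin.natAdd (a + b + c) j)] t
      = (r + (s₁ + s₂ + s₃ + s₄)) + ∑ j, d j := by
  simp [Fin.sum_univ_four, Fin.sum_univ_add]
  ring

/-- Full composition `μ ∘ (g₁, g₂, g₃, g₄)` with Koszul signs. -/
def comp₄ [∀ i, AddCommGroup (N i)] {a b c e : ℕ} {r s₁ s₂ s₃ s₄ : ℤ}
    (μ : MMap M N 4 r) (g₁ : MMap L M a s₁) (g₂ : MMap L M b s₂) (g₃ : MMap L M c s₃)
    (g₄ : MMap L M e s₄) :
    MMap L N (a + b + c + e) (r + (s₁ + s₂ + s₃ + s₄)) :=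
  fun d x =>
    ((-1 : ℤ) ^ (s₂ * (∑ j : Fin a, d (Fin.castAdd e (Fin.castAdd c (Fin.castAdd b j))))
        + s₃ * ((∑ j : Fin a, d (Fin.castAdd e (Fin.castAdd c (Fin.castAdd b j))))
          + ∑ j : Fin b, d (Fin.castAdd e (Fin.castAdd c (Fin.natAdd a j))))
        + s₄ * ((∑ j : Fin a, d (Fin.castAdd e (Fin.castAdd c (Fin.castAdd b j))))
          + (∑ j : Fin b, d (Fin.castAdd e (Fin.castAdd c (Fin.natAdd a j))))
          + ∑ j : Fin c, d (Fin.castAdd e (Fin.natAdd (a + b) j)))).natAbs) •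
    gcast (sum4 a b c e r s₁ s₂ s₃ s₄ d)
      (μ ![s₁ + ∑ j : Fin a, d (Fin.castAdd e (Fin.castAdd c (Fin.castAdd b j))),
           s₂ + ∑ j : Fin b, d (Fin.castAdd e (Fin.castAdd c (Fin.natAdd a j))),
           s₃ + ∑ j : Fin c, d (Fin.castAdd e (Fin.natAdd (a + b) j)),
           s₄ + ∑ j : Fin e, d (Fin.natAdd (a + b + c) j)]
        (Fin.cons (gcast (by simp)
            (g₁ (fun j => d (Fin.castAdd e (Fin.castAdd c (Fin.castAdd b j))))
                (fun j => x (Fin.castAdd e (Fin.castAdd c (Fin.castAdd b j))))))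
          (Fin.cons (gcast (by simp)
              (g₂ (fun j => d (Fin.castAdd e (Fin.castAdd c (Fin.natAdd a j))))
                  (fun j => x (Fin.castAdd e (Fin.castAdd c (Fin.natAdd a j))))))
            (Fin.cons (gcast (by simp)
                (g₃ (fun j => d (Fin.castAdd e (Fin.natAdd (a + b) j)))
                    (fun j => x (Fin.castAdd e (Fin.natAdd (a + b) j)))))
              (fun _ : Fin 1 => gcast (by simp)
                (g₄ (fun j => d (Fin.natAdd (a + b + c) j))
                    (fun j => x (Fin.natAdd (a + b + c) j))))))))

/-- The differential `∂(μ) = D' ∘ μ - (-1)^{|μ|} ∑ᵢ μ ∘ᵢ D`. -/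
def bdry [∀ i, AddCommGroup (L i)] [∀ i, AddCommGroup (M i)] {m : ℕ} {r : ℤ}
    (D' : MMap M M 1 (-1)) (D : MMap L L 1 (-1)) (μ : MMap L M m r) : MMap L M m (-1 + r) :=
  comp₁ D' μ - ((-1 : ℤ) ^ r.natAbs) •
    ∑ p : Fin m, mcast (by have := p.isLt; omega) (by ring)
      (pcomp p.val (m - 1 - p.val) (mcast (by have := p.isLt; omega) rfl μ) D)

/-- The identity, as an `MMap`. -/
def idm : MMap L L 1 0 := fun d x => gcast (by rw [Fin.sum_univ_one, zero_add]) (x 0)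

/-- `μ ∘_{m₁+1} ν`, recast to a specified target degree `R`. -/
def pc [∀ i, AddCommGroup (L i)] [∀ i, AddCommGroup (M i)] (R : ℤ) (m₁ m₂ : ℕ) {n : ℕ}
    {r s : ℤ} (μ : MMap L M (m₁ + 1 + m₂) r) (ν : MMap L L n s)
    (h : r + s = R := by norm_num) : MMap L M (m₁ + n + m₂) R :=
  mcast rfl h (pcomp m₁ m₂ μ ν)

/-- `μ ∘ g`, recast to a specified target degree `R`. -/
def fc1 (R : ℤ) {a : ℕ} {r s : ℤ} (μ : MMap M N 1 r) (g : MMap L M a s)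
    (h : r + s = R := by norm_num) : MMap L N a R :=
  mcast rfl h (comp₁ μ g)

/-- `μ ∘ (g₁, g₂)`, recast to a specified target degree `R`. -/
def fc2 [∀ i, AddCommGroup (N i)] (R : ℤ) {a b : ℕ} {r s₁ s₂ : ℤ}
    (μ : MMap M N 2 r) (g₁ : MMap L M a s₁) (g₂ : MMap L M b s₂)
    (h : r + (s₁ + s₂) = R := by norm_num) : MMap L N (a + b) R :=
  mcast rfl h (comp₂ μ g₁ g₂)

/-- `μ ∘ (g₁, g₂, g₃)`, recast to a specified target degree `R`. -/
def fc3 [∀ i, AddCommGroup (N i)] (R : ℤ) {a b c : ℕ} {r s₁ s₂ s₃ : ℤ}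
    (μ : MMap M N 3 r) (g₁ : MMap L M a s₁) (g₂ : MMap L M b s₂) (g₃ : MMap L M c s₃)
    (h : r + (s₁ + s₂ + s₃) = R := by norm_num) : MMap L N (a + b + c) R :=
  mcast rfl h (comp₃ μ g₁ g₂ g₃)

/-- `μ ∘ (g₁, g₂, g₃, g₄)`, recast to a specified target degree `R`. -/
def fc4 [∀ i, AddCommGroup (N i)] (R : ℤ) {a b c e : ℕ} {r s₁ s₂ s₃ s₄ : ℤ}
    (μ : MMap M N 4 r) (g₁ : MMap L M a s₁) (g₂ : MMap L M b s₂) (g₃ : MMap L M c s₃)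
    (g₄ : MMap L M e s₄) (h : r + (s₁ + s₂ + s₃ + s₄) = R := by norm_num) :
    MMap L N (a + b + c + e) R :=
  mcast rfl h (comp₄ μ g₁ g₂ g₃ g₄)

/-- `∂(μ)`, recast to a specified target degree `R`. -/
def bd [∀ i, AddCommGroup (L i)] [∀ i, AddCommGroup (M i)] (R : ℤ) {m : ℕ} {r : ℤ}
    (D' : MMap M M 1 (-1)) (D : MMap L L 1 (-1)) (μ : MMap L M m r)
    (h : -1 + r = R := by norm_num) : MMap L M m R :=
  mcast rfl h (bdry D' D μ)

/-- Multilinearity over `k` of the components of an `MMap`. -/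
def IsMultilinear (k : Type) [CommRing k] {L M : ℤ → Type} [∀ i, AddCommGroup (L i)]
    [∀ i, AddCommGroup (M i)] [∀ i, Module k (L i)] [∀ i, Module k (M i)] {m : ℕ} {r : ℤ}
    (μ : MMap L M m r) : Prop :=
  ∀ (d : Fin m → ℤ) (x : ∀ j, L (d j)) (j : Fin m),
    (∀ a b : L (d j), μ d (Function.update x j (a + b))
        = μ d (Function.update x j a) + μ d (Function.update x j b)) ∧
    (∀ (c : k) (a : L (d j)), μ d (Function.update x j (c • a)) = c • μ d (Function.update x j a))

/-! ## Permutations (0-indexed; a cycle `(a b c)` is `swap a b * swap b c`) -/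

def P12 (m : ℕ) [NeZero m] : Equiv.Perm (Fin m) := Equiv.swap 0 1
def P13 (m : ℕ) [NeZero m] : Equiv.Perm (Fin m) := Equiv.swap 0 2
def P23 (m : ℕ) [NeZero m] : Equiv.Perm (Fin m) := Equiv.swap 1 2
def P34 (m : ℕ) [NeZero m] : Equiv.Perm (Fin m) := Equiv.swap 2 3
def P123 (m : ℕ) [NeZero m] : Equiv.Perm (Fin m) := Equiv.swap 0 1 * Equiv.swap 1 2
def P132 (m : ℕ) [NeZero m] : Equiv.Perm (Fin m) := Equiv.swap 0 2 * Equiv.swap 2 1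
def P234 (m : ℕ) [NeZero m] : Equiv.Perm (Fin m) := Equiv.swap 1 2 * Equiv.swap 2 3
def P243 (m : ℕ) [NeZero m] : Equiv.Perm (Fin m) := Equiv.swap 1 3 * Equiv.swap 3 2
def P1234 (m : ℕ) [NeZero m] : Equiv.Perm (Fin m) :=
  Equiv.swap 0 1 * Equiv.swap 1 2 * Equiv.swap 2 3
def P1432 (m : ℕ) [NeZero m] : Equiv.Perm (Fin m) :=
  Equiv.swap 0 3 * Equiv.swap 3 2 * Equiv.swap 2 1
def P1342 (m : ℕ) [NeZero m] : Equiv.Perm (Fin m) :=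
  Equiv.swap 0 2 * Equiv.swap 2 3 * Equiv.swap 3 1
def P13P24 (m : ℕ) [NeZero m] : Equiv.Perm (Fin m) := Equiv.swap 0 2 * Equiv.swap 1 3

end WL3
namespace WL3

open Finset

variable (k : Type) [CommRing k]

/-- A Leibniz 3-algebra structure: maps `l2, l3, l4` on a complex with differential `D`
satisfying the generalized Jacobi identities (L1)–(L4). -/
structure IsLeibniz3 {L : ℤ → Type} [∀ i, AddCommGroup (L i)] [∀ i, Module k (L i)]
    (D : MMap L L 1 (-1)) (l2 : MMap L L 2 0) (l3 : MMap L L 3 1) (l4 : MMap L L 4 2) :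
    Prop where
  lin2 : IsMultilinear k l2
  lin3 : IsMultilinear k l3
  lin4 : IsMultilinear k l4
  eqL1 : bd (-1) D D l2 = 0
  eqL2 : bd 0 D D l3 =
    pc 0 1 0 l2 l2 - pc 0 0 1 l2 l2 - pa (P12 3) (pc 0 1 0 l2 l2)
  eqL3 : bd 1 D D l4 =
    pc 1 0 1 l2 l3 + pc 1 1 0 l2 l3 - pa (P12 4) (pc 1 1 0 l2 l3)
      + pa (P123 4) (pc 1 1 0 l2 l3) - pc 1 0 2 l3 l2
      + pc 1 1 1 l3 l2 - pa (P12 4) (pc 1 1 1 l3 l2)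
      - pc 1 2 0 l3 l2 + pa (P23 4) (pc 1 2 0 l3 l2) - pa (P132 4) (pc 1 2 0 l3 l2)
  eqL4 : (0 : MMap L L 5 2) =
    pc 2 0 1 l2 l4 - pc 2 1 0 l2 l4 + pa (P12 5) (pc 2 1 0 l2 l4)
      - pa (P123 5) (pc 2 1 0 l2 l4) + pa (P1234 5) (pc 2 1 0 l2 l4)
      + pc 2 0 2 l3 l3 + pc 2 1 1 l3 l3 - pa (P12 5) (pc 2 1 1 l3 l3)
      + pa (P123 5) (pc 2 1 1 l3 l3) + pc 2 2 0 l3 l3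
      - pa (P23 5) (pc 2 2 0 l3 l3) + pa (P132 5) (pc 2 2 0 l3 l3)
      + pa (P234 5) (pc 2 2 0 l3 l3) - pa (P1342 5) (pc 2 2 0 l3 l3)
      + pa (P13P24 5) (pc 2 2 0 l3 l3)
      + pc 2 0 3 l4 l2 - pc 2 1 2 l4 l2 + pa (P12 5) (pc 2 1 2 l4 l2)
      + pc 2 2 1 l4 l2 - pa (P23 5) (pc 2 2 1 l4 l2) + pa (P132 5) (pc 2 2 1 l4 l2)
      - pc 2 3 0 l4 l2 + pa (P34 5) (pc 2 3 0 l4 l2) - pa (P243 5) (pc 2 3 0 l4 l2)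
      + pa (P1432 5) (pc 2 3 0 l4 l2)

/-- A weak Lie 3-algebra: a 3-term chain complex equipped with structure maps
`l2, l3, l4, l21, l211, l31, l32` satisfying (L1)–(L4) and (W1)–(W11). -/
structure WeakLie3 (L : ℤ → Type) [∀ i, AddCommGroup (L i)] [∀ i, Module k (L i)] where
  D : MMap L L 1 (-1)
  linD : IsMultilinear k D
  dd : fc1 (-2) D D = 0
  bound : ∀ i : ℤ, (i < 0 ∨ 2 < i) → ∀ x : L i, x = 0
  l2 : MMap L L 2 0
  l3 : MMap L L 3 1
  l4 : MMap L L 4 2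
  l21 : MMap L L 2 1
  l211 : MMap L L 2 2
  l31 : MMap L L 3 2
  l32 : MMap L L 3 2
  leib : IsLeibniz3 k D l2 l3 l4
  lin21 : IsMultilinear k l21
  lin211 : IsMultilinear k l211
  lin31 : IsMultilinear k l31
  lin32 : IsMultilinear k l32
  w1 : bd 0 D D l21 = l2 + pa (P12 2) l2
  w2 : bd 1 D D l211 = l21 - pa (P12 2) l21
  w3 : bd 1 D D l31 = l3 + pa (P12 3) l3 + pc 1 0 1 l2 l21
  w4 : bd 1 D D l32 = l3 + pa (P23 3) l3 - pc 1 1 0 l2 l21 + pc 1 0 1 l21 l2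
        + pa (P12 3) (pc 1 1 0 l21 l2)
  w5 : l211 + pa (P12 2) l211 = 0
  w6 : l31 - pa (P12 3) l31 = pc 2 0 1 l2 l211
  w7 : l31 - pa (P12 3) l32 + pa (P132 3) l31 - l32 + pa (P23 3) l31 - pa (P123 3) l32
        = pc 2 1 0 l21 l21 + pc 2 0 1 l21 l21 + pa (P12 3) (pc 2 1 0 l21 l21)
          + pa (P132 3) (pc 2 1 0 l211 l2)
  w8 : l32 - pa (P23 3) l32 = - pc 2 1 0 l2 l211 + pc 2 0 1 l211 l2
        + pa (P12 3) (pc 2 1 0 l211 l2)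
  w9 : l4 + pa (P12 4) l4 = pc 2 0 1 l2 l31 - pc 2 2 0 l31 l2
        + pa (P123 4) (pc 2 1 0 l2 l31) + pc 2 0 2 l3 l21
  w10 : l4 + pa (P23 4) l4 = pc 2 0 1 l2 l32 - pc 2 1 1 l3 l21 + pc 2 1 0 l2 l31
        - pc 2 0 2 l31 l2 - pa (P12 4) (pc 2 1 1 l31 l2) - pa (P132 4) (pc 2 2 0 l31 l2)
  w11 : l4 + pa (P34 4) l4 = pc 2 0 1 l21 l3 - pc 2 0 2 l32 l2 + pc 2 1 1 l32 l2
        - pa (P12 4) (pc 2 1 1 l32 l2) + pc 2 2 0 l3 l21 + pa (P23 4) (pc 2 2 0 l32 l2)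
        - pa (P132 4) (pc 2 2 0 l32 l2) + pc 2 1 0 l2 l32 - pa (P12 4) (pc 2 1 0 l2 l32)
        + pa (P123 4) (pc 2 1 0 l21 l3)

end WL3
namespace WL3

open Finset

variable (k : Type) [CommRing k]

/-- A weak morphism of weak Lie 3-algebras `(f1,f2,f21,f3) : A → B`, i.e. a solution of
equations (M1)–(M8). -/
structure IsWeakMorphism {L M : ℤ → Type} [∀ i, AddCommGroup (L i)] [∀ i, Module k (L i)]
    [∀ i, AddCommGroup (M i)] [∀ i, Module k (M i)]
    (A : WeakLie3 k L) (B : WeakLie3 k M)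
    (f1 : MMap L M 1 0) (f2 : MMap L M 2 1) (f21 : MMap L M 2 2) (f3 : MMap L M 3 2) :
    Prop where
  lin1 : IsMultilinear k f1
  lin2 : IsMultilinear k f2
  lin21 : IsMultilinear k f21
  lin3 : IsMultilinear k f3
  m1 : bd (-1) B.D A.D f1 = 0
  m2 : bd 0 B.D A.D f2 = fc1 0 f1 A.l2 - fc2 0 B.l2 f1 f1
  m3 : bd 1 B.D A.D f3 = fc1 1 f1 A.l3 - pc 1 1 0 f2 A.l2 + pc 1 0 1 f2 A.l2
        + pa (P12 3) (pc 1 1 0 f2 A.l2) - fc3 1 B.l3 f1 f1 f1 - fc2 1 B.l2 f1 f2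
        + fc2 1 B.l2 f2 f1 + pa (P12 3) (fc2 1 B.l2 f1 f2)
  m4 : fc1 2 f1 A.l4 - fc4 2 B.l4 f1 f1 f1 f1 =
        pc 2 0 1 f2 A.l3 + pc 2 1 0 f2 A.l3 - pa (P12 4) (pc 2 1 0 f2 A.l3)
        + pa (P123 4) (pc 2 1 0 f2 A.l3) - pc 2 0 2 f3 A.l2 + pc 2 1 1 f3 A.l2
        - pa (P12 4) (pc 2 1 1 f3 A.l2) - pc 2 2 0 f3 A.l2 + pa (P23 4) (pc 2 2 0 f3 A.l2)
        - pa (P132 4) (pc 2 2 0 f3 A.l2) + fc2 2 B.l2 f3 f1 + fc2 2 B.l2 f1 f3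
        - pa (P12 4) (fc2 2 B.l2 f1 f3) + pa (P123 4) (fc2 2 B.l2 f1 f3)
        - fc2 2 B.l2 f2 f2 + pa (P23 4) (fc2 2 B.l2 f2 f2) - pa (P132 4) (fc2 2 B.l2 f2 f2)
        + fc3 2 B.l3 f2 f1 f1 - fc3 2 B.l3 f1 f2 f1 + pa (P12 4) (fc3 2 B.l3 f1 f2 f1)
        + fc3 2 B.l3 f1 f1 f2 - pa (P23 4) (fc3 2 B.l3 f1 f1 f2)
        + pa (P132 4) (fc3 2 B.l3 f1 f1 f2)
  m5 : bd 1 B.D A.D f21 = - f2 - pa (P12 2) f2 + fc1 1 f1 A.l21 - fc2 1 B.l21 f1 f1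
  m6 : fc1 2 f1 A.l211 - fc2 2 B.l211 f1 f1 = f21 - pa (P12 2) f21
  m7 : fc1 2 f1 A.l31 - fc3 2 B.l31 f1 f1 f1 =
        f3 + pa (P12 3) f3 + pc 2 0 1 f2 A.l21 + fc2 2 B.l2 f21 f1
  m8 : fc1 2 f1 A.l32 - fc3 2 B.l32 f1 f1 f1 =
        f3 + pa (P23 3) f3 - pc 2 1 0 f2 A.l21 + pc 2 0 1 f21 A.l2
        + pa (P12 3) (pc 2 1 0 f21 A.l2) - fc2 2 B.l2 f1 f21 - fc2 2 B.l21 f2 f1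
        - pa (P12 3) (fc2 2 B.l21 f1 f2)

/-- A morphism of (semi-strict) Lie 3-algebras / Leibniz 3-algebras: equations (M1)–(M4)
for structure maps `(a2,a3,a4)` on the source and `(b2,b3,b4)` on the target. -/
structure IsLeibMorphism {L M : ℤ → Type} [∀ i, AddCommGroup (L i)] [∀ i, Module k (L i)]
    [∀ i, AddCommGroup (M i)] [∀ i, Module k (M i)]
    (DL : MMap L L 1 (-1)) (DM : MMap M M 1 (-1))
    (a2 : MMap L L 2 0) (a3 : MMap L L 3 1) (a4 : MMap L L 4 2)
    (b2 : MMap M M 2 0) (b3 : MMap M M 3 1) (b4 : MMap M M 4 2)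
    (f1 : MMap L M 1 0) (f2 : MMap L M 2 1) (f3 : MMap L M 3 2) : Prop where
  lin1 : IsMultilinear k f1
  lin2 : IsMultilinear k f2
  lin3 : IsMultilinear k f3
  m1 : bd (-1) DM DL f1 = 0
  m2 : bd 0 DM DL f2 = fc1 0 f1 a2 - fc2 0 b2 f1 f1
  m3 : bd 1 DM DL f3 = fc1 1 f1 a3 - pc 1 1 0 f2 a2 + pc 1 0 1 f2 a2
        + pa (P12 3) (pc 1 1 0 f2 a2) - fc3 1 b3 f1 f1 f1 - fc2 1 b2 f1 f2
        + fc2 1 b2 f2 f1 + pa (P12 3) (fc2 1 b2 f1 f2)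
  m4 : fc1 2 f1 a4 - fc4 2 b4 f1 f1 f1 f1 =
        pc 2 0 1 f2 a3 + pc 2 1 0 f2 a3 - pa (P12 4) (pc 2 1 0 f2 a3)
        + pa (P123 4) (pc 2 1 0 f2 a3) - pc 2 0 2 f3 a2 + pc 2 1 1 f3 a2
        - pa (P12 4) (pc 2 1 1 f3 a2) - pc 2 2 0 f3 a2 + pa (P23 4) (pc 2 2 0 f3 a2)
        - pa (P132 4) (pc 2 2 0 f3 a2) + fc2 2 b2 f3 f1 + fc2 2 b2 f1 f3
        - pa (P12 4) (fc2 2 b2 f1 f3) + pa (P123 4) (fc2 2 b2 f1 f3)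
        - fc2 2 b2 f2 f2 + pa (P23 4) (fc2 2 b2 f2 f2) - pa (P132 4) (fc2 2 b2 f2 f2)
        + fc3 2 b3 f2 f1 f1 - fc3 2 b3 f1 f2 f1 + pa (P12 4) (fc3 2 b3 f1 f2 f1)
        + fc3 2 b3 f1 f1 f2 - pa (P23 4) (fc3 2 b3 f1 f1 f2)
        + pa (P132 4) (fc3 2 b3 f1 f1 f2)

/-- A deformation retract `(p, i, h)` of `(L, D)` onto `(L', D')`:
`p`, `i` are chain maps, `id - i∘p = D∘h + h∘D` and `p∘i = id`. -/
structure IsDefRetract {L L' : ℤ → Type} [∀ i, AddCommGroup (L i)] [∀ i, Module k (L i)]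
    [∀ i, AddCommGroup (L' i)] [∀ i, Module k (L' i)]
    (D : MMap L L 1 (-1)) (D' : MMap L' L' 1 (-1))
    (p : MMap L L' 1 0) (i : MMap L' L 1 0) (h : MMap L L 1 1) : Prop where
  linp : IsMultilinear k p
  lini : IsMultilinear k i
  linh : IsMultilinear k h
  chainp : bd (-1) D' D p = 0
  chaini : bd (-1) D D' i = 0
  homotopy : idm - fc1 0 i p = fc1 0 D h + fc1 0 h D
  retract : fc1 0 p i = idm

/-- A weak Lie 2-algebra in the sense of Roytenberg (a 2-term truncation of a weak
Lie 3-algebra). -/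
structure WeakLie2 (L : ℤ → Type) [∀ i, AddCommGroup (L i)] [∀ i, Module k (L i)] where
  D : MMap L L 1 (-1)
  linD : IsMultilinear k D
  dd : fc1 (-2) D D = 0
  bound : ∀ i : ℤ, (i < 0 ∨ 1 < i) → ∀ x : L i, x = 0
  l2 : MMap L L 2 0
  l3 : MMap L L 3 1
  l21 : MMap L L 2 1
  lin2 : IsMultilinear k l2
  lin3 : IsMultilinear k l3
  lin21 : IsMultilinear k l21
  e1 : bd (-1) D D l2 = 0
  e2 : bd 0 D D l3 = pc 0 1 0 l2 l2 - pc 0 0 1 l2 l2 - pa (P12 3) (pc 0 1 0 l2 l2)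
  e3 : (0 : MMap L L 4 1) =
    pc 1 0 1 l2 l3 + pc 1 1 0 l2 l3 - pa (P12 4) (pc 1 1 0 l2 l3)
      + pa (P123 4) (pc 1 1 0 l2 l3) - pc 1 0 2 l3 l2
      + pc 1 1 1 l3 l2 - pa (P12 4) (pc 1 1 1 l3 l2)
      - pc 1 2 0 l3 l2 + pa (P23 4) (pc 1 2 0 l3 l2) - pa (P132 4) (pc 1 2 0 l3 l2)
  e4 : bd 0 D D l21 = l2 + pa (P12 2) l2
  e5 : (0 : MMap L L 2 1) = l21 - pa (P12 2) l21
  e6 : (0 : MMap L L 3 1) = l3 + pa (P12 3) l3 + pc 1 0 1 l2 l21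
  e7 : (0 : MMap L L 3 1) = l3 + pa (P23 3) l3 - pc 1 1 0 l2 l21 + pc 1 0 1 l21 l2
        + pa (P12 3) (pc 1 1 0 l21 l2)

end WL3
namespace WL3

open Finset

section Transfer

variable {k : Type} [CommRing k] {L L' : ℤ → Type}
  [∀ i, AddCommGroup (L i)] [∀ i, Module k (L i)]
  [∀ i, AddCommGroup (L' i)] [∀ i, Module k (L' i)]
variable (A : WeakLie3 k L) (p : MMap L L' 1 0) (i : MMap L' L 1 0) (h : MMap L L 1 1)

/-- `h ∘ λ2` -/
def hl2 : MMap L L 2 1 := fc1 1 h A.l2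
/-- `h ∘ λ3` -/
def hl3 : MMap L L 3 2 := fc1 2 h A.l3
/-- `h ∘ λ21` -/
def hl21 : MMap L L 2 2 := fc1 2 h A.l21

/-- Transferred `λ2' = p ∘ λ2 ∘ (i,i)`. -/
def tl2 : MMap L' L' 2 0 := fc1 0 p (fc2 0 A.l2 i i)

/-- Transferred `λ3'`. -/
def tl3 : MMap L' L' 3 1 :=
  fc1 1 p (fc3 1 A.l3 i i i)
  + fc1 1 p (fc3 1 (pc 1 0 1 A.l2 (hl2 A h)
      - (pc 1 1 0 A.l2 (hl2 A h) - pa (P12 3) (pc 1 1 0 A.l2 (hl2 A h)))) i i i)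

/-- Transferred `λ4'`. -/
def tl4 : MMap L' L' 4 2 :=
  fc1 2 p (fc4 2 A.l4 i i i i)
  - fc1 2 p (fc4 2
      (pc 2 0 1 A.l2 (hl3 A h)
        + (pc 2 1 0 A.l2 (hl3 A h) - pa (P12 4) (pc 2 1 0 A.l2 (hl3 A h))
            + pa (P123 4) (pc 2 1 0 A.l2 (hl3 A h)))
        + pc 2 0 2 A.l3 (hl2 A h)
        - (pc 2 1 1 A.l3 (hl2 A h) - pa (P12 4) (pc 2 1 1 A.l3 (hl2 A h)))
        + (pc 2 2 0 A.l3 (hl2 A h) - pa (P23 4) (pc 2 2 0 A.l3 (hl2 A h))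
            + pa (P132 4) (pc 2 2 0 A.l3 (hl2 A h)))) i i i i)
  - fc1 2 p (fc4 2
      (pc 2 0 2 (pc 1 0 1 A.l2 (hl2 A h)) (hl2 A h)
        - (pc 2 1 1 (pc 1 0 1 A.l2 (hl2 A h)) (hl2 A h)
            - pa (P12 4) (pc 2 1 1 (pc 1 0 1 A.l2 (hl2 A h)) (hl2 A h)))
        + (fc2 2 A.l2 (hl2 A h) (hl2 A h) - pa (P23 4) (fc2 2 A.l2 (hl2 A h) (hl2 A h))
            + pa (P132 4) (fc2 2 A.l2 (hl2 A h) (hl2 A h)))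
        + (pc 2 1 1 (pc 1 1 0 A.l2 (hl2 A h)) (hl2 A h)
            - pa (P12 4) (pc 2 1 1 (pc 1 1 0 A.l2 (hl2 A h)) (hl2 A h))
            + pa (P123 4) (pc 2 1 1 (pc 1 1 0 A.l2 (hl2 A h)) (hl2 A h)))
        - (pc 2 2 0 (pc 1 1 0 A.l2 (hl2 A h)) (hl2 A h)
            - pa (P12 4) (pc 2 2 0 (pc 1 1 0 A.l2 (hl2 A h)) (hl2 A h))
            + pa (P123 4) (pc 2 2 0 (pc 1 1 0 A.l2 (hl2 A h)) (hl2 A h))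
            - pa (P23 4) (pc 2 2 0 (pc 1 1 0 A.l2 (hl2 A h)) (hl2 A h))
            + pa (P132 4) (pc 2 2 0 (pc 1 1 0 A.l2 (hl2 A h)) (hl2 A h))
            - pa (P13 4) (pc 2 2 0 (pc 1 1 0 A.l2 (hl2 A h)) (hl2 A h)))) i i i i)

/-- Transferred `λ21' = p ∘ λ21 ∘ (i,i)`. -/
def tl21 : MMap L' L' 2 1 := fc1 1 p (fc2 1 A.l21 i i)

/-- Transferred `λ211' = p ∘ λ211 ∘ (i,i)`. -/
def tl211 : MMap L' L' 2 2 := fc1 2 p (fc2 2 A.l211 i i)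

/-- Transferred `λ31'`. -/
def tl31 : MMap L' L' 3 2 :=
  fc1 2 p (fc3 2 A.l31 i i i) - fc1 2 p (fc3 2 (pc 2 0 1 A.l2 (hl21 A h)) i i i)

/-- Transferred `λ32'`. -/
def tl32 : MMap L' L' 3 2 :=
  fc1 2 p (fc3 2 A.l32 i i i)
  + fc1 2 p (fc3 2 (pc 2 0 1 A.l21 (hl2 A h) + pc 2 1 0 A.l2 (hl21 A h)
      + pa (P12 3) (pc 2 1 0 A.l21 (hl2 A h))) i i i)

/-- Extension of `i`: `i₂ = -h ∘ λ2 ∘ (i,i)`. -/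
def ti2 : MMap L' L 2 1 := - fc1 1 h (fc2 0 A.l2 i i)

/-- Extension of `i`: `i₂₁ = -h ∘ λ21 ∘ (i,i)`. -/
def ti21 : MMap L' L 2 2 := - fc1 2 h (fc2 1 A.l21 i i)

/-- Extension of `i`: `i₃`. -/
def ti3 : MMap L' L 3 2 :=
  - fc1 2 h (fc3 1 A.l3 i i i)
  - fc1 2 h (fc3 1 (pc 1 0 1 A.l2 (hl2 A h)
      - (pc 1 1 0 A.l2 (hl2 A h) - pa (P12 3) (pc 1 1 0 A.l2 (hl2 A h)))) i i i)

end Transfer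

section Skew

variable (k : Type) [CommRing k] [Invertible (2 : k)] [Invertible (3 : k)]
variable {L M : ℤ → Type} [∀ i, AddCommGroup (L i)] [∀ i, Module k (L i)]
  [∀ i, AddCommGroup (M i)] [∀ i, Module k (M i)]

/-- Skew-symmetrization `λ̄2` of a weak Lie 3-algebra. -/
def skew2 (A : WeakLie3 k L) : MMap L L 2 0 :=
  (⅟ (2 : k)) • ∑ σ : Equiv.Perm (Fin 2), (Equiv.Perm.sign σ : ℤ) • pa σ A.l2

/-- Skew-symmetrization `λ̄3` of a weak Lie 3-algebra. -/
def skew3 (A : WeakLie3 k L) : MMap L L 3 1 :=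
  (⅟ (2 : k) * ⅟ (3 : k)) • ∑ σ : Equiv.Perm (Fin 3), (Equiv.Perm.sign σ : ℤ) • pa σ A.l3
  - (⅟ (2 : k) * ⅟ (2 : k) * ⅟ (2 : k) * ⅟ (3 : k)) •
      ∑ σ : Equiv.Perm (Fin 3), (Equiv.Perm.sign σ : ℤ) •
        pa σ (pc 1 0 1 A.l21 A.l2 + pc 1 1 0 A.l21 A.l2)

/-- Skew-symmetrization `λ̄4` of a weak Lie 3-algebra. -/
def skew4 (A : WeakLie3 k L) : MMap L L 4 2 :=
  (⅟ (2 : k) * ⅟ (2 : k) * ⅟ (2 : k) * ⅟ (3 : k)) •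
      ∑ σ : Equiv.Perm (Fin 4), (Equiv.Perm.sign σ : ℤ) • pa σ A.l4
  + (⅟ (2 : k) * ⅟ (2 : k) * ⅟ (2 : k) * ⅟ (2 : k) * ⅟ (3 : k)) •
      ∑ σ : Equiv.Perm (Fin 4), (Equiv.Perm.sign σ : ℤ) •
        pa σ (pc 2 0 1 A.l21 A.l3 - pc 2 0 2 A.l31 A.l2 + pc 2 1 1 A.l32 A.l2
          - pc 2 1 0 A.l21 A.l3 - pc 2 1 1 A.l31 A.l2 + pc 2 2 0 A.l32 A.l2)

/-- Skew-symmetrization `f̄2` of the second component of a weak morphism. -/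
def skewMor2 (f2 : MMap L M 2 1) : MMap L M 2 1 :=
  (⅟ (2 : k)) • ∑ σ : Equiv.Perm (Fin 2), (Equiv.Perm.sign σ : ℤ) • pa σ f2

/-- Skew-symmetrization `f̄3` of the third component of a weak morphism `A → B`. -/
def skewMor3 (A : WeakLie3 k L) (B : WeakLie3 k M) (f1 : MMap L M 1 0) (f2 : MMap L M 2 1)
    (f21 : MMap L M 2 2) (f3 : MMap L M 3 2) : MMap L M 3 2 :=
  (⅟ (2 : k) * ⅟ (3 : k)) • ∑ σ : Equiv.Perm (Fin 3), (Equiv.Perm.sign σ : ℤ) • pa σ f3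
  - (⅟ (2 : k) * ⅟ (2 : k) * ⅟ (2 : k) * ⅟ (3 : k)) •
      ∑ σ : Equiv.Perm (Fin 3), (Equiv.Perm.sign σ : ℤ) •
        pa σ (pc 2 0 1 f21 A.l2 + pc 2 1 0 f21 A.l2
          - fc2 2 B.l21 f2 f1 - fc2 2 B.l21 f1 f2)

end Skew

section Comp

variable {k : Type} [CommRing k] {L M N : ℤ → Type}
  [∀ i, AddCommGroup (L i)] [∀ i, Module k (L i)]
  [∀ i, AddCommGroup (M i)] [∀ i, Module k (M i)]
  [∀ i, AddCommGroup (N i)] [∀ i, Module k (N i)]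

/-- First component of the composition of weak morphisms. -/
def cmp1 (f1' : MMap M N 1 0) (f1 : MMap L M 1 0) : MMap L N 1 0 := fc1 0 f1' f1

/-- Second component of the composition of weak morphisms. -/
def cmp2 (f1' : MMap M N 1 0) (f2' : MMap M N 2 1) (f1 : MMap L M 1 0) (f2 : MMap L M 2 1) :
    MMap L N 2 1 := fc2 1 f2' f1 f1 + fc1 1 f1' f2

/-- `(f'∘f)21` component of the composition of weak morphisms. -/
def cmp21 (f1' : MMap M N 1 0) (f21' : MMap M N 2 2) (f1 : MMap L M 1 0)
    (f21 : MMap L M 2 2) : MMap L N 2 2 := fc2 2 f21' f1 f1 + fc1 2 f1' f21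

/-- Third component of the composition of weak morphisms. -/
def cmp3 (f1' : MMap M N 1 0) (f2' : MMap M N 2 1) (f3' : MMap M N 3 2)
    (f1 : MMap L M 1 0) (f2 : MMap L M 2 1) (f3 : MMap L M 3 2) : MMap L N 3 2 :=
  fc3 2 f3' f1 f1 f1 - fc2 2 f2' f2 f1 + fc2 2 f2' f1 f2 - pa (P12 3) (fc2 2 f2' f1 f2)
    + fc1 2 f1' f3

end Comp

end WL3

namespace WL3

open Finset

section Signs

/-- The sign `(-1)^a` of a parity. -/
def sgn (a : ZMod 2) : ℤ := if a = 0 then 1 else -1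

@[simp] theorem sgn_zero : sgn 0 = 1 := rfl

theorem sgn_add : ∀ a b : ZMod 2, sgn (a + b) = sgn a * sgn b := by decide

theorem sgn_mul_self : ∀ a : ZMod 2, sgn a * sgn a = 1 := by decide

theorem sgn_sum {ι : Type*} (s : Finset ι) (f : ι → ZMod 2) :
    sgn (∑ i ∈ s, f i) = ∏ i ∈ s, sgn (f i) := by
  classical
  induction s using Finset.induction_on with
  | empty => simp
  | insert a s ha ih => rw [Finset.sum_insert ha, Finset.prod_insert ha, sgn_add, ih]

theorem neg_one_pow_eq_sgn (n : ℕ) : (-1 : ℤ) ^ n = sgn (n : ZMod 2) := by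
  induction n with
  | zero => simp
  | succ n ih => rw [pow_succ, ih, Nat.cast_succ, sgn_add]; rfl

theorem neg_one_pow_natAbs (z : ℤ) : (-1 : ℤ) ^ z.natAbs = sgn (z : ZMod 2) := by
  rw [neg_one_pow_eq_sgn]
  congr 1
  rcases Int.natAbs_eq z with h | h
  · conv_rhs => rw [h]
    simp
  · conv_rhs => rw [h]
    rw [Int.cast_neg, ZMod.neg_eq_self_mod_two]
    simp

/-- The sum of `C a b` over all pairs `a < b`. -/
def pairSum {m : ℕ} (C : Fin m → Fin m → ZMod 2) : ZMod 2 :=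
  ∑ a, ∑ b, if a < b then C a b else 0

theorem zmod2_add_self (x : ZMod 2) : x + x = 0 := CharTwo.add_self_eq_zero x

/-- The sum of `C a b` over the inversions of `σ`. -/
def invSum {m : ℕ} (σ : Equiv.Perm (Fin m)) (C : Fin m → Fin m → ZMod 2) : ZMod 2 :=
  ∑ a, ∑ b, if a < b ∧ σ b < σ a then C a b else 0

theorem pairSum_perm {m : ℕ} (σ : Equiv.Perm (Fin m)) (C : Fin m → Fin m → ZMod 2) :
    pairSum C + pairSum (fun a b => C (σ.symm a) (σ.symm b))
      = invSum σ (fun a b => C a b + C b a) := by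
  have h1 : pairSum (fun a b => C (σ.symm a) (σ.symm b))
      = ∑ a, ∑ b, if σ a < σ b then C a b else 0 := by
    unfold pairSum
    rw [← Equiv.sum_comp σ]
    refine Finset.sum_congr rfl fun a _ => ?_
    rw [← Equiv.sum_comp σ]
    simp
  have h2 : invSum σ (fun a b => C a b + C b a)
      = (∑ a, ∑ b, if a < b ∧ σ b < σ a then C a b else 0)
        + ∑ a, ∑ b, if b < a ∧ σ a < σ b then C a b else 0 := by
    rw [Finset.sum_comm (f := fun a b => if b < a ∧ σ a < σ b then C a b else 0)]
    unfold invSum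
    simp only [← Finset.sum_add_distrib]
    refine Finset.sum_congr rfl fun a _ => Finset.sum_congr rfl fun b _ => ?_
    split_ifs <;> simp
  rw [h1, h2, pairSum]
  simp only [← Finset.sum_add_distrib]
  refine Finset.sum_congr rfl fun a _ => Finset.sum_congr rfl fun b _ => ?_
  rcases lt_trichotomy a b with h | h | h
  · have h' : ¬ b < a := h.not_gt
    rcases lt_or_gt_of_ne (fun e => h.ne (σ.injective e)) with g | g
    · simp [h, h', g, g.not_gt, zmod2_add_self]
    · simp [h, h', g, g.not_gt]
  · subst h; simp
  · have h' : ¬ a < b := h.not_gt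
    rcases lt_or_gt_of_ne (fun e => h.ne (σ.injective e)) with g | g
    · simp [h, h', g.not_gt]
    · simp [h, h', g]

theorem pairSum_add_index {m n : ℕ} (C : Fin (m + n) → Fin (m + n) → ZMod 2) :
    pairSum C = pairSum (fun a b => C (Fin.castAdd n a) (Fin.castAdd n b))
      + pairSum (fun a b => C (Fin.natAdd m a) (Fin.natAdd m b))
      + ∑ a, ∑ b, C (Fin.castAdd n a) (Fin.natAdd m b) := by
  unfold pairSum
  rw [Fin.sum_univ_add]
  simp only [Fin.sum_univ_add]
  have h1 : ∀ (a : Fin m) (b : Fin n), Fin.castAdd n a < Fin.natAdd m b := by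
    intro a b; rw [Fin.lt_def]; simp; omega
  have h2 : ∀ (a : Fin m) (b : Fin n), ¬ Fin.natAdd m b < Fin.castAdd n a := by
    intro a b; rw [Fin.lt_def]; simp; omega
  have h3 : ∀ a b : Fin m, (Fin.castAdd n a < Fin.castAdd n b) = (a < b) := by
    intro a b; simp only [Fin.lt_def]; simp
  have h4 : ∀ a b : Fin n, (Fin.natAdd m a < Fin.natAdd m b) = (a < b) := by
    intro a b; simp only [Fin.lt_def]; simp
  simp only [h1, h2, h3, h4, if_true, if_false, Finset.sum_const_zero, zero_add,
    Finset.sum_add_distrib]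
  ring

theorem pairSum_one (C : Fin 1 → Fin 1 → ZMod 2) : pairSum C = 0 := by
  simp [pairSum]

/-- The Koszul sign of `σ` acting on a tuple of elements of parities `a`. -/
def ksgn {m : ℕ} (a : Fin m → ZMod 2) (σ : Equiv.Perm (Fin m)) : ℤ :=
  sgn (invSum σ fun i j => a i * a j)

theorem koszulSign_eq {m : ℕ} (d : Fin m → ℤ) (σ : Equiv.Perm (Fin m)) :
    koszulSign d σ = ksgn (fun j => (d j : ZMod 2)) σ := by
  unfold koszulSign ksgn invSum
  rw [← Finset.sum_product' (f := fun a b : Fin m =>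
    if a < b ∧ σ b < σ a then ((d a : ZMod 2) * d b) else 0), Finset.univ_product_univ,
    ← Finset.sum_filter, sgn_sum]
  refine Finset.prod_congr rfl fun p _ => ?_
  rw [neg_one_pow_natAbs, Int.cast_mul]

theorem ksgn_one {m : ℕ} (σ : Equiv.Perm (Fin m)) :
    ksgn (fun _ => 1) σ = Equiv.Perm.sign σ := by
  unfold ksgn invSum
  rw [Equiv.Perm.sign_eq_prod_prod_Iio]
  rw [Finset.sum_comm, sgn_sum, Units.coe_prod]
  refine Finset.prod_congr rfl fun a _ => ?_
  rw [sgn_sum, Units.coe_prod, ← Finset.prod_subset (Finset.subset_univ (Finset.Iio a))]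
  · refine Finset.prod_congr rfl fun b hb => ?_
    have hb' : b < a := by simpa using hb
    have : σ b ≠ σ a := fun e => hb'.ne (σ.injective e)
    rcases lt_or_gt_of_ne this with g | g
    · simp [hb', g, g.not_gt]
    · simp [hb', g, g.not_gt]; rfl
  · intro b _ hb
    have : ¬ b < a := by simpa using hb
    simp [this]

end Signs

end WL3

namespace WL3

open Finset

section Model

variable {k : Type} [CommRing k] {L : ℤ → Type} [∀ i, AddCommGroup (L i)] [∀ i, Module k (L i)]
variable {n : ℕ}

/-- Bidegrees: a multidegree in auxiliary variables `θ₁, …, θₙ` and a degree in `L`. -/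
abbrev Idx (n : ℕ) := (Fin n → ℕ) × ℤ

/-- The extension of scalars of `L` by auxiliary graded-commutative variables. -/
abbrev Mod (L : ℤ → Type) [∀ i, AddCommGroup (L i)] (n : ℕ) := Π₀ p : Idx n, L p.2

/-- The homogeneous element `θ^S y`. -/
def mono (S : Fin n → ℕ) (i : ℤ) (y : L i) : Mod L n := DFinsupp.single (S, i) y

theorem mono_gcast {S : Fin n → ℕ} {i j : ℤ} (h : i = j) (y : L i) :
    mono S j (gcast h y) = mono S i y := by
  subst h; rfl

theorem mono_zero (S : Fin n → ℕ) (i : ℤ) : mono S i (0 : L i) = 0 := DFinsupp.single_zero _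

theorem mono_add (S : Fin n → ℕ) (i : ℤ) (x y : L i) :
    mono S i (x + y) = mono S i x + mono S i y := DFinsupp.single_add _ _ _

theorem mono_zsmul (S : Fin n → ℕ) (i : ℤ) (c : ℤ) (x : L i) :
    mono S i (c • x) = c • mono S i x := by
  exact map_zsmul (DFinsupp.singleAddHom (fun p : Idx n => L p.2) (S, i)) c x

variable (e : Fin n → ZMod 2)

/-- The parity of `θ^S`. -/
def par (S : Fin n → ℕ) : ZMod 2 := ∑ j, (S j : ZMod 2) * e j

/-- The exponent of the sign in `θ^S θ^T = ± θ^(S+T)`. -/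
def cross (S T : Fin n → ℕ) : ZMod 2 :=
  ∑ i, ∑ j, if j < i then (S i : ZMod 2) * e i * (T j * e j) else 0

theorem par_sum {ι : Type*} (s : Finset ι) (S : ι → Fin n → ℕ) :
    par e (∑ a ∈ s, S a) = ∑ a ∈ s, par e (S a) := by
  unfold par
  rw [Finset.sum_comm]
  refine Finset.sum_congr rfl fun j _ => ?_
  rw [Finset.sum_apply, Nat.cast_sum, Finset.sum_mul]

theorem cross_sum_left {ι : Type*} (s : Finset ι) (S : ι → Fin n → ℕ) (T : Fin n → ℕ) :
    cross e (∑ a ∈ s, S a) T = ∑ a ∈ s, cross e (S a) T := by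
  unfold cross
  symm
  rw [Finset.sum_comm]
  refine Finset.sum_congr rfl fun i _ => ?_
  rw [Finset.sum_comm]
  refine Finset.sum_congr rfl fun j _ => ?_
  split_ifs
  · rw [Finset.sum_apply, Nat.cast_sum, Finset.sum_mul, Finset.sum_mul]
  · simp

theorem cross_sum_right {ι : Type*} (s : Finset ι) (S : Fin n → ℕ) (T : ι → Fin n → ℕ) :
    cross e S (∑ a ∈ s, T a) = ∑ a ∈ s, cross e S (T a) := by
  unfold cross
  symm
  rw [Finset.sum_comm]
  refine Finset.sum_congr rfl fun i _ => ?_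
  rw [Finset.sum_comm]
  refine Finset.sum_congr rfl fun j _ => ?_
  split_ifs
  · rw [Finset.sum_apply, Nat.cast_sum, Finset.sum_mul, Finset.mul_sum]
  · simp

theorem cross_comm {S T : Fin n → ℕ} (h : ∀ j, S j + T j ≤ 1) :
    cross e S T + cross e T S = par e S * par e T := by
  unfold cross par
  rw [Finset.sum_comm (f := fun i j => if j < i then (T i : ZMod 2) * e i * (S j * e j) else 0),
    Finset.sum_mul_sum]
  simp only [← Finset.sum_add_distrib]
  refine Finset.sum_congr rfl fun i _ => Finset.sum_congr rfl fun j _ => ?_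
  rcases lt_trichotomy i j with g | g | g
  · simp [g, g.not_gt]; ring
  · subst g
    have := h i
    rcases (by omega : S i = 0 ∨ T i = 0) with h0 | h0 <;> simp [h0]
  · simp [g, g.not_gt]

/-- Exponent of the sign produced by moving the auxiliary variables in front of the
operation of degree `r` and its arguments. -/
def extractExp {m : ℕ} (r : ℤ) (S : Fin m → Fin n → ℕ) (d : Fin m → ℤ) : ZMod 2 :=
  r * ∑ a, par e (S a) + pairSum fun a b => d a * par e (S b) + cross e (S a) (S b)

open Classical in
/-- The coefficient of the extension of an operation of degree `r` on monomials: a sign, or `0`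
if some variable is repeated. -/
noncomputable def extractCoeff {m : ℕ} (r : ℤ) (S : Fin m → Fin n → ℕ) (d : Fin m → ℤ) : ℤ :=
  if ∀ j, (∑ a, S a) j ≤ 1 then sgn (extractExp e r S d) else 0

/-- The component of a multilinear `MMap` as a `MultilinearMap`. -/
def IsMultilinear.toMultilinearMap {m : ℕ} {r : ℤ} {μ : MMap L L m r} (h : IsMultilinear k μ)
    (d : Fin m → ℤ) : MultilinearMap k (fun j => L (d j)) (L (r + ∑ j, d j)) where
  toFun := μ d
  map_update_add' {inst} x j a b := by
    rw [Subsingleton.elim inst (instDecidableEqFin m)]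
    exact (h d x j).1 a b
  map_update_smul' {inst} x j c a := by
    rw [Subsingleton.elim inst (instDecidableEqFin m)]
    exact (h d x j).2 c a

/-- The extension of a multilinear operation to `Mod L n`. -/
noncomputable def hat {m : ℕ} {r : ℤ} {μ : MMap L L m r} (h : IsMultilinear k μ) :
    MultilinearMap k (fun _ : Fin m => Mod L n) (Mod L n) :=
  LinearMap.compMultilinearMap
    (DFinsupp.lsum ℕ fun t : Fin m → Idx n =>
      (extractCoeff e r (fun j => (t j).1) (fun j => (t j).2)) •
        (DFinsupp.lsingle (R := k) (M := fun p : Idx n => L p.2)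
          ((∑ j, (t j).1, r + ∑ j, (t j).2) : Idx n)))
    (MultilinearMap.dfinsuppFamily fun t : Fin m → Idx n =>
      h.toMultilinearMap (fun j => (t j).2))

theorem hat_mono {m : ℕ} {r : ℤ} {μ : MMap L L m r} (h : IsMultilinear k μ)
    (S : Fin m → Fin n → ℕ) (d : Fin m → ℤ) (y : ∀ j, L (d j)) :
    hat e h (fun j => mono (S j) (d j) (y j))
      = extractCoeff e r S d • mono (∑ j, S j) (r + ∑ j, d j) (μ d y) := by
  unfold hat mono
  rw [LinearMap.compMultilinearMap_apply]
  have := MultilinearMap.dfinsuppFamily_single (R := k) (κ := fun _ => Idx n)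
    (M := fun _ p => L p.2)
    (fun t : Fin m → Idx n => h.toMultilinearMap (fun j => (t j).2))
    (fun j => (S j, d j)) y
  erw [this]
  erw [DFinsupp.lsum_single]
  rfl

end Model

end WL3

namespace WL3

open Finset

section Homogeneous

variable {k : Type} [CommRing k] {L : ℤ → Type} [∀ i, AddCommGroup (L i)] [∀ i, Module k (L i)]
variable {n : ℕ} (e : Fin n → ZMod 2)

/-- The monomials of parity `a`. -/
def monoSet (L : ℤ → Type) [∀ i, AddCommGroup (L i)] (a : ZMod 2) : Set (Mod L n) :=
  {x | ∃ (S : Fin n → ℕ) (i : ℤ) (y : L i), par e S + i = a ∧ x = mono S i y}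

/-- The elements of parity `a`. -/
def Homog (L : ℤ → Type) [∀ i, AddCommGroup (L i)] (a : ZMod 2) : AddSubgroup (Mod L n) :=
  AddSubgroup.closure (monoSet e L a)

/-- Additivity in each variable. -/
def MultiAdd {m : ℕ} {V W : Type} [AddCommGroup V] [AddCommGroup W] (F : (Fin m → V) → W) :
    Prop :=
  ∀ w j x y, F (Function.update w j (x + y))
    = F (Function.update w j x) + F (Function.update w j y)

theorem MultiAdd.update_zero {m : ℕ} {V W : Type} [AddCommGroup V] [AddCommGroup W]
    {F : (Fin m → V) → W} (h : MultiAdd F) (w : Fin m → V) (j : Fin m) :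
    F (Function.update w j 0) = 0 := by
  have := h w j 0 0
  rw [add_zero] at this
  exact left_eq_add.mp this

theorem MultiAdd.update_neg {m : ℕ} {V W : Type} [AddCommGroup V] [AddCommGroup W]
    {F : (Fin m → V) → W} (h : MultiAdd F) (w : Fin m → V) (j : Fin m) (x : V) :
    F (Function.update w j (-x)) = -F (Function.update w j x) := by
  rw [eq_neg_iff_add_eq_zero, ← h, neg_add_cancel, h.update_zero]

theorem MultiAdd.ext_closure {m : ℕ} {V W : Type} [AddCommGroup V] [AddCommGroup W]
    {F G : (Fin m → V) → W} (hF : MultiAdd F) (hG : MultiAdd G) (T : Fin m → Set V)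
    (h : ∀ w, (∀ j, w j ∈ T j) → F w = G w)
    (w : Fin m → V) (hw : ∀ j, w j ∈ AddSubgroup.closure (T j)) : F w = G w := by
  have key : ∀ (s : Finset (Fin m)) (w : Fin m → V),
      (∀ j ∈ s, w j ∈ AddSubgroup.closure (T j)) → (∀ j, j ∉ s → w j ∈ T j) →
        F w = G w := by
    intro s
    induction s using Finset.induction_on with
    | empty => exact fun w _ h2 => h w fun j => h2 j (Finset.notMem_empty j)
    | insert b s hb ih =>
      intro w h1 h2
      have hx : ∀ x ∈ AddSubgroup.closure (T b),
          F (Function.update w b x) = G (Function.update w b x) := by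
        intro x hx
        induction hx using AddSubgroup.closure_induction with
        | mem x hx =>
          refine ih _ (fun j hj => ?_) (fun j hj => ?_)
          · have : j ≠ b := fun e => hb (e ▸ hj)
            rw [Function.update_of_ne this]
            exact h1 j (Finset.mem_insert_of_mem hj)
          · by_cases hjb : j = b
            · subst hjb
              rwa [Function.update_self]
            · rw [Function.update_of_ne hjb]
              exact h2 j (by simp [hjb, hj])
        | zero => rw [hF.update_zero, hG.update_zero]
        | add x y _ _ hx hy => rw [hF, hG, hx, hy]
        | neg x _ hx => rw [hF.update_neg, hG.update_neg, hx]
      have := hx (w b) (h1 b (Finset.mem_insert_self b s))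
      rwa [Function.update_eq_self] at this
  exact key Finset.univ w (fun j _ => hw j) (fun j hj => absurd (Finset.mem_univ j) hj)

theorem MultiAdd.ext_homog {m : ℕ} {W : Type} [AddCommGroup W]
    {F G : (Fin m → Mod L n) → W} (hF : MultiAdd F) (hG : MultiAdd G)
    (a : Fin m → ZMod 2)
    (h : ∀ (S : Fin m → Fin n → ℕ) (d : Fin m → ℤ) (y : ∀ j, L (d j)),
      (∀ j, par e (S j) + d j = a j) →
        F (fun j => mono (S j) (d j) (y j)) = G (fun j => mono (S j) (d j) (y j)))
    (w : Fin m → Mod L n) (hw : ∀ j, w j ∈ Homog e L (a j)) : F w = G w := by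
  refine hF.ext_closure hG (fun j => monoSet e L (a j)) (fun w h3 => ?_) w hw
  choose S d y hp hm using h3
  rw [show w = fun j => mono (S j) (d j) (y j) from funext hm]
  exact h S d y hp

theorem MultilinearMap.multiAdd {m : ℕ} {V W : Type} [AddCommGroup V] [AddCommGroup W]
    [Module k V] [Module k W] (f : MultilinearMap k (fun _ : Fin m => V) W) :
    MultiAdd fun w => f w := fun w j x y => f.map_update_add w j x y

theorem MultiAdd.zsmul {m : ℕ} {V W : Type} [AddCommGroup V] [AddCommGroup W]
    {F : (Fin m → V) → W} (h : MultiAdd F) (c : ℤ) : MultiAdd fun w => c • F w :=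
  fun w j x y => by simp only [h w j x y, smul_add]

theorem MultiAdd.add {m : ℕ} {V W : Type} [AddCommGroup V] [AddCommGroup W]
    {F G : (Fin m → V) → W} (hF : MultiAdd F) (hG : MultiAdd G) :
    MultiAdd fun w => F w + G w :=
  fun w j x y => by simp only [hF w j x y, hG w j x y]; abel

theorem MultiAdd.comp_equiv {m : ℕ} {V W : Type} [AddCommGroup V] [AddCommGroup W]
    {F : (Fin m → V) → W} (h : MultiAdd F) (σ : Equiv.Perm (Fin m)) :
    MultiAdd fun w => F (fun j => w (σ j)) := fun w j x y => by
  have : ∀ z, (fun i => Function.update w j z (σ i))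
      = Function.update (fun i => w (σ i)) (σ.symm j) z := by
    intro z; ext1 i
    by_cases hi : σ i = j
    · subst hi; simp
    · have hi' : i ≠ σ.symm j := fun h => hi (by rw [h]; simp)
      rw [Function.update_of_ne hi, Function.update_of_ne hi']
  simp only [this]
  exact h _ _ _ _

theorem MultiAdd.hom_comp {m : ℕ} {V W X : Type} [AddCommGroup V] [AddCommGroup W]
    [AddCommGroup X] {F : (Fin m → V) → W} (h : MultiAdd F) (g : (Fin 1 → W) → X)
    (hg : MultiAdd g) : MultiAdd fun w => g fun _ => F w := fun w j x y => by
  have := hg (fun _ => 0) 0 (F (Function.update w j x)) (F (Function.update w j y))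
  have e : ∀ z : W, Function.update (fun _ : Fin 1 => (0 : W)) 0 z = fun _ => z := by
    intro z; ext1 i; rw [Subsingleton.elim i 0]; simp
  simp only [h w j x y]
  simpa only [e] using this

theorem block_cases (a b c : ℕ) (j : Fin (a + b + c)) :
    (∃ i, j = Fin.castAdd c (Fin.castAdd b i)) ∨ (∃ i, j = Fin.castAdd c (Fin.natAdd a i)) ∨
      ∃ i, j = Fin.natAdd (a + b) i := by
  induction j using Fin.addCases with
  | left j =>
    induction j using Fin.addCases with
    | left j => exact Or.inl ⟨j, rfl⟩
    | right j => exact Or.inr (Or.inl ⟨j, rfl⟩)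
  | right j => exact Or.inr (Or.inr ⟨j, rfl⟩)

/-- Insertion of a block: the arguments of `μ` in `μ ∘ᵢ ν`. -/
def insertBlock {V : Type} (m₁ m₂ n : ℕ) (w : Fin (m₁ + n + m₂) → V) (v : V) :
    Fin (m₁ + 1 + m₂) → V :=
  Fin.append (Fin.append (fun j => w (Fin.castAdd m₂ (Fin.castAdd n j))) fun _ : Fin 1 => v)
    fun j => w (Fin.natAdd (m₁ + n) j)

theorem MultiAdd.pcomp {V : Type} [AddCommGroup V] {m₁ m₂ n : ℕ}
    {F : (Fin (m₁ + 1 + m₂) → V) → V} {G : (Fin n → V) → V} (hF : MultiAdd F)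
    (hG : MultiAdd G) :
    MultiAdd fun w : Fin (m₁ + n + m₂) → V =>
      F (insertBlock m₁ m₂ n w (G fun j => w (Fin.castAdd m₂ (Fin.natAdd m₁ j)))) := by
  have up : ∀ {p : ℕ} (w : Fin p → V) (j : Fin p) (z : V) (i : Fin p),
      Function.update w j z i = if i = j then z else w i := by
    intro p w j z i; simp [Function.update_apply]
  intro w j x y
  obtain ⟨j, rfl⟩ | ⟨j, rfl⟩ | ⟨j, rfl⟩ := block_cases m₁ n m₂ j
  · have h1 : ∀ (z : V), (fun i => Function.update w (Fin.castAdd m₂ (Fin.castAdd n j)) z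
        (Fin.castAdd m₂ (Fin.natAdd m₁ i))) = fun i : Fin n =>
          w (Fin.castAdd m₂ (Fin.natAdd m₁ i)) := by
      intro z; ext1 i; rw [up, if_neg]; simp [Fin.ext_iff]; omega
    have h2 : ∀ (z v : V), insertBlock m₁ m₂ n
        (Function.update w (Fin.castAdd m₂ (Fin.castAdd n j)) z) v
        = Function.update (insertBlock m₁ m₂ n w v) (Fin.castAdd m₂ (Fin.castAdd 1 j)) z := by
      intro z v; ext1 i
      obtain ⟨i, rfl⟩ | ⟨i, rfl⟩ | ⟨i, rfl⟩ := block_cases m₁ 1 m₂ i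
      · simp [insertBlock, up, Fin.ext_iff]
      · simp only [insertBlock, up, Fin.append_left, Fin.append_right]
        rw [if_neg]; simp [Fin.ext_iff]; omega
      · simp only [insertBlock, up, Fin.append_right]
        rw [if_neg, if_neg] <;> simp [Fin.ext_iff] <;> omega
    simp only [h1, h2]
    exact hF _ _ _ _
  · have h1 : ∀ (z : V), (fun i => Function.update w (Fin.castAdd m₂ (Fin.natAdd m₁ j)) z
        (Fin.castAdd m₂ (Fin.natAdd m₁ i))) = Function.update (fun i : Fin n =>
          w (Fin.castAdd m₂ (Fin.natAdd m₁ i))) j z := by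
      intro z; ext1 i; simp [up, Fin.ext_iff]
    have h2 : ∀ (z v : V), insertBlock m₁ m₂ n
        (Function.update w (Fin.castAdd m₂ (Fin.natAdd m₁ j)) z) v
        = Function.update (insertBlock m₁ m₂ n w 0) (Fin.castAdd m₂ (Fin.natAdd m₁ 0)) v := by
      intro z v; ext1 i
      obtain ⟨i, rfl⟩ | ⟨i, rfl⟩ | ⟨i, rfl⟩ := block_cases m₁ 1 m₂ i
      · simp only [insertBlock, up, Fin.append_left]
        rw [if_neg, if_neg] <;> simp [Fin.ext_iff] <;> omega
      · simp [insertBlock, up, Fin.append_left, Fin.append_right, Fin.ext_iff]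
      · simp only [insertBlock, up, Fin.append_right]
        rw [if_neg, if_neg] <;> simp [Fin.ext_iff] <;> omega
    simp only [h1, h2]
    rw [hG, hF]
  · have h1 : ∀ (z : V), (fun i => Function.update w (Fin.natAdd (m₁ + n) j) z
        (Fin.castAdd m₂ (Fin.natAdd m₁ i))) = fun i : Fin n =>
          w (Fin.castAdd m₂ (Fin.natAdd m₁ i)) := by
      intro z; ext1 i; rw [up, if_neg]; simp [Fin.ext_iff]; omega
    have h2 : ∀ (z v : V), insertBlock m₁ m₂ n
        (Function.update w (Fin.natAdd (m₁ + n) j) z) v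
        = Function.update (insertBlock m₁ m₂ n w v) (Fin.natAdd (m₁ + 1) j) z := by
      intro z v; ext1 i
      obtain ⟨i, rfl⟩ | ⟨i, rfl⟩ | ⟨i, rfl⟩ := block_cases m₁ 1 m₂ i
      · simp only [insertBlock, up, Fin.append_left]
        rw [if_neg, if_neg] <;> simp [Fin.ext_iff] <;> omega
      · simp only [insertBlock, up, Fin.append_left, Fin.append_right]
        rw [if_neg]; simp [Fin.ext_iff]; omega
      · simp [insertBlock, up, Fin.append_right, Fin.ext_iff]
    simp only [h1, h2]
    exact hF _ _ _ _

end Homogeneous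

end WL3

namespace WL3

open Finset

section Multilinearity

variable {k : Type} [CommRing k] {L : ℤ → Type} [∀ i, AddCommGroup (L i)] [∀ i, Module k (L i)]

theorem gcast_add {i j : ℤ} (h : i = j) (x y : L i) :
    gcast h (x + y) = gcast h x + gcast h y := by subst h; rfl

theorem gcast_smul {i j : ℤ} (h : i = j) (c : k) (x : L i) :
    gcast h (c • x) = c • gcast h x := by subst h; rfl

theorem gcast_zsmul {i j : ℤ} (h : i = j) (c : ℤ) (x : L i) :
    gcast h (c • x) = c • gcast h x := by subst h; rfl

theorem IsMultilinear.zero {m : ℕ} {r : ℤ} : IsMultilinear k (0 : MMap L L m r) :=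
  fun _ _ _ => ⟨fun _ _ => (add_zero _).symm, fun _ _ => (smul_zero _).symm⟩

theorem IsMultilinear.add {m : ℕ} {r : ℤ} {μ ν : MMap L L m r} (hμ : IsMultilinear k μ)
    (hν : IsMultilinear k ν) : IsMultilinear k (μ + ν) := by
  refine fun d x j => ⟨fun a b => ?_, fun c a => ?_⟩
  · simp only [Pi.add_apply, (hμ d x j).1, (hν d x j).1]; abel
  · simp only [Pi.add_apply, (hμ d x j).2, (hν d x j).2, smul_add]

theorem IsMultilinear.smul {m : ℕ} {r : ℤ} {μ : MMap L L m r} (hμ : IsMultilinear k μ)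
    (c : k) : IsMultilinear k (c • μ) := by
  refine fun d x j => ⟨fun a b => ?_, fun c' a => ?_⟩
  · simp only [Pi.smul_apply, (hμ d x j).1, smul_add]
  · simp only [Pi.smul_apply, (hμ d x j).2, smul_comm c c']

theorem IsMultilinear.zsmul {m : ℕ} {r : ℤ} {μ : MMap L L m r} (hμ : IsMultilinear k μ)
    (c : ℤ) : IsMultilinear k (c • μ) := by
  refine fun d x j => ⟨fun a b => ?_, fun c' a => ?_⟩
  · simp only [Pi.smul_apply, (hμ d x j).1, smul_add]
  · simp only [Pi.smul_apply, (hμ d x j).2, smul_comm c c']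

theorem IsMultilinear.neg {m : ℕ} {r : ℤ} {μ : MMap L L m r} (hμ : IsMultilinear k μ) :
    IsMultilinear k (-μ) := by
  rw [← neg_one_zsmul]; exact hμ.zsmul _

theorem IsMultilinear.sub {m : ℕ} {r : ℤ} {μ ν : MMap L L m r} (hμ : IsMultilinear k μ)
    (hν : IsMultilinear k ν) : IsMultilinear k (μ - ν) := by
  rw [sub_eq_add_neg]; exact hμ.add hν.neg

theorem IsMultilinear.sum {ι : Type*} (s : Finset ι) {m : ℕ} {r : ℤ} {μ : ι → MMap L L m r}
    (h : ∀ i, IsMultilinear k (μ i)) : IsMultilinear k (∑ i ∈ s, μ i) := by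
  classical
  induction s using Finset.induction_on with
  | empty => exact IsMultilinear.zero
  | insert a s ha ih => rw [Finset.sum_insert ha]; exact (h a).add ih

theorem IsMultilinear.pa {m : ℕ} {r : ℤ} {μ : MMap L L m r} (hμ : IsMultilinear k μ)
    (σ : Equiv.Perm (Fin m)) : IsMultilinear k (pa σ μ) := by
  intro d x j
  obtain ⟨i, rfl⟩ := σ.symm.surjective j
  have key : ∀ a, (fun l => Function.update x (σ.symm i) a (σ.symm l))
      = Function.update (fun l => x (σ.symm l)) i a := by
    intro a
    ext1 l
    by_cases h : l = i
    · subst h; simp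
    · rw [Function.update_of_ne h, Function.update_of_ne (fun g => h (σ.symm.injective g))]
  refine ⟨fun a b => ?_, fun c a => ?_⟩
  · simp only [WL3.pa, key]
    rw [(hμ _ _ i).1, gcast_add, smul_add]
  · simp only [WL3.pa, key]
    rw [(hμ _ _ i).2, gcast_smul, smul_comm]

/-- The arguments of `μ` in `μ ∘ᵢ ν`. -/
def outArgs (m₁ m₂ n : ℕ) (s : ℤ) (d : Fin (m₁ + n + m₂) → ℤ) (x : ∀ j, L (d j))
    (v : L (s + ∑ j : Fin n, d (Fin.castAdd m₂ (Fin.natAdd m₁ j)))) :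
    ∀ j, L (outDeg m₁ m₂ n s d j) :=
  fun j => Fin.addCases (motive := fun t => L (outDeg m₁ m₂ n s d t))
          (fun j' => Fin.addCases (motive := fun t => L (outDeg m₁ m₂ n s d (Fin.castAdd m₂ t)))
            (fun j1 => gcast (outDeg_left m₁ m₂ n s d j1).symm
              (x (Fin.castAdd m₂ (Fin.castAdd n j1))))
            (fun j0 => gcast (outDeg_mid m₁ m₂ n s d j0).symm v)
            j')
          (fun j3 => gcast (outDeg_right m₁ m₂ n s d j3).symm (x (Fin.natAdd (m₁ + n) j3)))
          j

section OutArgs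

variable {M : ℤ → Type} (m₁ m₂ n : ℕ) (s : ℤ) (d : Fin (m₁ + n + m₂) → ℤ) (x : ∀ j, M (d j))
    (v : M (s + ∑ j : Fin n, d (Fin.castAdd m₂ (Fin.natAdd m₁ j))))

theorem outArgs_left (j : Fin m₁) :
    outArgs m₁ m₂ n s d x v (Fin.castAdd m₂ (Fin.castAdd 1 j))
      = gcast (outDeg_left m₁ m₂ n s d j).symm (x (Fin.castAdd m₂ (Fin.castAdd n j))) := by
  simp [outArgs]

theorem outArgs_mid (j : Fin 1) :
    outArgs m₁ m₂ n s d x v (Fin.castAdd m₂ (Fin.natAdd m₁ j))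
      = gcast (outDeg_mid m₁ m₂ n s d j).symm v := by
  simp [outArgs]

theorem outArgs_right (j : Fin m₂) :
    outArgs m₁ m₂ n s d x v (Fin.natAdd (m₁ + 1) j)
      = gcast (outDeg_right m₁ m₂ n s d j).symm (x (Fin.natAdd (m₁ + n) j)) := by
  simp [outArgs]

theorem outArgs_update_left (j : Fin m₁) (a : M (d (Fin.castAdd m₂ (Fin.castAdd n j)))) :
    outArgs m₁ m₂ n s d (Function.update x (Fin.castAdd m₂ (Fin.castAdd n j)) a) v
      = Function.update (outArgs m₁ m₂ n s d x v) (Fin.castAdd m₂ (Fin.castAdd 1 j))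
        (gcast (outDeg_left m₁ m₂ n s d j).symm a) := by
  ext1 i
  obtain ⟨i, rfl⟩ | ⟨i, rfl⟩ | ⟨i, rfl⟩ := block_cases m₁ 1 m₂ i
  · by_cases h : i = j
    · subst h; rw [outArgs_left, Function.update_self, Function.update_self]
    · rw [outArgs_left, Function.update_of_ne, Function.update_of_ne, outArgs_left]
      all_goals simp [Fin.ext_iff] at h ⊢; omega
  · rw [outArgs_mid, Function.update_of_ne, outArgs_mid]
    simp [Fin.ext_iff]; omega
  · rw [outArgs_right, Function.update_of_ne, Function.update_of_ne, outArgs_right]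
    all_goals simp [Fin.ext_iff]; omega

theorem outArgs_update_right (j : Fin m₂) (a : M (d (Fin.natAdd (m₁ + n) j))) :
    outArgs m₁ m₂ n s d (Function.update x (Fin.natAdd (m₁ + n) j) a) v
      = Function.update (outArgs m₁ m₂ n s d x v) (Fin.natAdd (m₁ + 1) j)
        (gcast (outDeg_right m₁ m₂ n s d j).symm a) := by
  ext1 i
  obtain ⟨i, rfl⟩ | ⟨i, rfl⟩ | ⟨i, rfl⟩ := block_cases m₁ 1 m₂ i
  · rw [outArgs_left, Function.update_of_ne, Function.update_of_ne, outArgs_left]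
    all_goals simp [Fin.ext_iff]; omega
  · rw [outArgs_mid, Function.update_of_ne, outArgs_mid]
    simp [Fin.ext_iff]; omega
  · by_cases h : i = j
    · subst h; rw [outArgs_right, Function.update_self, Function.update_self]
    · rw [outArgs_right, Function.update_of_ne, Function.update_of_ne, outArgs_right]
      all_goals simp [Fin.ext_iff] at h ⊢; omega

end OutArgs

theorem outArgs_update_mid (m₁ m₂ n : ℕ) (s : ℤ) (d : Fin (m₁ + n + m₂) → ℤ) (x : ∀ j, L (d j))
    (v : L (s + ∑ j : Fin n, d (Fin.castAdd m₂ (Fin.natAdd m₁ j))))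
    (j : Fin n) (a : L (d (Fin.castAdd m₂ (Fin.natAdd m₁ j)))) :
    outArgs m₁ m₂ n s d (Function.update x (Fin.castAdd m₂ (Fin.natAdd m₁ j)) a) v
      = Function.update (outArgs m₁ m₂ n s d x 0) (Fin.castAdd m₂ (Fin.natAdd m₁ 0))
        (gcast (outDeg_mid m₁ m₂ n s d 0).symm v) := by
  ext1 i
  obtain ⟨i, rfl⟩ | ⟨i, rfl⟩ | ⟨i, rfl⟩ := block_cases m₁ 1 m₂ i
  · rw [outArgs_left, Function.update_of_ne, Function.update_of_ne, outArgs_left]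
    all_goals simp [Fin.ext_iff]; omega
  · rw [Subsingleton.elim i 0, outArgs_mid, Function.update_self]
  · rw [outArgs_right, Function.update_of_ne, Function.update_of_ne, outArgs_right]
    all_goals simp [Fin.ext_iff]; omega

theorem pcomp_apply (m₁ m₂ : ℕ) {n : ℕ} {r s : ℤ} (μ : MMap L L (m₁ + 1 + m₂) r)
    (ν : MMap L L n s) (d : Fin (m₁ + n + m₂) → ℤ) (x : ∀ j, L (d j)) :
    pcomp m₁ m₂ μ ν d x
      = ((-1 : ℤ) ^ (s * ∑ j : Fin m₁, d (Fin.castAdd m₂ (Fin.castAdd n j))).natAbs) •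
        gcast (outDeg_sum m₁ m₂ n r s d) (μ (outDeg m₁ m₂ n s d)
          (outArgs m₁ m₂ n s d x (ν (fun j => d (Fin.castAdd m₂ (Fin.natAdd m₁ j)))
            (fun j => x (Fin.castAdd m₂ (Fin.natAdd m₁ j)))))) := rfl

theorem IsMultilinear.pcomp {m₁ m₂ n : ℕ} {r s : ℤ} {μ : MMap L L (m₁ + 1 + m₂) r}
    {ν : MMap L L n s} (hμ : IsMultilinear k μ) (hν : IsMultilinear k ν) :
    IsMultilinear k (pcomp m₁ m₂ μ ν) := by
  intro d x j
  obtain ⟨j, rfl⟩ | ⟨j, rfl⟩ | ⟨j, rfl⟩ := block_cases m₁ n m₂ j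
  · have h1 : ∀ a, (fun i : Fin n => Function.update x (Fin.castAdd m₂ (Fin.castAdd n j)) a
        (Fin.castAdd m₂ (Fin.natAdd m₁ i))) = fun i => x (Fin.castAdd m₂ (Fin.natAdd m₁ i)) := by
      intro a; ext1 i; rw [Function.update_of_ne]; simp [Fin.ext_iff]; omega
    refine ⟨fun a b => ?_, fun c a => ?_⟩
    · simp only [pcomp_apply, h1, outArgs_update_left, gcast_add, (hμ _ _ _).1, smul_add]
    · simp only [pcomp_apply, h1, outArgs_update_left, gcast_smul, (hμ _ _ _).2]
      rw [smul_comm]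
  · have h1 : ∀ a, (fun i : Fin n => Function.update x (Fin.castAdd m₂ (Fin.natAdd m₁ j)) a
        (Fin.castAdd m₂ (Fin.natAdd m₁ i)))
        = Function.update (fun i => x (Fin.castAdd m₂ (Fin.natAdd m₁ i))) j a := by
      intro a; ext1 i
      by_cases h : i = j
      · subst h; simp
      · rw [Function.update_of_ne h, Function.update_of_ne]
        simp [Fin.ext_iff] at h ⊢; omega
    refine ⟨fun a b => ?_, fun c a => ?_⟩
    · simp only [pcomp_apply, h1, outArgs_update_mid, gcast_add, (hμ _ _ _).1, (hν _ _ _).1,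
        smul_add]
    · simp only [pcomp_apply, h1, outArgs_update_mid, gcast_smul, (hμ _ _ _).2, (hν _ _ _).2]
      rw [smul_comm]
  · have h1 : ∀ a, (fun i : Fin n => Function.update x (Fin.natAdd (m₁ + n) j) a
        (Fin.castAdd m₂ (Fin.natAdd m₁ i))) = fun i => x (Fin.castAdd m₂ (Fin.natAdd m₁ i)) := by
      intro a; ext1 i; rw [Function.update_of_ne]; simp [Fin.ext_iff]; omega
    refine ⟨fun a b => ?_, fun c a => ?_⟩
    · simp only [pcomp_apply, h1, outArgs_update_right, gcast_add, (hμ _ _ _).1, smul_add]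
    · simp only [pcomp_apply, h1, outArgs_update_right, gcast_smul, (hμ _ _ _).2]
      rw [smul_comm]

theorem IsMultilinear.pc {R : ℤ} {m₁ m₂ n : ℕ} {r s : ℤ} {μ : MMap L L (m₁ + 1 + m₂) r}
    {ν : MMap L L n s} (hμ : IsMultilinear k μ) (hν : IsMultilinear k ν) (h : r + s = R) :
    IsMultilinear k (pc R m₁ m₂ μ ν h) := by
  subst h
  exact hμ.pcomp hν

theorem IsMultilinear.comp₁ {n : ℕ} {r s : ℤ} {μ : MMap L L 1 r}
    {ν : MMap L L n s} (hμ : IsMultilinear k μ) (hν : IsMultilinear k ν) :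
    IsMultilinear k (comp₁ μ ν) := by
  intro d x j
  have h : ∀ v : L (s + ∑ j, d j), (fun _ : Fin 1 => v)
      = Function.update (fun _ : Fin 1 => (0 : L (s + ∑ j, d j))) 0 v := by
    intro v; ext1 i; rw [Subsingleton.elim i 0, Function.update_self]
  refine ⟨fun a b => ?_, fun c a => ?_⟩
  · simp only [WL3.comp₁]
    rw [(hν d x j).1, h, (hμ _ _ _).1, gcast_add, ← h, ← h]
  · simp only [WL3.comp₁]
    rw [(hν d x j).2, h, (hμ _ _ _).2, gcast_smul, ← h]

theorem IsMultilinear.fc1 {R : ℤ} {n : ℕ} {r s : ℤ} {μ : MMap L L 1 r}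
    {ν : MMap L L n s} (hμ : IsMultilinear k μ) (hν : IsMultilinear k ν) (h : r + s = R) :
    IsMultilinear k (fc1 R μ ν h) := by
  subst h
  exact hμ.comp₁ hν

end Multilinearity

end WL3

namespace WL3

open Finset

section HatAlgebra

variable {k : Type} [CommRing k] {L : ℤ → Type} [∀ i, AddCommGroup (L i)] [∀ i, Module k (L i)]
variable {n : ℕ} (e : Fin n → ZMod 2)

theorem mono_mem_homog {a : ZMod 2} {S : Fin n → ℕ} {i : ℤ} (y : L i) (h : par e S + i = a) :
    mono S i y ∈ Homog e L a :=
  AddSubgroup.subset_closure ⟨S, i, y, h, rfl⟩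

theorem hat_mem_homog {m : ℕ} {r : ℤ} {μ : MMap L L m r} (hμ : IsMultilinear k μ)
    (a : Fin m → ZMod 2) (w : Fin m → Mod L n) (hw : ∀ j, w j ∈ Homog e L (a j)) :
    hat e hμ w ∈ Homog e L (r + ∑ j, a j) := by
  rw [← QuotientAddGroup.eq_zero_iff]
  refine MultiAdd.ext_homog (e := e) (F := fun w => (hat e hμ w : Mod L n ⧸ Homog e L _))
    (G := fun _ => 0) (fun w j x y => ?_) (fun w j x y => (add_zero _).symm) a (fun S d y h => ?_)
    w hw
  · simp only [MultilinearMap.map_update_add]; rfl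
  · rw [QuotientAddGroup.eq_zero_iff, hat_mono, ← mono_zsmul]
    refine mono_mem_homog e _ ?_
    rw [par_sum]
    push_cast
    rw [← Finset.sum_congr rfl fun j _ => h j, Finset.sum_add_distrib]
    ring

theorem hat_congr {m : ℕ} {r : ℤ} {μ ν : MMap L L m r} (hμ : IsMultilinear k μ)
    (hν : IsMultilinear k ν) (h : μ = ν) (w : Fin m → Mod L n) : hat e hμ w = hat e hν w := by
  subst h; rfl

theorem hat_add {m : ℕ} {r : ℤ} {μ ν : MMap L L m r} (hμ : IsMultilinear k μ)
    (hν : IsMultilinear k ν) (h : IsMultilinear k (μ + ν)) (a : Fin m → ZMod 2)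
    (w : Fin m → Mod L n) (hw : ∀ j, w j ∈ Homog e L (a j)) :
    hat e h w = hat e hμ w + hat e hν w := by
  refine MultiAdd.ext_homog (e := e) (F := fun w => hat e h w)
    (G := fun w => hat e hμ w + hat e hν w) (MultilinearMap.multiAdd _)
    ((MultilinearMap.multiAdd _).add (MultilinearMap.multiAdd _)) a (fun S d y h => ?_) w hw
  simp only [hat_mono, Pi.add_apply, mono_add, smul_add]

theorem hat_zsmul {m : ℕ} {r : ℤ} {μ : MMap L L m r} (hμ : IsMultilinear k μ) (c : ℤ)
    (h : IsMultilinear k (c • μ)) (a : Fin m → ZMod 2)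
    (w : Fin m → Mod L n) (hw : ∀ j, w j ∈ Homog e L (a j)) :
    hat e h w = c • hat e hμ w := by
  refine MultiAdd.ext_homog (e := e) (F := fun w => hat e h w)
    (G := fun w => c • hat e hμ w) (MultilinearMap.multiAdd _)
    ((MultilinearMap.multiAdd _).zsmul c) a (fun S d y h => ?_) w hw
  simp only [hat_mono, Pi.smul_apply, mono_zsmul]
  rw [smul_comm]

theorem hat_zero {m : ℕ} {r : ℤ} (h : IsMultilinear k (0 : MMap L L m r))
    (a : Fin m → ZMod 2) (w : Fin m → Mod L n) (hw : ∀ j, w j ∈ Homog e L (a j)) :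
    hat e h w = 0 := by
  refine MultiAdd.ext_homog (e := e) (F := fun w => hat e h w)
    (G := fun _ => 0) (MultilinearMap.multiAdd _)
    (fun _ _ _ _ => (add_zero _).symm) a (fun S d y h => ?_) w hw
  simp only [hat_mono, Pi.zero_apply, mono_zero, smul_zero]

theorem hat_pa {m : ℕ} {r : ℤ} {μ : MMap L L m r} (hμ : IsMultilinear k μ)
    (σ : Equiv.Perm (Fin m)) (h : IsMultilinear k (pa σ μ)) (a : Fin m → ZMod 2)
    (w : Fin m → Mod L n) (hw : ∀ j, w j ∈ Homog e L (a j)) :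
    hat e h w = ksgn a σ • hat e hμ fun j => w (σ.symm j) := by
  refine MultiAdd.ext_homog (e := e) (F := fun w => hat e h w)
    (G := fun w => ksgn a σ • hat e hμ fun j => w (σ.symm j)) (MultilinearMap.multiAdd _)
    (((MultilinearMap.multiAdd (hat e hμ)).comp_equiv σ.symm).zsmul _) a (fun S d y ha => ?_) w hw
  have hS : ∑ j, S (σ.symm j) = ∑ j, S j := Equiv.sum_comp σ.symm S
  simp only [hat_mono, pa, mono_zsmul, mono_gcast, hS]
  rw [smul_smul, smul_smul, koszulSign_eq]
  congr 1
  unfold extractCoeff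
  rw [hS]
  split_ifs with hle
  · unfold ksgn
    rw [← sgn_add, ← sgn_add]
    congr 1
    unfold extractExp
    rw [Equiv.sum_comp σ.symm fun j => par e (S j)]
    have h1 := pairSum_perm σ fun a b => (d a : ZMod 2) * par e (S b) + cross e (S a) (S b)
    have h2 : invSum σ (fun i j => a i * a j) = invSum σ (fun i j => (d i : ZMod 2) * d j)
        + invSum σ fun a b => (d a : ZMod 2) * par e (S b) + cross e (S a) (S b)
          + ((d b : ZMod 2) * par e (S a) + cross e (S b) (S a)) := by
      unfold invSum
      simp only [← Finset.sum_add_distrib]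
      refine Finset.sum_congr rfl fun i _ => Finset.sum_congr rfl fun j _ => ?_
      split_ifs with hij
      · have hc : cross e (S i) (S j) + cross e (S j) (S i) = par e (S i) * par e (S j) := by
          refine cross_comm e fun l => le_trans ?_ (hle l)
          rw [Finset.sum_apply, ← Finset.sum_pair (f := fun c => S c l) hij.1.ne]
          exact Finset.sum_le_sum_of_subset (Finset.subset_univ _)
        rw [← ha i, ← ha j]
        linear_combination -hc
      · simp
    rw [h2, ← h1]
    have := zmod2_add_self (pairSum fun a b =>
      (d (σ.symm a) : ZMod 2) * par e (S (σ.symm b)) + cross e (S (σ.symm a)) (S (σ.symm b)))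
    linear_combination -this
  · simp

theorem MultiAdd.update_zsmul {m : ℕ} {V W : Type} [AddCommGroup V] [AddCommGroup W]
    {F : (Fin m → V) → W} (h : MultiAdd F) (w : Fin m → V) (j : Fin m) (c : ℤ) (x : V) :
    F (Function.update w j (c • x)) = c • F (Function.update w j x) :=
  map_zsmul (AddMonoidHom.mk' (fun x => F (Function.update w j x)) (h w j)) c x

theorem insertBlock_eq_update {V : Type} [Zero V] (m₁ m₂ n : ℕ) (w : Fin (m₁ + n + m₂) → V)
    (v : V) : insertBlock m₁ m₂ n w v
      = Function.update (insertBlock m₁ m₂ n w 0) (Fin.castAdd m₂ (Fin.natAdd m₁ 0)) v := by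
  ext1 i
  obtain ⟨i, rfl⟩ | ⟨i, rfl⟩ | ⟨i, rfl⟩ := block_cases m₁ 1 m₂ i
  · rw [Function.update_of_ne]
    · simp only [insertBlock, Fin.append_left]
    · simp [Fin.ext_iff]; omega
  · simp [insertBlock, Fin.append_left, Fin.append_right, Subsingleton.elim i 0]
  · rw [Function.update_of_ne]
    · simp only [insertBlock, Fin.append_right]
    · simp [Fin.ext_iff]; omega

theorem insertBlock_left {V : Type} (m₁ m₂ n : ℕ) (w : Fin (m₁ + n + m₂) → V) (v : V)
    (j : Fin m₁) : insertBlock m₁ m₂ n w v (Fin.castAdd m₂ (Fin.castAdd 1 j))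
      = w (Fin.castAdd m₂ (Fin.castAdd n j)) := by
  simp [insertBlock, Fin.append_left]

theorem insertBlock_mid {V : Type} (m₁ m₂ n : ℕ) (w : Fin (m₁ + n + m₂) → V) (v : V)
    (j : Fin 1) : insertBlock m₁ m₂ n w v (Fin.castAdd m₂ (Fin.natAdd m₁ j)) = v := by
  simp [insertBlock, Fin.append_left, Fin.append_right]

theorem insertBlock_right {V : Type} (m₁ m₂ n : ℕ) (w : Fin (m₁ + n + m₂) → V) (v : V)
    (j : Fin m₂) : insertBlock m₁ m₂ n w v (Fin.natAdd (m₁ + 1) j)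
      = w (Fin.natAdd (m₁ + n) j) := by
  simp [insertBlock, Fin.append_right]

theorem insertBlock_sum {V : Type} [AddCommMonoid V] (m₁ m₂ n : ℕ) (w : Fin (m₁ + n + m₂) → V) :
    ∑ j, insertBlock m₁ m₂ n w (∑ j, w (Fin.castAdd m₂ (Fin.natAdd m₁ j))) j = ∑ j, w j := by
  simp only [Fin.sum_univ_add, insertBlock_left, insertBlock_mid, insertBlock_right,
    Fin.sum_univ_one]

theorem extractExp_insertBlock (m₁ m₂ m : ℕ) (r s : ℤ) (S : Fin (m₁ + m + m₂) → Fin n → ℕ)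
    (d : Fin (m₁ + m + m₂) → ℤ) :
    extractExp e (r + s) S d
        + s * ∑ j : Fin m₁, (d (Fin.castAdd m₂ (Fin.castAdd m j)) : ZMod 2)
      = s * (∑ j : Fin m₁, (par e (S (Fin.castAdd m₂ (Fin.castAdd m j)))
            + d (Fin.castAdd m₂ (Fin.castAdd m j))))
        + extractExp e s (fun j : Fin m => S (Fin.castAdd m₂ (Fin.natAdd m₁ j)))
            (fun j => d (Fin.castAdd m₂ (Fin.natAdd m₁ j)))
        + extractExp e r (insertBlock m₁ m₂ m S (∑ j, S (Fin.castAdd m₂ (Fin.natAdd m₁ j))))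
            (outDeg m₁ m₂ m s d) := by
  unfold extractExp
  simp only [pairSum_add_index, pairSum_one, Fin.sum_univ_add, insertBlock_left, insertBlock_mid,
    insertBlock_right, outDeg_left, outDeg_mid, outDeg_right, par_sum, cross_sum_left,
    cross_sum_right, Fin.sum_univ_one, Finset.sum_add_distrib, Int.cast_add, Int.cast_sum,
    ← Finset.mul_sum, ← Finset.sum_mul, add_mul, mul_add]
  rw [Finset.sum_comm (f := fun (i : Fin m₂) (j : Fin m) =>
    cross e (S (Fin.castAdd m₂ (Fin.natAdd m₁ j))) (S (Fin.natAdd (m₁ + m) i)))]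
  ring

theorem hat_pc {R : ℤ} {m₁ m₂ m : ℕ} {r s : ℤ} {μ : MMap L L (m₁ + 1 + m₂) r}
    {ν : MMap L L m s} (hμ : IsMultilinear k μ) (hν : IsMultilinear k ν) (hR : r + s = R)
    (h : IsMultilinear k (pc R m₁ m₂ μ ν hR)) (a : Fin (m₁ + m + m₂) → ZMod 2)
    (w : Fin (m₁ + m + m₂) → Mod L n) (hw : ∀ j, w j ∈ Homog e L (a j)) :
    hat e h w = sgn (s * ∑ j : Fin m₁, a (Fin.castAdd m₂ (Fin.castAdd m j))) •
      hat e hμ (insertBlock m₁ m₂ m w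
        (hat e hν fun j => w (Fin.castAdd m₂ (Fin.natAdd m₁ j)))) := by
  subst hR
  refine MultiAdd.ext_homog (e := e) (F := fun w => hat e h w)
    (G := fun w => sgn (s * ∑ j : Fin m₁, a (Fin.castAdd m₂ (Fin.castAdd m j))) •
      hat e hμ (insertBlock m₁ m₂ m w
        (hat e hν fun j => w (Fin.castAdd m₂ (Fin.natAdd m₁ j))))) (MultilinearMap.multiAdd _)
    (MultiAdd.zsmul (MultiAdd.pcomp (F := fun w => hat e hμ w) (G := fun w => hat e hν w)
      (MultilinearMap.multiAdd _) (MultilinearMap.multiAdd _)) _) a (fun S d y ha => ?_) w hw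
  have hins : insertBlock m₁ m₂ m (fun j => mono (S j) (d j) (y j))
      (mono (∑ j, S (Fin.castAdd m₂ (Fin.natAdd m₁ j)))
        (s + ∑ j, d (Fin.castAdd m₂ (Fin.natAdd m₁ j)))
        (ν (fun j => d (Fin.castAdd m₂ (Fin.natAdd m₁ j)))
          (fun j => y (Fin.castAdd m₂ (Fin.natAdd m₁ j)))))
      = fun j => mono (insertBlock m₁ m₂ m S (∑ j, S (Fin.castAdd m₂ (Fin.natAdd m₁ j))) j)
        (outDeg m₁ m₂ m s d j) (outArgs m₁ m₂ m s d y
          (ν (fun j => d (Fin.castAdd m₂ (Fin.natAdd m₁ j)))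
          (fun j => y (Fin.castAdd m₂ (Fin.natAdd m₁ j)))) j) := by
    ext1 i
    obtain ⟨i, rfl⟩ | ⟨i, rfl⟩ | ⟨i, rfl⟩ := block_cases m₁ 1 m₂ i
    · rw [insertBlock_left, insertBlock_left, outArgs_left, mono_gcast]
    · rw [insertBlock_mid, insertBlock_mid, outArgs_mid, mono_gcast]
    · rw [insertBlock_right, insertBlock_right, outArgs_right, mono_gcast]
  have hlhs : pc (r + s) m₁ m₂ μ ν rfl = pcomp m₁ m₂ μ ν := rfl
  simp only [hat_mono]
  rw [insertBlock_eq_update, MultiAdd.update_zsmul (MultilinearMap.multiAdd _),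
    ← insertBlock_eq_update, hins, hat_mono, hlhs, pcomp_apply, mono_zsmul, mono_gcast,
    insertBlock_sum, smul_smul, smul_smul, smul_smul, neg_one_pow_natAbs]
  congr 1
  unfold extractCoeff
  rw [insertBlock_sum]
  split_ifs with h1 h2
  · rw [← sgn_add, ← sgn_add, ← sgn_add]
    congr 1
    push_cast
    rw [extractExp_insertBlock]
    simp only [ha]
  · exfalso
    refine h2 fun l => le_trans ?_ (h1 l)
    simp only [Fin.sum_univ_add, Pi.add_apply]
    omega
  · simp
  · simp

theorem hat_fc1 {R : ℤ} {m : ℕ} {r s : ℤ} {μ : MMap L L 1 r}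
    {ν : MMap L L m s} (hμ : IsMultilinear k μ) (hν : IsMultilinear k ν) (hR : r + s = R)
    (h : IsMultilinear k (fc1 R μ ν hR)) (a : Fin m → ZMod 2)
    (w : Fin m → Mod L n) (hw : ∀ j, w j ∈ Homog e L (a j)) :
    hat e h w = hat e hμ fun _ => hat e hν w := by
  subst hR
  refine MultiAdd.ext_homog (e := e) (F := fun w => hat e h w)
    (G := fun w => hat e hμ fun _ => hat e hν w) (MultilinearMap.multiAdd _)
    ((MultilinearMap.multiAdd (hat e hν)).hom_comp (fun w => hat e hμ w)
      (MultilinearMap.multiAdd _)) a (fun S d y ha => ?_) w hw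
  have hc : ∀ (c : ℤ) (v : Mod L n),
      hat e hμ (fun _ => c • v) = c • hat e hμ (fun _ => v) := by
    intro c v
    have := (MultilinearMap.multiAdd (hat e hμ)).update_zsmul (fun _ => v) 0 c v
    have h2 : ∀ x : Mod L n, Function.update (fun _ : Fin 1 => v) 0 x = fun _ => x := by
      intro x; ext1 i; rw [Subsingleton.elim i 0, Function.update_self]
    simpa only [h2] using this
  have hlhs : fc1 (r + s) μ ν rfl = comp₁ μ ν := rfl
  simp only [hat_mono, hc]
  have hS : (∑ _j : Fin 1, ∑ j, S j) = ∑ j, S j := Fin.sum_univ_one _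
  rw [hlhs, comp₁, mono_gcast, hS, smul_smul]
  congr 1
  unfold extractCoeff
  rw [hS]
  split_ifs with h1
  · rw [← sgn_add]
    congr 1
    unfold extractExp
    rw [pairSum_one, Fin.sum_univ_one, par_sum]
    push_cast
    ring
  · simp

end HatAlgebra

end WL3

namespace WL3

open Finset

section Degree

variable {k : Type} [CommRing k] {L : ℤ → Type} [∀ i, AddCommGroup (L i)] [∀ i, Module k (L i)]
variable {n : ℕ} (e : Fin n → ZMod 2)

/-- The part of `Mod L n` of degree at least `c`. -/
def DegGE (L : ℤ → Type) [∀ i, AddCommGroup (L i)] (n : ℕ) (c : ℤ) : AddSubgroup (Mod L n) :=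
  AddSubgroup.closure {x | ∃ (S : Fin n → ℕ) (i : ℤ) (y : L i), c ≤ i ∧ x = mono S i y}

theorem DegGE_anti {c c' : ℤ} (h : c ≤ c') : DegGE L n c' ≤ DegGE L n c :=
  AddSubgroup.closure_mono fun _ ⟨S, i, y, hi, hx⟩ => ⟨S, i, y, h.trans hi, hx⟩

theorem hat_mem_DegGE {m : ℕ} {r : ℤ} {μ : MMap L L m r} (hμ : IsMultilinear k μ)
    (c : Fin m → ℤ) (w : Fin m → Mod L n) (hw : ∀ j, w j ∈ DegGE L n (c j)) :
    hat e hμ w ∈ DegGE L n (r + ∑ j, c j) := by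
  rw [← QuotientAddGroup.eq_zero_iff]
  refine MultiAdd.ext_closure (F := fun w => (hat e hμ w : Mod L n ⧸ DegGE L n _))
    (G := fun _ => 0) (fun w j x y => ?_) (fun w j x y => (add_zero _).symm) _ (fun w h => ?_)
    w hw
  · simp only [MultilinearMap.map_update_add]; rfl
  · choose S d y hc hm using h
    rw [show w = fun j => mono (S j) (d j) (y j) from funext hm, QuotientAddGroup.eq_zero_iff,
      hat_mono, ← mono_zsmul]
    exact AddSubgroup.subset_closure ⟨_, _, _,
      add_le_add le_rfl (Finset.sum_le_sum fun j _ => hc j), rfl⟩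

theorem mem_DegGE_zero (hL : ∀ i : ℤ, i < 0 → ∀ x : L i, x = 0) (x : Mod L n) :
    x ∈ DegGE L n 0 := by
  classical
  induction x using DFinsupp.induction with
  | h0 => exact zero_mem _
  | ha p b f _ _ ih =>
    refine add_mem ?_ ih
    by_cases h : p.2 < 0
    · rw [hL _ h b, DFinsupp.single_zero]; exact zero_mem _
    · exact AddSubgroup.subset_closure ⟨p.1, p.2, b, not_lt.mp h, rfl⟩

theorem eq_zero_of_mem_DegGE {c : ℤ} (hL : ∀ i : ℤ, c ≤ i → ∀ x : L i, x = 0) {x : Mod L n}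
    (hx : x ∈ DegGE L n c) : x = 0 := by
  rw [← AddSubgroup.mem_bot]
  refine (AddSubgroup.closure_le _).mpr ?_ hx
  rintro _ ⟨S, i, y, hi, rfl⟩
  rw [hL i hi y, mono_zero]
  exact zero_mem _

end Degree

section Generic

variable {k : Type} [CommRing k] {L : ℤ → Type} [∀ i, AddCommGroup (L i)] [∀ i, Module k (L i)]
variable {n : ℕ}

/-- The parities of variables for which `genericArg d x` consists of odd elements. -/
def genericPar (d : Fin n → ℤ) (j : Fin n) : ZMod 2 := 1 + d j

/-- The odd elements `θⱼ xⱼ`. -/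
def genericArg (d : Fin n → ℤ) (x : ∀ j, L (d j)) (j : Fin n) : Mod L n :=
  mono (Pi.single j 1) (d j) (x j)

theorem genericArg_mem (d : Fin n → ℤ) (x : ∀ j, L (d j)) (j : Fin n) :
    genericArg d x j ∈ Homog (genericPar d) L 1 := by
  refine mono_mem_homog _ _ ?_
  unfold par
  rw [Finset.sum_eq_single j]
  · simp only [Pi.single_eq_same, genericPar]; push_cast
    have := zmod2_add_self (d j : ZMod 2)
    linear_combination this
  · intro b _ hb; simp [Pi.single_eq_of_ne hb]
  · simp

theorem sum_single_eq_one : (∑ j : Fin n, Pi.single (M := fun _ => ℕ) j 1) = fun _ => 1 := by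
  ext1 i
  rw [Finset.sum_apply, Finset.sum_eq_single i]
  · simp
  · intro b _ hb; rw [Pi.single_eq_of_ne hb.symm]
  · simp

theorem eq_zero_of_hat_genericArg {r : ℤ} {μ : MMap L L n r} (hμ : IsMultilinear k μ)
    (h : ∀ d x, hat (genericPar d) hμ (genericArg d x) = 0) : μ = 0 := by
  funext d x
  have h1 := h d x
  unfold genericArg at h1
  rw [hat_mono] at h1
  unfold extractCoeff at h1
  rw [sum_single_eq_one, if_pos fun _ => le_rfl] at h1
  have h2 := congrArg (fun z => sgn (extractExp (genericPar d) r
    (fun j => Pi.single (M := fun _ => ℕ) j 1) d) • z) h1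
  simp only [smul_smul, sgn_mul_self, one_smul, smul_zero] at h2
  unfold mono at h2
  exact (DFinsupp.single_eq_zero (β := fun p : Idx n => L p.2)).mp h2

theorem hat_genericArg_comp_eq_zero {r : ℤ} {μ : MMap L L n r} (hμ : IsMultilinear k μ)
    (d : Fin n → ℤ) (x : ∀ j, L (d j)) (f : Fin n → Fin n) (hf : ¬ Function.Injective f) :
    hat (genericPar d) hμ (fun j => genericArg d x (f j)) = 0 := by
  unfold genericArg
  rw [hat_mono (genericPar d) hμ (fun j => Pi.single (f j) 1) (fun j => d (f j))
    (fun j => x (f j))]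
  unfold extractCoeff
  rw [if_neg, zero_smul]
  intro h
  obtain ⟨a, b, hab, hne⟩ := Function.not_injective_iff.mp hf
  have h1 := h (f a)
  rw [Finset.sum_apply] at h1
  have h2 : ∑ c ∈ {a, b}, (Pi.single (M := fun _ => ℕ) (f c) 1 : Fin n → ℕ) (f a)
      ≤ ∑ c, (Pi.single (M := fun _ => ℕ) (f c) 1 : Fin n → ℕ) (f a) :=
    Finset.sum_le_sum_of_subset (Finset.subset_univ _)
  rw [Finset.sum_pair hne, ← hab, Pi.single_eq_same] at h2
  omega

theorem symm_of_adjacent {t : ℕ} {V W : Type} (f : (Fin (t + 1) → V) → W) (u : Fin (t + 1) → V)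
    (h : ∀ (σ : Equiv.Perm (Fin (t + 1))) (i : Fin t),
      f (fun j => u (σ (Equiv.swap i.castSucc i.succ j))) = f fun j => u (σ j))
    (σ : Equiv.Perm (Fin (t + 1))) : f (fun j => u (σ j)) = f u := by
  have key : ∀ τ : Equiv.Perm (Fin (t + 1)),
      f (fun j => u (τ (σ j))) = f fun j => u (τ j) := by
    have hσ : σ ∈ Submonoid.closure
        (Set.range fun i : Fin t => Equiv.swap i.castSucc i.succ) := by
      rw [Equiv.Perm.mclosure_swap_castSucc_succ]; trivial
    induction hσ using Submonoid.closure_induction with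
    | mem σ hσ =>
      obtain ⟨i, rfl⟩ := hσ
      exact fun τ => h τ i
    | one => exact fun τ => rfl
    | mul σ₁ σ₂ _ _ h1 h2 =>
      intro τ
      have := h2 (τ * σ₁)
      simp only [Equiv.Perm.mul_apply] at this ⊢
      rw [this, h1]
  exact key 1

/-- Polarization of a symmetric form vanishing on tuples with repetitions. -/
theorem polarization {t : ℕ} {V W : Type} [AddCommGroup V] [AddCommGroup W] [Module k V]
    [Module k W] (f : MultilinearMap k (fun _ : Fin t => V) W) (u : Fin t → V)
    (hsymm : ∀ σ : Equiv.Perm (Fin t), f (fun j => u (σ j)) = f u)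
    (hrep : ∀ g : Fin t → Fin t, ¬ Function.Injective g → f (fun j => u (g j)) = 0)
    (hz : f (fun _ => ∑ j, u j) = 0) : (t.factorial : ℕ) • f u = 0 := by
  classical
  rw [← hz, MultilinearMap.map_sum]
  have : ∀ g : Fin t → Fin t, f (fun j => u (g j))
      = if Function.Bijective g then f u else 0 := by
    intro g
    split_ifs with hg
    · exact hsymm (Equiv.ofBijective g hg)
    · exact hrep g fun h => hg (Finite.injective_iff_bijective.mp h)
  rw [Finset.sum_congr rfl fun g _ => this g, ← Finset.sum_filter, Finset.sum_const]
  congr 1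
  have hcard : Fintype.card (Equiv.Perm (Fin t)) = t.factorial := by
    rw [Fintype.card_perm, Fintype.card_fin]
  rw [← hcard, Fintype.card_congr (Equiv.ofBijective (α := Equiv.Perm (Fin t))
    (β := {g : Fin t → Fin t // Function.Bijective g}) (fun σ => ⟨σ, σ.bijective⟩)
    ⟨fun a b hab => by ext1 j; exact congrFun (congrArg Subtype.val hab) j,
      fun g => ⟨Equiv.ofBijective g.1 g.2, rfl⟩⟩), Fintype.card_subtype]

end Generic

end WL3

namespace WL3

open Finset

/-! ## Trees of operations -/

/-- Symbols for the operations of a weak Lie 3-algebra, indexed by arity. -/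
inductive Op : ℕ → Type
  | D : Op 1
  | l2 : Op 2
  | l21 : Op 2
  | l211 : Op 2
  | l3 : Op 3
  | l31 : Op 3
  | l32 : Op 3
  | l4 : Op 4

namespace Op

/-- The degree of an operation. -/
def deg : {m : ℕ} → Op m → ℤ
  | _, D => -1
  | _, l2 => 0
  | _, l21 => 1
  | _, l211 => 2
  | _, l3 => 1
  | _, l31 => 2
  | _, l32 => 2
  | _, l4 => 2

/-- A natural number with the parity of the degree. -/
def par : {m : ℕ} → Op m → ℕ
  | _, D => 1
  | _, l2 => 0
  | _, l21 => 1
  | _, l211 => 2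
  | _, l3 => 1
  | _, l31 => 2
  | _, l32 => 2
  | _, l4 => 2

/-- A code distinguishing operations of the same arity. -/
def code : {m : ℕ} → Op m → ℕ
  | _, D => 8
  | _, l2 => 9
  | _, l21 => 10
  | _, l211 => 11
  | _, l3 => 12
  | _, l31 => 13
  | _, l32 => 14
  | _, l4 => 15

theorem par_cast {m : ℕ} (g : Op m) : (g.par : ZMod 2) = (g.deg : ℤ) := by
  cases g <;> decide

theorem par_eq_deg {m : ℕ} (hm : m ≠ 1) (g : Op m) : (g.par : ℤ) = g.deg := by
  cases g <;> first | rfl | exact absurd rfl hm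

theorem code_injective {m : ℕ} (g h : Op m) (H : g.code = h.code) : g = h := by
  cases g <;> cases h <;> first | rfl | exact absurd H (by decide)

end Op

/-- Iterated compositions of operations, with leaves labelled by natural numbers. -/
inductive Tree : Type
  | leaf (i : ℕ) : Tree
  | n1 (g : Op 1) (a : Tree) : Tree
  | n2 (g : Op 2) (a b : Tree) : Tree
  | n3 (g : Op 3) (a b c : Tree) : Tree
  | n4 (g : Op 4) (a b c d : Tree) : Tree

/-- Formal linear combinations of trees. -/
abbrev Terms := List (ℤ × Tree)

namespace Tree

/-- The parity of a tree with odd leaves. -/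
def par : Tree → ℕ
  | leaf _ => 1
  | n1 g a => g.par + a.par
  | n2 g a b => g.par + (a.par + b.par)
  | n3 g a b c => g.par + (a.par + b.par + c.par)
  | n4 g a b c d => g.par + (a.par + b.par + c.par + d.par)

/-- A lower bound for the degree of a tree. -/
def deg : Tree → ℕ
  | leaf _ => 0
  | n1 _ a => a.deg - 1
  | n2 g a b => g.par + (a.deg + b.deg)
  | n3 g a b c => g.par + (a.deg + b.deg + c.deg)
  | n4 g a b c d => g.par + (a.deg + b.deg + c.deg + d.deg)

/-- The preorder word of a tree, as a number. -/
def enc : Tree → ℕ → ℕ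
  | leaf i, w => w * 16 + i
  | n1 g a, w => a.enc (w * 16 + g.code)
  | n2 g a b, w => b.enc (a.enc (w * 16 + g.code))
  | n3 g a b c, w => c.enc (b.enc (a.enc (w * 16 + g.code)))
  | n4 g a b c d, w => d.enc (c.enc (b.enc (a.enc (w * 16 + g.code))))

/-- Equality of trees. -/
def same : Tree → Tree → Bool
  | leaf i, leaf j => Nat.beq i j
  | n1 g a, n1 g' a' => (Nat.beq g.code g'.code) && a.same a'
  | n2 g a b, n2 g' a' b' => (Nat.beq g.code g'.code) && (a.same a' && b.same b')
  | n3 g a b c, n3 g' a' b' c' =>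
    (Nat.beq g.code g'.code) && (a.same a' && (b.same b' && c.same c'))
  | n4 g a b c d, n4 g' a' b' c' d' =>
    (Nat.beq g.code g'.code) && (a.same a' && (b.same b' && (c.same c' && d.same d')))
  | _, _ => false

theorem eq_of_same : ∀ t u : Tree, t.same u = true → t = u := by
  intro t
  induction t with
  | leaf i =>
    intro u h
    cases u <;> simp_all [same]
  | n1 g a iha =>
    intro u h
    cases u <;> simp only [same, Bool.and_eq_true, Nat.beq_eq, reduceCtorEq] at h
    rw [Op.code_injective _ _ h.1, iha _ h.2]
  | n2 g a b iha ihb =>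
    intro u h
    cases u <;> simp only [same, Bool.and_eq_true, Nat.beq_eq, reduceCtorEq] at h
    rw [Op.code_injective _ _ h.1, iha _ h.2.1, ihb _ h.2.2]
  | n3 g a b c iha ihb ihc =>
    intro u h
    cases u <;> simp only [same, Bool.and_eq_true, Nat.beq_eq, reduceCtorEq] at h
    rw [Op.code_injective _ _ h.1, iha _ h.2.1, ihb _ h.2.2.1, ihc _ h.2.2.2]
  | n4 g a b c d iha ihb ihc ihd =>
    intro u h
    cases u <;> simp only [same, Bool.and_eq_true, Nat.beq_eq, reduceCtorEq] at h
    rw [Op.code_injective _ _ h.1, iha _ h.2.1, ihb _ h.2.2.1, ihc _ h.2.2.2.1,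
      ihd _ h.2.2.2.2]

/-- The tree with root `g` and the given branches. -/
def node : {m : ℕ} → Op m → List Tree → Tree
  | 1, g, [a] => n1 g a
  | 2, g, [a, b] => n2 g a b
  | 3, g, [a, b, c] => n3 g a b c
  | 4, g, [a, b, c, d] => n4 g a b c d
  | _, _, _ => leaf 0

end Tree

namespace Terms

/-- The sign of a parity. -/
def sg (n : ℕ) : ℤ := if Nat.beq (n % 2) 0 then 1 else -1

theorem sg_eq (n : ℕ) : sg n = sgn (n : ZMod 2) := by
  unfold sg sgn
  have h : (n : ZMod 2) = 0 ↔ n % 2 = 0 := by rw [ZMod.natCast_eq_zero_iff_even, Nat.even_iff]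
  by_cases h1 : n % 2 = 0 <;> simp [h, h1]

/-- Scalar multiple. -/
def scale (c : ℤ) (l : Terms) : Terms := l.map fun p => (c * p.1, p.2)

/-- Linear extension of a map defined on trees. -/
def lin (l : Terms) (f : Tree → Terms) : Terms := l.flatMap fun p => scale p.1 (f p.2)

/-- A linear combination of trees annotated by numbers used for sorting. -/
abbrev Keyed := List (ℕ × ℤ × Tree)

/-- Merging of sorted linear combinations. -/
def merge : ℕ → Keyed → Keyed → Keyed
  | 0, l₁, l₂ => l₁ ++ l₂
  | _ + 1, [], l₂ => l₂
  | _ + 1, p :: l₁, [] => p :: l₁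
  | n + 1, p :: l₁, q :: l₂ =>
    if Nat.ble p.1 q.1 then
      if Nat.beq p.1 q.1 && p.2.2.same q.2.2 then
        (p.1, p.2.1 + q.2.1, p.2.2) :: merge n l₁ l₂
      else p :: merge n l₁ (q :: l₂)
    else q :: merge n (p :: l₁) l₂

/-- Splitting of a list into two parts of about the same size. -/
def split {α : Type} : List α → List α × List α
  | [] => ([], [])
  | a :: l => (a :: (split l).2, (split l).1)

/-- Merge sort. -/
def sort : ℕ → Keyed → Keyed
  | 0, l => l
  | _ + 1, [] => []
  | _ + 1, [p] => [p]
  | n + 1, p :: q :: l =>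
    merge 100000 (sort n (split (p :: q :: l)).1) (sort n (split (p :: q :: l)).2)

/-- Test for the vanishing of a linear combination of trees. -/
def isZero (l : Terms) : Bool :=
  (sort 20 (l.map fun p => (p.2.enc 1, p.1, p.2))).all fun p => p.2.1 == 0

end Terms

/-! ## Evaluation of trees -/

section Eval

variable {k : Type} [CommRing k] {L : ℤ → Type} [∀ i, AddCommGroup (L i)] [∀ i, Module k (L i)]

/-- An interpretation of the operation symbols. -/
structure Interp (k : Type) [CommRing k] (L : ℤ → Type) [∀ i, AddCommGroup (L i)]
    [∀ i, Module k (L i)] where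
  op : ∀ {m : ℕ} (g : Op m), MMap L L m g.deg
  multilinear : ∀ {m : ℕ} (g : Op m), IsMultilinear k (op g)

variable {n : ℕ} (I : Interp k L) (e : Fin n → ZMod 2) (lv : ℕ → Mod L n)

/-- The value of a tree. -/
noncomputable def Tree.ev : Tree → Mod L n
  | leaf i => lv i
  | n1 g a => hat e (I.multilinear g) ![a.ev]
  | n2 g a b => hat e (I.multilinear g) ![a.ev, b.ev]
  | n3 g a b c => hat e (I.multilinear g) ![a.ev, b.ev, c.ev]
  | n4 g a b c d => hat e (I.multilinear g) ![a.ev, b.ev, c.ev, d.ev]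

/-- The value of a linear combination of trees. -/
noncomputable def Terms.ev (l : Terms) : Mod L n := (l.map fun p => p.1 • p.2.ev I e lv).sum

namespace Terms

theorem ev_nil : ev I e lv [] = 0 := rfl

theorem ev_cons (p : ℤ × Tree) (l : Terms) :
    ev I e lv (p :: l) = p.1 • p.2.ev I e lv + ev I e lv l := by
  simp [ev]

theorem ev_single (t : Tree) : ev I e lv [(1, t)] = t.ev I e lv := by
  simp [ev]

theorem ev_append (l l' : Terms) : ev I e lv (l ++ l') = ev I e lv l + ev I e lv l' := by
  simp [ev]

theorem ev_scale (c : ℤ) (l : Terms) : ev I e lv (scale c l) = c • ev I e lv l := by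
  induction l with
  | nil => simp [scale, ev_nil]
  | cons p l ih =>
    rw [scale, List.map_cons, ev_cons, ev_cons, smul_add, ← ih, mul_smul]; rfl

theorem ev_lin (l : Terms) (f : Tree → Terms) (φ : Mod L n →+ Mod L n)
    (h : ∀ t, ev I e lv (f t) = φ (t.ev I e lv)) :
    ev I e lv (lin l f) = φ (ev I e lv l) := by
  induction l with
  | nil => simp [lin, ev_nil]
  | cons p l ih =>
    rw [lin, List.flatMap_cons, ev_append, ev_scale, h, ev_cons, map_add, map_zsmul, ← ih]
    rfl

/-- The value of an annotated linear combination of trees. -/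
noncomputable def evKeyed (l : Keyed) : Mod L n := (l.map fun p => p.2.1 • p.2.2.ev I e lv).sum

theorem evKeyed_merge (n : ℕ) (l l' : Keyed) :
    evKeyed I e lv (merge n l l') = evKeyed I e lv l + evKeyed I e lv l' := by
  induction n generalizing l l' with
  | zero => simp [merge, evKeyed]
  | succ n ih =>
    match l, l' with
    | [], l' => simp [merge, evKeyed]
    | p :: l, [] => simp [merge, evKeyed]
    | p :: l, q :: l' =>
      unfold merge
      split_ifs with h1 h2
      · have h3 := Tree.eq_of_same _ _ (Bool.and_eq_true _ _ ▸ h2 : _ ∧ _).2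
        have := ih l l'
        simp only [evKeyed, List.map_cons, List.sum_cons] at this ⊢
        rw [this, h3, add_smul]; abel
      · have := ih l (q :: l')
        simp only [evKeyed, List.map_cons, List.sum_cons] at this ⊢
        rw [this]; abel
      · have := ih (p :: l) l'
        simp only [evKeyed, List.map_cons, List.sum_cons] at this ⊢
        rw [this]; abel

theorem evKeyed_split (l : Keyed) :
    evKeyed I e lv (split l).1 + evKeyed I e lv (split l).2 = evKeyed I e lv l := by
  induction l with
  | nil => simp [split, evKeyed]
  | cons p l ih =>
    simp only [split, evKeyed, List.map_cons, List.sum_cons] at ih ⊢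
    rw [← ih]; abel

theorem evKeyed_sort (n : ℕ) (l : Keyed) : evKeyed I e lv (sort n l) = evKeyed I e lv l := by
  induction n generalizing l with
  | zero => rfl
  | succ n ih =>
    match l with
    | [] => rfl
    | [p] => rfl
    | p :: q :: l => rw [sort, evKeyed_merge, ih, ih, evKeyed_split]

theorem ev_eq_zero {l : Terms} (h : isZero l = true) : ev I e lv l = 0 := by
  have h1 : ev I e lv l = evKeyed I e lv (l.map fun p => (p.2.enc 1, p.1, p.2)) := by
    simp [ev, evKeyed, Function.comp_def]
  rw [h1, ← evKeyed_sort I e lv 20]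
  refine List.sum_eq_zero fun x hx => ?_
  obtain ⟨p, hp, rfl⟩ := List.mem_map.mp hx
  have := List.all_eq_true.mp h p hp
  rw [beq_iff_eq.mp this, zero_smul]

end Terms

variable {I e lv}

theorem Tree.ev_mem_homog (hlv : ∀ i, lv i ∈ Homog e L 1) (t : Tree) :
    t.ev I e lv ∈ Homog e L (t.par : ZMod 2) := by
  induction t with
  | leaf i => simpa [par, ev] using hlv i
  | n1 g a iha =>
    have := hat_mem_homog e (I.multilinear g) ![(a.par : ZMod 2)] ![a.ev I e lv]
      (by intro j; fin_cases j; exact iha)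
    simpa [par, ev, Op.par_cast] using this
  | n2 g a b iha ihb =>
    have := hat_mem_homog e (I.multilinear g) ![(a.par : ZMod 2), b.par]
      ![a.ev I e lv, b.ev I e lv] (by intro j; fin_cases j; exacts [iha, ihb])
    simpa [par, ev, Op.par_cast] using this
  | n3 g a b c iha ihb ihc =>
    have := hat_mem_homog e (I.multilinear g) ![(a.par : ZMod 2), b.par, c.par]
      ![a.ev I e lv, b.ev I e lv, c.ev I e lv]
      (by intro j; fin_cases j; exacts [iha, ihb, ihc])
    simpa [par, ev, Op.par_cast, Fin.sum_univ_succ, add_assoc] using this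
  | n4 g a b c d iha ihb ihc ihd =>
    have := hat_mem_homog e (I.multilinear g) ![(a.par : ZMod 2), b.par, c.par, d.par]
      ![a.ev I e lv, b.ev I e lv, c.ev I e lv, d.ev I e lv]
      (by intro j; fin_cases j; exacts [iha, ihb, ihc, ihd])
    simpa [par, ev, Op.par_cast, Fin.sum_univ_succ, add_assoc] using this

theorem Tree.ev_mem_DegGE (hL : ∀ i : ℤ, i < 0 → ∀ x : L i, x = 0) (t : Tree) :
    t.ev I e lv ∈ DegGE L n (t.deg : ℤ) := by
  induction t with
  | leaf i => exact mem_DegGE_zero hL _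
  | n1 g a iha =>
    have := hat_mem_DegGE e (I.multilinear g) ![(a.deg : ℤ)] ![a.ev I e lv]
      (by intro j; fin_cases j; exact iha)
    cases g
    rcases Nat.eq_zero_or_pos a.deg with h | h
    · rw [deg, h]; exact mem_DegGE_zero hL _
    · rw [deg, Nat.cast_sub h]
      refine DegGE_anti (le_of_eq ?_) this
      simp [Op.deg]; ring
  | n2 g a b iha ihb =>
    have := hat_mem_DegGE e (I.multilinear g) ![(a.deg : ℤ), b.deg]
      ![a.ev I e lv, b.ev I e lv] (by intro j; fin_cases j; exacts [iha, ihb])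
    simpa [deg, ev, Op.par_eq_deg] using this
  | n3 g a b c iha ihb ihc =>
    have := hat_mem_DegGE e (I.multilinear g) ![(a.deg : ℤ), b.deg, c.deg]
      ![a.ev I e lv, b.ev I e lv, c.ev I e lv]
      (by intro j; fin_cases j; exacts [iha, ihb, ihc])
    simpa [deg, ev, Op.par_eq_deg, Fin.sum_univ_succ, add_assoc] using this
  | n4 g a b c d iha ihb ihc ihd =>
    have := hat_mem_DegGE e (I.multilinear g) ![(a.deg : ℤ), b.deg, c.deg, d.deg]
      ![a.ev I e lv, b.ev I e lv, c.ev I e lv, d.ev I e lv]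
      (by intro j; fin_cases j; exacts [iha, ihb, ihc, ihd])
    simpa [deg, ev, Op.par_eq_deg, Fin.sum_univ_succ, add_assoc] using this

theorem Tree.ev_eq_zero_of_deg (hL : ∀ i : ℤ, (i < 0 ∨ 2 < i) → ∀ x : L i, x = 0) {t : Tree}
    (h : 3 ≤ t.deg) : t.ev I e lv = 0 :=
  eq_zero_of_mem_DegGE (c := t.deg) (fun i hi => hL i (Or.inr (by omega)))
    (t.ev_mem_DegGE fun i hi => hL i (Or.inl hi))

end Eval

end WL3

namespace WL3

open Finset

/-- A linear combination of trees depending on a tuple of trees. -/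
abbrev TermFun := List Tree → Terms

namespace TermFun

/-- The corolla with a given operation. -/
def op {m : ℕ} (g : Op m) : TermFun := fun ts => [(1, Tree.node g ts)]

/-- Sum. -/
def add (f g : TermFun) : TermFun := fun ts => f ts ++ g ts

/-- Negation. -/
def neg (f : TermFun) : TermFun := fun ts => Terms.scale (-1) (f ts)

/-- Difference. -/
def sub (f g : TermFun) : TermFun := fun ts => f ts ++ Terms.scale (-1) (g ts)

/-- Integer multiple. -/
def smul (c : ℤ) (f : TermFun) : TermFun := fun ts => Terms.scale c (f ts)

/-- The sum of `C i j` over the inversions of the permutation with values `l`. -/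
def inv (l : List ℕ) (C : ℕ → ℕ → ℕ) : ℕ :=
  ((List.range l.length).map fun i => ((List.range l.length).map fun j =>
    if Nat.blt i j && Nat.blt (l.getD j 0) (l.getD i 0) then C i j else 0).sum).sum

/-- Action of a permutation, given by its values and the values of its inverse. -/
def perm (p : List ℕ × List ℕ) (f : TermFun) : TermFun := fun ts =>
  Terms.scale (Terms.sg (inv p.1 fun i j =>
      (ts.getD i (.leaf 0)).par * (ts.getD j (.leaf 0)).par))
    (f (p.2.map fun i => ts.getD i (.leaf 0)))

/-- Alternating sum over a list of permutations. -/
def alt (ps : List (List ℕ × List ℕ)) (f : TermFun) : TermFun := fun ts =>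
  ps.flatMap fun p => Terms.scale (Terms.sg (inv p.1 fun _ _ => 1)) (perm p f ts)

/-- Partial composition with an operation of arity `n` and parity `s`. -/
def comp (m₁ n s : ℕ) (f g : TermFun) : TermFun := fun ts =>
  Terms.scale (Terms.sg (s * ((ts.take m₁).map Tree.par).sum))
    (Terms.lin (g ((ts.drop m₁).take n)) fun u => f (ts.take m₁ ++ u :: ts.drop (m₁ + n)))

/-- Composition of a unary operation with an operation. -/
def comp₁ (f g : TermFun) : TermFun := fun ts => Terms.lin (g ts) fun u => f [u]

end TermFun

/-- The values of a permutation and of its inverse. -/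
def permData {m : ℕ} (σ : Equiv.Perm (Fin m)) : List ℕ × List ℕ :=
  (List.ofFn fun i => (σ i : ℕ), List.ofFn fun i => (σ.symm i : ℕ))

section Alt

variable {L : ℤ → Type} [∀ i, AddCommGroup (L i)]

/-- The alternating sum of the permutations of an operation. -/
def alt {m : ℕ} {r : ℤ} (μ : MMap L L m r) : MMap L L m r :=
  ∑ σ : Equiv.Perm (Fin m), (Equiv.Perm.sign σ : ℤ) • pa σ μ

end Alt

section Rep

variable {k : Type} [CommRing k] {L : ℤ → Type} [∀ i, AddCommGroup (L i)] [∀ i, Module k (L i)]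
variable {n : ℕ}

/-- The values on trees of an operation `μ` are computed by `f`. -/
structure Rep (I : Interp k L) (e : Fin n → ZMod 2) (lv : ℕ → Mod L n) {m : ℕ} {r : ℤ}
    (μ : MMap L L m r) (f : TermFun) : Prop where
  multilinear : IsMultilinear k μ
  eval : ∀ ts : List Tree, ts.length = m → Terms.ev I e lv (f ts)
    = hat e multilinear fun j : Fin m => (ts.getD j (.leaf 0)).ev I e lv

variable {I : Interp k L} {e : Fin n → ZMod 2} {lv : ℕ → Mod L n} {m : ℕ} {r : ℤ}
variable {μ ν : MMap L L m r} {f g : TermFun}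

namespace Rep

theorem op {m : ℕ} (g : Op m) : Rep I e lv (I.op g) (TermFun.op g) := by
  refine ⟨I.multilinear g, fun ts h => ?_⟩
  rw [TermFun.op, Terms.ev_single]
  match m, g, ts, h with
  | 1, g, [a], _ =>
    rw [Tree.node, Tree.ev]; congr 1; funext j; fin_cases j; rfl
  | 2, g, [a, b], _ =>
    rw [Tree.node, Tree.ev]; congr 1; funext j; fin_cases j <;> rfl
  | 3, g, [a, b, c], _ =>
    rw [Tree.node, Tree.ev]; congr 1; funext j; fin_cases j <;> rfl
  | 4, g, [a, b, c, d], _ =>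
    rw [Tree.node, Tree.ev]; congr 1; funext j; fin_cases j <;> rfl

theorem of_eq (hf : Rep I e lv μ f) (h : ν = μ) : Rep I e lv ν f := h ▸ hf

theorem add (hlv : ∀ i, lv i ∈ Homog e L 1) (hf : Rep I e lv μ f) (hg : Rep I e lv ν g) :
    Rep I e lv (μ + ν) (f.add g) := by
  refine ⟨hf.multilinear.add hg.multilinear, fun ts h => ?_⟩
  rw [hat_add e hf.multilinear hg.multilinear _ _ _ fun j => Tree.ev_mem_homog hlv _,
    TermFun.add, Terms.ev_append, hf.eval ts h, hg.eval ts h]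

theorem smul (hlv : ∀ i, lv i ∈ Homog e L 1) (c : ℤ) (hf : Rep I e lv μ f) :
    Rep I e lv (c • μ) (f.smul c) := by
  refine ⟨hf.multilinear.zsmul c, fun ts h => ?_⟩
  rw [hat_zsmul e hf.multilinear _ _ _ _ fun j => Tree.ev_mem_homog hlv _,
    TermFun.smul, Terms.ev_scale, hf.eval ts h]

theorem neg (hlv : ∀ i, lv i ∈ Homog e L 1) (hf : Rep I e lv μ f) :
    Rep I e lv (-μ) f.neg :=
  (hf.smul hlv (-1)).of_eq (neg_one_zsmul μ).symm

theorem sub (hlv : ∀ i, lv i ∈ Homog e L 1) (hf : Rep I e lv μ f) (hg : Rep I e lv ν g) :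
    Rep I e lv (μ - ν) (f.sub g) :=
  (hf.add hlv (hg.neg hlv)).of_eq (sub_eq_add_neg μ ν)

theorem zero (hlv : ∀ i, lv i ∈ Homog e L 1) : Rep I e lv (0 : MMap L L m r) fun _ => [] :=
  ⟨IsMultilinear.zero, fun _ _ => (hat_zero e _ _ _ fun _ => Tree.ev_mem_homog hlv _).symm⟩

theorem inv_eq (σ : Equiv.Perm (Fin m)) (C : ℕ → ℕ → ℕ) :
    (TermFun.inv (permData σ).1 C : ZMod 2) = invSum σ fun i j => (C i j : ZMod 2) := by
  unfold TermFun.inv invSum permData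
  simp only [List.length_ofFn]
  have key : ∀ F : ℕ → ℕ, (((List.range m).map F).sum : ℕ) = ∑ i : Fin m, F i :=
    fun F => (Finset.sum_range F)
  rw [key]
  simp only [key, Nat.cast_sum]
  refine Finset.sum_congr rfl fun i _ => Finset.sum_congr rfl fun j _ => ?_
  simp only [List.getD_eq_getElem?_getD, List.getElem?_ofFn, Fin.is_lt, dif_pos,
    Option.getD_some, Bool.and_eq_true, Nat.blt_eq, Fin.lt_def, Fin.eta]
  split_ifs <;> simp

theorem perm (hlv : ∀ i, lv i ∈ Homog e L 1) (σ : Equiv.Perm (Fin m)) (p : List ℕ × List ℕ)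
    (hp : permData σ = p) (hf : Rep I e lv μ f) : Rep I e lv (pa σ μ) (f.perm p) := by
  subst hp
  refine ⟨hf.multilinear.pa σ, fun ts h => ?_⟩
  rw [hat_pa e hf.multilinear σ _ _ _ fun j => Tree.ev_mem_homog hlv _,
    TermFun.perm, Terms.ev_scale, hf.eval _ (by simp [permData]), Terms.sg_eq, inv_eq, ksgn]
  simp only [Nat.cast_mul]
  congr 2
  funext j
  simp [permData]

theorem sum_perm (hlv : ∀ i, lv i ∈ Homog e L 1) (s : Multiset (Equiv.Perm (Fin m)))
    (ps : List (List ℕ × List ℕ)) (hps : s.map permData = ps) (hf : Rep I e lv μ f) :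
    Rep I e lv ((s.map fun σ => (Equiv.Perm.sign σ : ℤ) • pa σ μ).sum) (f.alt ps) := by
  induction ps generalizing s with
  | nil =>
    rw [Multiset.coe_nil, Multiset.map_eq_zero] at hps
    subst hps
    exact Rep.zero hlv
  | cons p ps ih =>
    rw [← Multiset.cons_coe] at hps
    obtain ⟨σ, hσ, h1, h2⟩ := (Multiset.map_eq_cons _ _ _ _).mpr hps
    have h3 := ((hf.perm hlv σ p h1).smul hlv (Equiv.Perm.sign σ)).add hlv (ih _ h2)
    have h4 : ((Equiv.Perm.sign σ : ℤˣ) : ℤ) = Terms.sg (TermFun.inv p.1 fun _ _ => 1) := by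
      rw [← ksgn_one, Terms.sg_eq, ← h1, inv_eq]
      simp [ksgn]
    have h5 : (f.perm p).smul (Equiv.Perm.sign σ : ℤ) = fun ts =>
        Terms.scale (Terms.sg (TermFun.inv p.1 fun _ _ => 1)) (f.perm p ts) := by
      funext ts; rw [TermFun.smul, h4]
    rw [h5] at h3
    refine h3.of_eq ?_
    rw [← Multiset.sum_cons, ← Multiset.map_cons
      (fun σ : Equiv.Perm (Fin m) => (Equiv.Perm.sign σ : ℤ) • pa σ μ), Multiset.cons_erase hσ]

theorem alt (hlv : ∀ i, lv i ∈ Homog e L 1) (ps : List (List ℕ × List ℕ))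
    (hps : (univ : Finset (Equiv.Perm (Fin m))).val.map permData = ps) (hf : Rep I e lv μ f) :
    Rep I e lv (alt μ) (f.alt ps) :=
  hf.sum_perm hlv _ ps hps

theorem comp (hlv : ∀ i, lv i ∈ Homog e L 1) {R : ℤ} {m₁ m₂ m : ℕ} {r s : ℤ}
    {μ : MMap L L (m₁ + 1 + m₂) r} {ν : MMap L L m s} (p : ℕ)
    (hp : (p : ZMod 2) = (s : ℤ)) (hf : Rep I e lv μ f) (hg : Rep I e lv ν g)
    (hR : r + s = R) : Rep I e lv (pc R m₁ m₂ μ ν hR) (f.comp m₁ m p g) := by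
  refine ⟨hf.multilinear.pc hg.multilinear hR, fun ts h => ?_⟩
  rw [hat_pc e hf.multilinear hg.multilinear hR _ _ _ fun j => Tree.ev_mem_homog hlv _]
  set w : Fin (m₁ + m + m₂) → Mod L n := fun j => (ts.getD j (.leaf 0)).ev I e lv with hw
  let φ : Mod L n →+ Mod L n := AddMonoidHom.mk'
    (fun v => hat e hf.multilinear (insertBlock m₁ m₂ m w v)) (fun a b => by
      rw [insertBlock_eq_update, insertBlock_eq_update _ _ _ _ a, insertBlock_eq_update _ _ _ _ b,
        MultilinearMap.map_update_add])
  rw [TermFun.comp, Terms.ev_scale, Terms.ev_lin I e lv _ _ φ, hg.eval _ (by simp; omega)]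
  · have h1 : Terms.sg (p * ((ts.take m₁).map Tree.par).sum)
        = sgn (s * ∑ j : Fin m₁, ((ts.getD (Fin.castAdd m₂ (Fin.castAdd m j) : Fin _).val
          (.leaf 0)).par : ZMod 2)) := by
      rw [Terms.sg_eq, Nat.cast_mul, hp, ← Nat.cast_sum]
      congr 3
      have h2 : (ts.take m₁).map Tree.par
          = List.ofFn fun j : Fin m₁ => (ts.getD j.val (.leaf 0)).par := by
        refine List.ext_getElem (by simp; omega) fun i hi _ => ?_
        have : i < ts.length := by simp at hi; omega
        simp [this]
      rw [h2, List.sum_ofFn]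
      rfl
    rw [h1]
    congr 1
    change hat e hf.multilinear _ = _
    congr 3
    funext j
    simp [List.getD_eq_getElem?_getD, List.getElem?_drop]
  · intro u
    rw [hf.eval _ (by simp; omega)]
    change _ = hat e hf.multilinear _
    congr 1
    funext j
    have hlen : min m₁ ts.length = m₁ := by omega
    obtain ⟨i, rfl⟩ | ⟨i, rfl⟩ | ⟨i, rfl⟩ := block_cases m₁ 1 m₂ j
    · have h1 : i.val < ts.length := by omega
      simp [insertBlock, hw, Fin.append_left, List.getD_eq_getElem?_getD,
        List.getElem?_append, hlen, h1]
    · simp [insertBlock, hw, Fin.append_left, Fin.append_right, List.getD_eq_getElem?_getD,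
        hlen, Subsingleton.elim i 0]
    · have h1 : ¬ m₁ + 1 + i.val < m₁ := by omega
      have h2 : m₁ + 1 + i.val - m₁ = i.val + 1 := by omega
      simp [insertBlock, hw, Fin.append_right, List.getD_eq_getElem?_getD,
        List.getElem?_append, hlen, h1, h2]

theorem comp₁ (hlv : ∀ i, lv i ∈ Homog e L 1) {R : ℤ} {m : ℕ} {r s : ℤ}
    {μ : MMap L L 1 r} {ν : MMap L L m s} (hf : Rep I e lv μ f) (hg : Rep I e lv ν g)
    (hR : r + s = R) : Rep I e lv (fc1 R μ ν hR) (f.comp₁ g) := by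
  refine ⟨hf.multilinear.fc1 hg.multilinear hR, fun ts h => ?_⟩
  rw [hat_fc1 e hf.multilinear hg.multilinear hR _ _ _ fun j => Tree.ev_mem_homog hlv _]
  let φ : Mod L n →+ Mod L n := AddMonoidHom.mk'
    (fun v => hat e hf.multilinear fun _ => v) (fun a b => by
      have h1 : ∀ v : Mod L n, (fun _ : Fin 1 => v)
          = Function.update (0 : Fin 1 → Mod L n) 0 v := by
        intro v; funext j; rw [Subsingleton.elim j 0, Function.update_self]
      rw [h1, h1 a, h1 b, MultilinearMap.map_update_add])
  rw [TermFun.comp₁, Terms.ev_lin I e lv _ _ φ, hg.eval _ h]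
  · rfl
  · intro u
    rw [hf.eval _ rfl]
    change _ = hat e hf.multilinear _
    congr 1
    funext j
    rw [Subsingleton.elim j 0]
    rfl

end Rep

end Rep

section Boundary

variable {L : ℤ → Type} [∀ i, AddCommGroup (L i)]

theorem bd_eq₂ {R r : ℤ} (D : MMap L L 1 (-1)) (μ : MMap L L 2 r) (h : -1 + r = R) :
    bd R D D μ h = fc1 R D μ h - ((-1 : ℤ) ^ r.natAbs) •
      (pc R 0 1 μ D (by omega) + pc R 1 0 μ D (by omega)) := by
  subst h
  unfold bd bdry
  rw [Fin.sum_univ_two]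
  rfl

theorem bd_eq₃ {R r : ℤ} (D : MMap L L 1 (-1)) (μ : MMap L L 3 r) (h : -1 + r = R) :
    bd R D D μ h = fc1 R D μ h - ((-1 : ℤ) ^ r.natAbs) •
      (pc R 0 2 μ D (by omega) + pc R 1 1 μ D (by omega) + pc R 2 0 μ D (by omega)) := by
  subst h
  unfold bd bdry
  rw [Fin.sum_univ_three]
  rfl

theorem bd_eq₄ {R r : ℤ} (D : MMap L L 1 (-1)) (μ : MMap L L 4 r) (h : -1 + r = R) :
    bd R D D μ h = fc1 R D μ h - ((-1 : ℤ) ^ r.natAbs) •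
      (pc R 0 3 μ D (by omega) + pc R 1 2 μ D (by omega) + pc R 2 1 μ D (by omega)
        + pc R 3 0 μ D (by omega)) := by
  subst h
  unfold bd bdry
  rw [Fin.sum_univ_four]
  rfl

end Boundary

end WL3

namespace WL3

open Finset

/-! ## The structure equations on trees -/

namespace TermFun

/-- The right hand side of the second Leibniz equation. -/
def leib₂ (f2 : TermFun) : TermFun :=
  ((f2.comp 1 2 0 f2).sub (f2.comp 0 2 0 f2)).sub (perm ([1, 0, 2], [1, 0, 2]) (f2.comp 1 2 0 f2))

/-- The right hand side of the third Leibniz equation. -/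
def leib₃ (f2 f3 : TermFun) : TermFun :=
  (((((((((f2.comp 0 3 1 f3).add (f2.comp 1 3 1 f3)).sub
    (perm ([1, 0, 2, 3], [1, 0, 2, 3]) (f2.comp 1 3 1 f3))).add
    (perm ([1, 2, 0, 3], [2, 0, 1, 3]) (f2.comp 1 3 1 f3))).sub (f3.comp 0 2 0 f2)).add
    (f3.comp 1 2 0 f2)).sub (perm ([1, 0, 2, 3], [1, 0, 2, 3]) (f3.comp 1 2 0 f2))).sub
    (f3.comp 2 2 0 f2)).add (perm ([0, 2, 1, 3], [0, 2, 1, 3]) (f3.comp 2 2 0 f2))).sub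
    (perm ([2, 0, 1, 3], [1, 2, 0, 3]) (f3.comp 2 2 0 f2))

/-- The right hand side of the fourth Leibniz equation. -/
def leib₄ (f2 f3 f4 : TermFun) : TermFun :=
  ((((((((((((((((((((((((f2.comp 0 4 2 f4).sub (f2.comp 1 4 2 f4)).add
    (perm ([1, 0, 2, 3, 4], [1, 0, 2, 3, 4]) (f2.comp 1 4 2 f4))).sub
    (perm ([1, 2, 0, 3, 4], [2, 0, 1, 3, 4]) (f2.comp 1 4 2 f4))).add
    (perm ([1, 2, 3, 0, 4], [3, 0, 1, 2, 4]) (f2.comp 1 4 2 f4))).add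
    (f3.comp 0 3 1 f3)).add (f3.comp 1 3 1 f3)).sub
    (perm ([1, 0, 2, 3, 4], [1, 0, 2, 3, 4]) (f3.comp 1 3 1 f3))).add
    (perm ([1, 2, 0, 3, 4], [2, 0, 1, 3, 4]) (f3.comp 1 3 1 f3))).add (f3.comp 2 3 1 f3)).sub
    (perm ([0, 2, 1, 3, 4], [0, 2, 1, 3, 4]) (f3.comp 2 3 1 f3))).add
    (perm ([2, 0, 1, 3, 4], [1, 2, 0, 3, 4]) (f3.comp 2 3 1 f3))).add
    (perm ([0, 2, 3, 1, 4], [0, 3, 1, 2, 4]) (f3.comp 2 3 1 f3))).sub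
    (perm ([2, 0, 3, 1, 4], [1, 3, 0, 2, 4]) (f3.comp 2 3 1 f3))).add
    (perm ([2, 3, 0, 1, 4], [2, 3, 0, 1, 4]) (f3.comp 2 3 1 f3))).add
    (f4.comp 0 2 0 f2)).sub (f4.comp 1 2 0 f2)).add
    (perm ([1, 0, 2, 3, 4], [1, 0, 2, 3, 4]) (f4.comp 1 2 0 f2))).add (f4.comp 2 2 0 f2)).sub
    (perm ([0, 2, 1, 3, 4], [0, 2, 1, 3, 4]) (f4.comp 2 2 0 f2))).add
    (perm ([2, 0, 1, 3, 4], [1, 2, 0, 3, 4]) (f4.comp 2 2 0 f2))).sub (f4.comp 3 2 0 f2)).add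
    (perm ([0, 1, 3, 2, 4], [0, 1, 3, 2, 4]) (f4.comp 3 2 0 f2))).sub
    (perm ([0, 3, 1, 2, 4], [0, 2, 3, 1, 4]) (f4.comp 3 2 0 f2))).add
    (perm ([3, 0, 1, 2, 4], [1, 2, 3, 0, 4]) (f4.comp 3 2 0 f2))

end TermFun

section Leib

variable {L : ℤ → Type} [∀ i, AddCommGroup (L i)]

/-- The right hand side of the second Leibniz equation. -/
def leib₂ (l2 : MMap L L 2 0) : MMap L L 3 0 :=
  pc 0 1 0 l2 l2 - pc 0 0 1 l2 l2 - pa (P12 3) (pc 0 1 0 l2 l2)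

/-- The right hand side of the third Leibniz equation. -/
def leib₃ (l2 : MMap L L 2 0) (l3 : MMap L L 3 1) : MMap L L 4 1 :=
  pc 1 0 1 l2 l3 + pc 1 1 0 l2 l3 - pa (P12 4) (pc 1 1 0 l2 l3)
    + pa (P123 4) (pc 1 1 0 l2 l3) - pc 1 0 2 l3 l2
    + pc 1 1 1 l3 l2 - pa (P12 4) (pc 1 1 1 l3 l2)
    - pc 1 2 0 l3 l2 + pa (P23 4) (pc 1 2 0 l3 l2) - pa (P132 4) (pc 1 2 0 l3 l2)

/-- The right hand side of the fourth Leibniz equation. -/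
def leib₄ (l2 : MMap L L 2 0) (l3 : MMap L L 3 1) (l4 : MMap L L 4 2) : MMap L L 5 2 :=
  pc 2 0 1 l2 l4 - pc 2 1 0 l2 l4 + pa (P12 5) (pc 2 1 0 l2 l4)
    - pa (P123 5) (pc 2 1 0 l2 l4) + pa (P1234 5) (pc 2 1 0 l2 l4)
    + pc 2 0 2 l3 l3 + pc 2 1 1 l3 l3 - pa (P12 5) (pc 2 1 1 l3 l3)
    + pa (P123 5) (pc 2 1 1 l3 l3) + pc 2 2 0 l3 l3
    - pa (P23 5) (pc 2 2 0 l3 l3) + pa (P132 5) (pc 2 2 0 l3 l3)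
    + pa (P234 5) (pc 2 2 0 l3 l3) - pa (P1342 5) (pc 2 2 0 l3 l3)
    + pa (P13P24 5) (pc 2 2 0 l3 l3)
    + pc 2 0 3 l4 l2 - pc 2 1 2 l4 l2 + pa (P12 5) (pc 2 1 2 l4 l2)
    + pc 2 2 1 l4 l2 - pa (P23 5) (pc 2 2 1 l4 l2) + pa (P132 5) (pc 2 2 1 l4 l2)
    - pc 2 3 0 l4 l2 + pa (P34 5) (pc 2 3 0 l4 l2) - pa (P243 5) (pc 2 3 0 l4 l2)
    + pa (P1432 5) (pc 2 3 0 l4 l2)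

end Leib

section

variable {k : Type} [CommRing k] {L : ℤ → Type} [∀ i, AddCommGroup (L i)] [∀ i, Module k (L i)]
variable {n : ℕ} {I : Interp k L} {e : Fin n → ZMod 2} {lv : ℕ → Mod L n}
variable {l2 : MMap L L 2 0} {l3 : MMap L L 3 1} {l4 : MMap L L 4 2} {f2 f3 f4 : TermFun}

theorem Rep.leib₂ (hlv : ∀ i, lv i ∈ Homog e L 1) (h2 : Rep I e lv l2 f2) :
    Rep I e lv (leib₂ l2) (TermFun.leib₂ f2) := by
  unfold WL3.leib₂ TermFun.leib₂
  repeat' first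
    | exact (h2.comp hlv (m₁ := 0) (m₂ := 1) 0 (by decide) h2 _)
    | exact (h2.comp hlv (m₁ := 1) (m₂ := 0) 0 (by decide) h2 _)
    | refine Rep.add hlv ?_ ?_
    | refine Rep.sub hlv ?_ ?_
    | refine Rep.perm hlv _ _ (by decide) ?_

theorem Rep.leib₃ (hlv : ∀ i, lv i ∈ Homog e L 1) (h2 : Rep I e lv l2 f2)
    (h3 : Rep I e lv l3 f3) : Rep I e lv (leib₃ l2 l3) (TermFun.leib₃ f2 f3) := by
  unfold WL3.leib₃ TermFun.leib₃
  repeat' first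
    | refine Rep.add hlv ?_ ?_
    | refine Rep.sub hlv ?_ ?_
    | refine Rep.perm hlv _ _ (by decide) ?_
  · exact h2.comp hlv (m₁ := 0) (m₂ := 1) 1 (by decide) h3 _
  all_goals first
    | exact h2.comp hlv (m₁ := 1) (m₂ := 0) 1 (by decide) h3 _
    | exact h3.comp hlv (m₁ := 0) (m₂ := 2) 0 (by decide) h2 _
    | exact h3.comp hlv (m₁ := 1) (m₂ := 1) 0 (by decide) h2 _
    | exact h3.comp hlv (m₁ := 2) (m₂ := 0) 0 (by decide) h2 _

theorem Rep.leib₄ (hlv : ∀ i, lv i ∈ Homog e L 1) (h2 : Rep I e lv l2 f2)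
    (h3 : Rep I e lv l3 f3) (h4 : Rep I e lv l4 f4) :
    Rep I e lv (leib₄ l2 l3 l4) (TermFun.leib₄ f2 f3 f4) := by
  unfold WL3.leib₄ TermFun.leib₄
  repeat' first
    | refine Rep.add hlv ?_ ?_
    | refine Rep.sub hlv ?_ ?_
    | refine Rep.perm hlv _ _ (by decide) ?_
  all_goals first
    | exact h2.comp hlv (m₁ := 0) (m₂ := 1) 2 (by decide) h4 _
    | exact h2.comp hlv (m₁ := 1) (m₂ := 0) 2 (by decide) h4 _
    | exact h3.comp hlv (m₁ := 0) (m₂ := 2) 1 (by decide) h3 _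
    | exact h3.comp hlv (m₁ := 1) (m₂ := 1) 1 (by decide) h3 _
    | exact h3.comp hlv (m₁ := 2) (m₂ := 0) 1 (by decide) h3 _
    | exact h4.comp hlv (m₁ := 0) (m₂ := 3) 0 (by decide) h2 _
    | exact h4.comp hlv (m₁ := 1) (m₂ := 2) 0 (by decide) h2 _
    | exact h4.comp hlv (m₁ := 2) (m₂ := 1) 0 (by decide) h2 _
    | exact h4.comp hlv (m₁ := 3) (m₂ := 0) 0 (by decide) h2 _

end

end WL3

namespace WL3

open Finset

namespace TermFun

/-- The boundary of an operation of arity at least two, in terms of other operations. -/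
def bdFun : {m : ℕ} → Op m → TermFun
  | _, .D => fun _ => []
  | _, .l2 => fun _ => []
  | _, .l21 => (op .l2).add (perm ([1, 0], [1, 0]) (op .l2))
  | _, .l211 => (op .l21).sub (perm ([1, 0], [1, 0]) (op .l21))
  | _, .l3 => leib₂ (op .l2)
  | _, .l31 => ((op .l3).add (perm ([1, 0, 2], [1, 0, 2]) (op .l3))).add
      ((op .l2).comp 0 2 1 (op .l21))
  | _, .l32 => ((((op .l3).add (perm ([0, 2, 1], [0, 2, 1]) (op .l3))).sub
      ((op .l2).comp 1 2 1 (op .l21))).add ((op .l21).comp 0 2 0 (op .l2))).add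
      (perm ([1, 0, 2], [1, 0, 2]) ((op .l21).comp 1 2 0 (op .l2)))
  | _, .l4 => leib₃ (op .l2) (op .l3)

end TermFun

namespace Tree

/-- The differential of a tree, expressed by trees without differentials above operations. -/
def pushD : Tree → Terms
  | leaf i => [(1, n1 .D (leaf i))]
  | n1 _ _ => []
  | n2 g a b => TermFun.bdFun g [a, b] ++ Terms.scale (Terms.sg g.par)
      (Terms.lin a.pushD (fun u => [(1, n2 g u b)]) ++
        Terms.scale (Terms.sg a.par) (Terms.lin b.pushD fun u => [(1, n2 g a u)]))
  | n3 g a b c => TermFun.bdFun g [a, b, c] ++ Terms.scale (Terms.sg g.par)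
      (Terms.lin a.pushD (fun u => [(1, n3 g u b c)]) ++
        Terms.scale (Terms.sg a.par) (Terms.lin b.pushD fun u => [(1, n3 g a u c)]) ++
        Terms.scale (Terms.sg (a.par + b.par)) (Terms.lin c.pushD fun u => [(1, n3 g a b u)]))
  | n4 g a b c d => TermFun.bdFun g [a, b, c, d] ++ Terms.scale (Terms.sg g.par)
      (Terms.lin a.pushD (fun u => [(1, n4 g u b c d)]) ++
        Terms.scale (Terms.sg a.par) (Terms.lin b.pushD fun u => [(1, n4 g a u c d)]) ++
        Terms.scale (Terms.sg (a.par + b.par)) (Terms.lin c.pushD fun u => [(1, n4 g a b u d)]) ++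
        Terms.scale (Terms.sg (a.par + b.par + c.par))
          (Terms.lin d.pushD fun u => [(1, n4 g a b c u)]))

end Tree

namespace Terms

/-- Omit the trees which vanish for degree reasons. -/
def lowDeg (l : Terms) : Terms := l.filter fun p => Nat.ble p.2.deg 2

/-- Apply a differential at the root. -/
def pushTop (l : Terms) : Terms :=
  lin l fun
    | .n1 .D t => t.pushD
    | t => [(1, t)]

end Terms

/-- The equations between operations of degree two. -/
inductive Rel : ℕ → Type
  | leib : Rel 5
  | w5 : Rel 2
  | w6 : Rel 3
  | w7 : Rel 3
  | w8 : Rel 3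
  | w9 : Rel 4
  | w10 : Rel 4
  | w11 : Rel 4

/-- The difference of the two sides of an equation. -/
def Rel.fn : {m : ℕ} → Rel m → TermFun
  | _, leib => .leib₄ (.op .l2) (.op .l3) (.op .l4)
  | _, w5 => (TermFun.op .l211).add (.perm ([1, 0], [1, 0]) (.op .l211))
  | _, w6 => ((TermFun.op .l31).sub (.perm ([1, 0, 2], [1, 0, 2]) (.op .l31))).sub
      ((TermFun.op .l2).comp 0 2 2 (.op .l211))
  | _, w7 => ((((((TermFun.op .l31).sub (.perm ([1, 0, 2], [1, 0, 2]) (.op .l32))).add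
      (.perm ([2, 0, 1], [1, 2, 0]) (.op .l31))).sub (.op .l32)).add
      (.perm ([0, 2, 1], [0, 2, 1]) (.op .l31))).sub
      (.perm ([1, 2, 0], [2, 0, 1]) (.op .l32))).sub
      (((((TermFun.op .l21).comp 1 2 1 (.op .l21)).add
      ((TermFun.op .l21).comp 0 2 1 (.op .l21))).add
      (.perm ([1, 0, 2], [1, 0, 2]) ((TermFun.op .l21).comp 1 2 1 (.op .l21)))).add
      (.perm ([2, 0, 1], [1, 2, 0]) ((TermFun.op .l211).comp 1 2 0 (.op .l2))))
  | _, w8 => ((TermFun.op .l32).sub (.perm ([0, 2, 1], [0, 2, 1]) (.op .l32))).sub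
      ((((TermFun.op .l2).comp 1 2 2 (.op .l211)).neg.add
      ((TermFun.op .l211).comp 0 2 0 (.op .l2))).add
      (.perm ([1, 0, 2], [1, 0, 2]) ((TermFun.op .l211).comp 1 2 0 (.op .l2))))
  | _, w9 => ((TermFun.op .l4).add (.perm ([1, 0, 2, 3], [1, 0, 2, 3]) (.op .l4))).sub
      (((((TermFun.op .l2).comp 0 3 2 (.op .l31)).sub
      ((TermFun.op .l31).comp 2 2 0 (.op .l2))).add
      (.perm ([1, 2, 0, 3], [2, 0, 1, 3]) ((TermFun.op .l2).comp 1 3 2 (.op .l31)))).add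
      ((TermFun.op .l3).comp 0 2 1 (.op .l21)))
  | _, w10 => ((TermFun.op .l4).add (.perm ([0, 2, 1, 3], [0, 2, 1, 3]) (.op .l4))).sub
      (((((((TermFun.op .l2).comp 0 3 2 (.op .l32)).sub
      ((TermFun.op .l3).comp 1 2 1 (.op .l21))).add
      ((TermFun.op .l2).comp 1 3 2 (.op .l31))).sub
      ((TermFun.op .l31).comp 0 2 0 (.op .l2))).sub
      (.perm ([1, 0, 2, 3], [1, 0, 2, 3]) ((TermFun.op .l31).comp 1 2 0 (.op .l2)))).sub
      (.perm ([2, 0, 1, 3], [1, 2, 0, 3]) ((TermFun.op .l31).comp 2 2 0 (.op .l2))))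
  | _, w11 => ((TermFun.op .l4).add (.perm ([0, 1, 3, 2], [0, 1, 3, 2]) (.op .l4))).sub
      (((((((((((TermFun.op .l21).comp 0 3 1 (.op .l3)).sub
      ((TermFun.op .l32).comp 0 2 0 (.op .l2))).add
      ((TermFun.op .l32).comp 1 2 0 (.op .l2))).sub
      (.perm ([1, 0, 2, 3], [1, 0, 2, 3]) ((TermFun.op .l32).comp 1 2 0 (.op .l2)))).add
      ((TermFun.op .l3).comp 2 2 1 (.op .l21))).add
      (.perm ([0, 2, 1, 3], [0, 2, 1, 3]) ((TermFun.op .l32).comp 2 2 0 (.op .l2)))).sub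
      (.perm ([2, 0, 1, 3], [1, 2, 0, 3]) ((TermFun.op .l32).comp 2 2 0 (.op .l2)))).add
      ((TermFun.op .l2).comp 1 3 2 (.op .l32))).sub
      (.perm ([1, 0, 2, 3], [1, 0, 2, 3]) ((TermFun.op .l2).comp 1 3 2 (.op .l32)))).add
      (.perm ([1, 2, 0, 3], [2, 0, 1, 3]) ((TermFun.op .l21).comp 1 3 1 (.op .l3))))

/-- Trees of bilinear operations over an instance of an equation. -/
inductive RelTree : Type
  | base {m : ℕ} (r : Rel m) (ts : List Tree) : RelTree
  | left (t : RelTree) (u : Tree) : RelTree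
  | right (u : Tree) (t : RelTree) : RelTree

/-- The terms of an instance of an equation. -/
def RelTree.terms : RelTree → Terms
  | @base m r ts => if Nat.beq ts.length m then r.fn ts else []
  | left t u => Terms.lin t.terms fun v => [(1, .n2 .l2 v u)]
  | right u t => Terms.lin t.terms fun v => [(1, .n2 .l2 u v)]

namespace Word

/-- The hexadecimal digits of a number. -/
def digits : ℕ → ℕ → List ℕ → List ℕ
  | 0, _, l => l
  | n + 1, w, l => if Nat.beq w 0 then l else digits n (w / 16) (w % 16 :: l)

/-- Read a tree off a preorder word, and return the rest of the word. -/
def tree : ℕ → List ℕ → Tree × List ℕ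
  | 0, l => (.leaf 0, l)
  | _ + 1, [] => (.leaf 0, [])
  | n + 1, c :: l =>
    let p := tree n l
    let q := tree n p.2
    let r := tree n q.2
    let s := tree n r.2
    match c with
    | 9 => (.n2 .l2 p.1 q.1, q.2)
    | 10 => (.n2 .l21 p.1 q.1, q.2)
    | 11 => (.n2 .l211 p.1 q.1, q.2)
    | 12 => (.n3 .l3 p.1 q.1 r.1, r.2)
    | 13 => (.n3 .l31 p.1 q.1 r.1, r.2)
    | 14 => (.n3 .l32 p.1 q.1 r.1, r.2)
    | 15 => (.n4 .l4 p.1 q.1 r.1 s.1, s.2)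
    | i => (.leaf i, l)

/-- Read a list of trees off a word. -/
def trees : ℕ → List ℕ → List Tree
  | 0, _ => []
  | m + 1, l => (tree 20 l).1 :: trees m (tree 20 l).2

/-- Read an instance of an equation off a word, in which `3` and `4` stand for the bilinear
operation with the equation in its first and second argument, and `2` stands for the equation. -/
def relTree {m : ℕ} (r : Rel m) : ℕ → List ℕ → RelTree
  | n + 1, 3 :: l => .left (relTree r n (tree 20 l).2) (tree 20 l).1
  | n + 1, 4 :: l => .right (tree 20 l).1 (relTree r n (tree 20 l).2)
  | _ + 1, 2 :: l => .base r (trees m l)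
  | _, _ => .base r []

end Word

/-- Combination of instances of an equation. -/
def relSum {m : ℕ} (r : Rel m) (l : List (ℤ × ℕ)) : Terms :=
  l.flatMap fun p => Terms.scale p.1 (Word.relTree r 20 (Word.digits 40 p.2 [])).terms

/-- Combination of differentials of trees of degree three. -/
def boundarySum (l : List (ℤ × ℕ)) : Terms :=
  l.flatMap fun p =>
    let t := (Word.tree 20 (Word.digits 40 p.2 [])).1
    if Nat.ble 3 t.deg then Terms.scale p.1 t.pushD.lowDeg else []

namespace TermFun

/-- A tree before antisymmetrization. -/
def pre₂ : TermFun := smul 6 (op .l2)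

/-- A combination of trees before antisymmetrization. -/
def pre₃ : TermFun := (smul 24 (op .l3)).sub
  (smul 6 (((op .l21).comp 0 2 0 (op .l2)).add ((op .l21).comp 1 2 0 (op .l2))))

/-- A combination of trees before antisymmetrization. -/
def pre₄ : TermFun := (smul 72 (op .l4)).add
  (smul 36 (((((((op .l21).comp 0 3 1 (op .l3)).sub ((op .l31).comp 0 2 0 (op .l2))).add
    ((op .l32).comp 1 2 0 (op .l2))).sub ((op .l21).comp 1 3 1 (op .l3))).sub
    ((op .l31).comp 1 2 0 (op .l2))).add ((op .l32).comp 2 2 0 (op .l2))))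

/-- The permutations of two letters and their inverses. -/
def perms₂ : List (List ℕ × List ℕ) :=
  [([0, 1], [0, 1]), ([1, 0], [1, 0])]

/-- The permutations of three letters and their inverses. -/
def perms₃ : List (List ℕ × List ℕ) :=
  [([0, 1, 2], [0, 1, 2]), ([0, 2, 1], [0, 2, 1]), ([1, 0, 2], [1, 0, 2]),
    ([1, 2, 0], [2, 0, 1]), ([2, 0, 1], [1, 2, 0]), ([2, 1, 0], [2, 1, 0])]

/-- The permutations of four letters and their inverses. -/
def perms₄ : List (List ℕ × List ℕ) :=
  [([0, 1, 2, 3], [0, 1, 2, 3]), ([0, 1, 3, 2], [0, 1, 3, 2]), ([0, 2, 1, 3], [0, 2, 1, 3]),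
    ([0, 2, 3, 1], [0, 3, 1, 2]), ([0, 3, 1, 2], [0, 2, 3, 1]), ([0, 3, 2, 1], [0, 3, 2, 1]),
    ([1, 0, 2, 3], [1, 0, 2, 3]), ([1, 0, 3, 2], [1, 0, 3, 2]), ([1, 2, 0, 3], [2, 0, 1, 3]),
    ([1, 2, 3, 0], [3, 0, 1, 2]), ([1, 3, 0, 2], [2, 0, 3, 1]), ([1, 3, 2, 0], [3, 0, 2, 1]),
    ([2, 0, 1, 3], [1, 2, 0, 3]), ([2, 0, 3, 1], [1, 3, 0, 2]), ([2, 1, 0, 3], [2, 1, 0, 3]),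
    ([2, 1, 3, 0], [3, 1, 0, 2]), ([2, 3, 0, 1], [2, 3, 0, 1]), ([2, 3, 1, 0], [3, 2, 0, 1]),
    ([3, 0, 1, 2], [1, 2, 3, 0]), ([3, 0, 2, 1], [1, 3, 2, 0]), ([3, 1, 0, 2], [2, 1, 3, 0]),
    ([3, 1, 2, 0], [3, 1, 2, 0]), ([3, 2, 0, 1], [2, 3, 1, 0]), ([3, 2, 1, 0], [3, 2, 1, 0])]

end TermFun

end WL3

namespace WL3

open Finset

namespace TermFun

/-- The boundary of a binary operation of sign `s`. -/
def bd₂ (s : ℤ) (f : TermFun) : TermFun := ((op .D).comp₁ f).sub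
  (smul s ((f.comp 0 1 1 (op .D)).add (f.comp 1 1 1 (op .D))))

/-- The boundary of a ternary operation of sign `s`. -/
def bd₃ (s : ℤ) (f : TermFun) : TermFun := ((op .D).comp₁ f).sub
  (smul s (((f.comp 0 1 1 (op .D)).add (f.comp 1 1 1 (op .D))).add (f.comp 2 1 1 (op .D))))

/-- The boundary of a quaternary operation of sign `s`. -/
def bd₄ (s : ℤ) (f : TermFun) : TermFun := ((op .D).comp₁ f).sub
  (smul s ((((f.comp 0 1 1 (op .D)).add (f.comp 1 1 1 (op .D))).add
    (f.comp 2 1 1 (op .D))).add (f.comp 3 1 1 (op .D))))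

end TermFun

section Rep

variable {k : Type} [CommRing k] {L : ℤ → Type} [∀ i, AddCommGroup (L i)] [∀ i, Module k (L i)]
variable {n : ℕ} {I : Interp k L} {e : Fin n → ZMod 2} {lv : ℕ → Mod L n} {m : ℕ} {r : ℤ}
variable {f g : TermFun}

namespace Rep

theorem bd₂ (hlv : ∀ i, lv i ∈ Homog e L 1) {R : ℤ} {μ : MMap L L 2 r} (hf : Rep I e lv μ f)
    (h : -1 + r = R) (s : ℤ) (hs : s = (-1) ^ r.natAbs) :
    Rep I e lv (bd R (I.op .D) (I.op .D) μ h) (f.bd₂ s) := by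
  subst hs
  refine Rep.of_eq ?_ (bd_eq₂ _ _ h)
  refine ((op .D).comp₁ hlv hf h).sub hlv (Rep.smul hlv _ ?_)
  exact (hf.comp hlv (m₁ := 0) (m₂ := 1) 1 (by decide) (op .D) _).add hlv
    (hf.comp hlv (m₁ := 1) (m₂ := 0) 1 (by decide) (op .D) _)

theorem bd₃ (hlv : ∀ i, lv i ∈ Homog e L 1) {R : ℤ} {μ : MMap L L 3 r} (hf : Rep I e lv μ f)
    (h : -1 + r = R) (s : ℤ) (hs : s = (-1) ^ r.natAbs) :
    Rep I e lv (bd R (I.op .D) (I.op .D) μ h) (f.bd₃ s) := by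
  subst hs
  refine Rep.of_eq ?_ (bd_eq₃ _ _ h)
  refine ((op .D).comp₁ hlv hf h).sub hlv (Rep.smul hlv _ ?_)
  exact ((hf.comp hlv (m₁ := 0) (m₂ := 2) 1 (by decide) (op .D) _).add hlv
    (hf.comp hlv (m₁ := 1) (m₂ := 1) 1 (by decide) (op .D) _)).add hlv
    (hf.comp hlv (m₁ := 2) (m₂ := 0) 1 (by decide) (op .D) _)

theorem bd₄ (hlv : ∀ i, lv i ∈ Homog e L 1) {R : ℤ} {μ : MMap L L 4 r} (hf : Rep I e lv μ f)
    (h : -1 + r = R) (s : ℤ) (hs : s = (-1) ^ r.natAbs) :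
    Rep I e lv (bd R (I.op .D) (I.op .D) μ h) (f.bd₄ s) := by
  subst hs
  refine Rep.of_eq ?_ (bd_eq₄ _ _ h)
  refine ((op .D).comp₁ hlv hf h).sub hlv (Rep.smul hlv _ ?_)
  exact (((hf.comp hlv (m₁ := 0) (m₂ := 3) 1 (by decide) (op .D) _).add hlv
    (hf.comp hlv (m₁ := 1) (m₂ := 2) 1 (by decide) (op .D) _)).add hlv
    (hf.comp hlv (m₁ := 2) (m₂ := 1) 1 (by decide) (op .D) _)).add hlv
    (hf.comp hlv (m₁ := 3) (m₂ := 0) 1 (by decide) (op .D) _)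

theorem ev_eq {μ ν : MMap L L m r} (hf : Rep I e lv μ f) (hg : Rep I e lv ν g) (h : μ = ν)
    (ts : List Tree) (hts : ts.length = m) :
    Terms.ev I e lv (f ts) = Terms.ev I e lv (g ts) := by
  subst h
  rw [hf.eval ts hts, hg.eval ts hts]

theorem ev_eq_zero (hlv : ∀ i, lv i ∈ Homog e L 1) {μ : MMap L L m r} (hf : Rep I e lv μ f)
    (h : μ = 0) (ts : List Tree) (hts : ts.length = m) : Terms.ev I e lv (f ts) = 0 :=
  (hf.ev_eq (Rep.zero hlv) h ts hts).trans (Terms.ev_nil I e lv)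

end Rep

theorem Terms.ev_lin_update (F : MultilinearMap k (fun _ : Fin m => Mod L n) (Mod L n))
    (w : Fin m → Mod L n) (j : Fin m) (l : Terms) (f : Tree → Terms)
    (h : ∀ t, Terms.ev I e lv (f t) = F (Function.update w j (t.ev I e lv))) :
    Terms.ev I e lv (Terms.lin l f) = F (Function.update w j (Terms.ev I e lv l)) :=
  Terms.ev_lin I e lv l f (F.toLinearMap w j).toAddMonoidHom h

end Rep

namespace WeakLie3

variable {k : Type} [CommRing k] {L : ℤ → Type} [∀ i, AddCommGroup (L i)] [∀ i, Module k (L i)]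
variable (A : WeakLie3 k L)

/-- The operations of a weak Lie 3-algebra. -/
def interp : Interp k L where
  op g := match g with
    | .D => A.D
    | .l2 => A.l2
    | .l21 => A.l21
    | .l211 => A.l211
    | .l3 => A.l3
    | .l31 => A.l31
    | .l32 => A.l32
    | .l4 => A.l4
  multilinear g := match g with
    | .D => A.linD
    | .l2 => A.leib.lin2
    | .l21 => A.lin21
    | .l211 => A.lin211
    | .l3 => A.leib.lin3
    | .l31 => A.lin31
    | .l32 => A.lin32
    | .l4 => A.leib.lin4

variable {A} {n : ℕ} {e : Fin n → ZMod 2} {lv : ℕ → Mod L n}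

theorem rep_l2 : Rep A.interp e lv A.l2 (TermFun.op .l2) := Rep.op .l2
theorem rep_l21 : Rep A.interp e lv A.l21 (TermFun.op .l21) := Rep.op .l21
theorem rep_l211 : Rep A.interp e lv A.l211 (TermFun.op .l211) := Rep.op .l211
theorem rep_l3 : Rep A.interp e lv A.l3 (TermFun.op .l3) := Rep.op .l3
theorem rep_l31 : Rep A.interp e lv A.l31 (TermFun.op .l31) := Rep.op .l31
theorem rep_l32 : Rep A.interp e lv A.l32 (TermFun.op .l32) := Rep.op .l32
theorem rep_l4 : Rep A.interp e lv A.l4 (TermFun.op .l4) := Rep.op .l4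

theorem ev_bdFun₂ (hlv : ∀ i, lv i ∈ Homog e L 1) (g : Op 2) (ts : List Tree)
    (hts : ts.length = 2) : Terms.ev A.interp e lv (TermFun.bdFun g ts)
      = Terms.ev A.interp e lv ((TermFun.op g).bd₂ (Terms.sg g.par) ts) := by
  refine Eq.symm ?_
  cases g with
  | l2 => exact Rep.ev_eq (rep_l2.bd₂ hlv rfl _ rfl) (Rep.zero hlv) A.leib.eqL1 ts hts
  | l21 =>
    exact Rep.ev_eq (rep_l21.bd₂ hlv rfl _ rfl)
      (rep_l2.add hlv (rep_l2.perm hlv _ _ (by decide))) A.w1 ts hts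
  | l211 =>
    exact Rep.ev_eq (rep_l211.bd₂ hlv rfl _ rfl)
      (rep_l21.sub hlv (rep_l21.perm hlv _ _ (by decide))) A.w2 ts hts

theorem ev_bdFun₃ (hlv : ∀ i, lv i ∈ Homog e L 1) (g : Op 3) (ts : List Tree)
    (hts : ts.length = 3) : Terms.ev A.interp e lv (TermFun.bdFun g ts)
      = Terms.ev A.interp e lv ((TermFun.op g).bd₃ (Terms.sg g.par) ts) := by
  refine Eq.symm ?_
  cases g with
  | l3 => exact Rep.ev_eq (rep_l3.bd₃ hlv rfl _ rfl) (rep_l2.leib₂ hlv) A.leib.eqL2 ts hts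
  | l31 =>
    exact Rep.ev_eq (rep_l31.bd₃ hlv rfl _ rfl)
      ((rep_l3.add hlv (rep_l3.perm hlv _ _ (by decide))).add hlv
        (rep_l2.comp hlv (m₁ := 0) (m₂ := 1) 1 (by decide) rep_l21 _)) A.w3 ts hts
  | l32 =>
    exact Rep.ev_eq (rep_l32.bd₃ hlv rfl _ rfl)
      ((((rep_l3.add hlv (rep_l3.perm hlv _ _ (by decide))).sub hlv
        (rep_l2.comp hlv (m₁ := 1) (m₂ := 0) 1 (by decide) rep_l21 _)).add hlv
        (rep_l21.comp hlv (m₁ := 0) (m₂ := 1) 0 (by decide) rep_l2 _)).add hlv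
        (Rep.perm hlv _ _ (by decide)
          (rep_l21.comp hlv (m₁ := 1) (m₂ := 0) 0 (by decide) rep_l2 _))) A.w4 ts hts

theorem ev_bdFun₄ (hlv : ∀ i, lv i ∈ Homog e L 1) (g : Op 4) (ts : List Tree)
    (hts : ts.length = 4) : Terms.ev A.interp e lv (TermFun.bdFun g ts)
      = Terms.ev A.interp e lv ((TermFun.op g).bd₄ (Terms.sg g.par) ts) := by
  refine Eq.symm ?_
  cases g with
  | l4 => exact Rep.ev_eq (rep_l4.bd₄ hlv rfl _ rfl) (rep_l2.leib₃ hlv rep_l3) A.leib.eqL3 ts hts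

theorem ev_pushD (hlv : ∀ i, lv i ∈ Homog e L 1) (t : Tree) :
    Terms.ev A.interp e lv t.pushD = (Tree.n1 .D t).ev A.interp e lv := by
  have SG0 : Terms.sg 0 = 1 := rfl
  induction t with
  | leaf i => rw [Tree.pushD, Terms.ev_single]
  | n1 g a =>
    cases g
    have h1 := Rep.ev_eq_zero hlv ((Rep.op (I := A.interp) (e := e) (lv := lv) .D).comp₁ hlv
      (Rep.op .D) (R := -2) rfl) A.dd [a] rfl
    simpa [Tree.pushD, TermFun.comp₁, TermFun.op, Terms.lin, Terms.scale, Terms.ev, Tree.node]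
      using h1.symm
  | n2 g a b iha ihb =>
    rw [Tree.pushD, Terms.ev_append, ev_bdFun₂ hlv g _ rfl, Terms.ev_scale]
    have h0 : Terms.ev A.interp e lv (Terms.lin a.pushD fun u => [(1, .n2 g u b)])
        = (Tree.n2 g (.n1 .D a) b).ev A.interp e lv :=
      (Terms.ev_lin_update (hat e (A.interp.multilinear g))
        ![0, b.ev A.interp e lv] 0 _ _ fun t => by
          rw [Terms.ev_single, Tree.ev]; congr 1; funext j; fin_cases j <;> rfl).trans (by
        rw [iha, Tree.ev]; congr 1; funext j; fin_cases j <;> rfl)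
    have h1 : Terms.ev A.interp e lv (Terms.lin b.pushD fun u => [(1, .n2 g a u)])
        = (Tree.n2 g a (.n1 .D b)).ev A.interp e lv :=
      (Terms.ev_lin_update (hat e (A.interp.multilinear g))
        ![a.ev A.interp e lv, 0] 1 _ _ fun t => by
          rw [Terms.ev_single, Tree.ev]; congr 1; funext j; fin_cases j <;> rfl).trans (by
        rw [ihb, Tree.ev]; congr 1; funext j; fin_cases j <;> rfl)
    have h : Terms.ev A.interp e lv ((TermFun.op g).bd₂ (Terms.sg g.par) [a, b])
        = (Tree.n1 .D (.n2 g a b)).ev A.interp e lv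
          - Terms.sg g.par • ((Tree.n2 g (.n1 .D a) b).ev A.interp e lv
          + Terms.sg a.par • (Tree.n2 g a (.n1 .D b)).ev A.interp e lv) := by
      simp [TermFun.bd₂, TermFun.sub, TermFun.smul, TermFun.add, TermFun.comp₁, TermFun.comp,
        TermFun.op, Terms.lin, Tree.node, Terms.scale,
        Terms.ev_cons, Terms.ev_nil, SG0]
      module
    simp only [Terms.ev_append, Terms.ev_scale, h, h0, h1, sub_add_cancel]
  | n3 g a b c iha ihb ihc =>
    rw [Tree.pushD, Terms.ev_append, ev_bdFun₃ hlv g _ rfl, Terms.ev_scale]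
    have h0 : Terms.ev A.interp e lv (Terms.lin a.pushD fun u => [(1, .n3 g u b c)])
        = (Tree.n3 g (.n1 .D a) b c).ev A.interp e lv :=
      (Terms.ev_lin_update (hat e (A.interp.multilinear g))
        ![0, b.ev A.interp e lv, c.ev A.interp e lv] 0 _ _ fun t => by
          rw [Terms.ev_single, Tree.ev]; congr 1; funext j; fin_cases j <;> rfl).trans (by
        rw [iha, Tree.ev]; congr 1; funext j; fin_cases j <;> rfl)
    have h1 : Terms.ev A.interp e lv (Terms.lin b.pushD fun u => [(1, .n3 g a u c)])
        = (Tree.n3 g a (.n1 .D b) c).ev A.interp e lv :=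
      (Terms.ev_lin_update (hat e (A.interp.multilinear g))
        ![a.ev A.interp e lv, 0, c.ev A.interp e lv] 1 _ _ fun t => by
          rw [Terms.ev_single, Tree.ev]; congr 1; funext j; fin_cases j <;> rfl).trans (by
        rw [ihb, Tree.ev]; congr 1; funext j; fin_cases j <;> rfl)
    have h2 : Terms.ev A.interp e lv (Terms.lin c.pushD fun u => [(1, .n3 g a b u)])
        = (Tree.n3 g a b (.n1 .D c)).ev A.interp e lv :=
      (Terms.ev_lin_update (hat e (A.interp.multilinear g))
        ![a.ev A.interp e lv, b.ev A.interp e lv, 0] 2 _ _ fun t => by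
          rw [Terms.ev_single, Tree.ev]; congr 1; funext j; fin_cases j <;> rfl).trans (by
        rw [ihc, Tree.ev]; congr 1; funext j; fin_cases j <;> rfl)
    have h : Terms.ev A.interp e lv ((TermFun.op g).bd₃ (Terms.sg g.par) [a, b, c])
        = (Tree.n1 .D (.n3 g a b c)).ev A.interp e lv
          - Terms.sg g.par • ((Tree.n3 g (.n1 .D a) b c).ev A.interp e lv
          + Terms.sg a.par • (Tree.n3 g a (.n1 .D b) c).ev A.interp e lv
          + Terms.sg (a.par + b.par) • (Tree.n3 g a b (.n1 .D c)).ev A.interp e lv) := by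
      simp [TermFun.bd₃, TermFun.sub, TermFun.smul, TermFun.add, TermFun.comp₁, TermFun.comp,
        TermFun.op, Terms.lin, Tree.node, Terms.scale,
        Terms.ev_cons, Terms.ev_nil, SG0]
      module
    simp only [Terms.ev_append, Terms.ev_scale, h, h0, h1, h2, sub_add_cancel]
  | n4 g a b c d iha ihb ihc ihd =>
    rw [Tree.pushD, Terms.ev_append, ev_bdFun₄ hlv g _ rfl, Terms.ev_scale]
    have h0 : Terms.ev A.interp e lv (Terms.lin a.pushD fun u => [(1, .n4 g u b c d)])
        = (Tree.n4 g (.n1 .D a) b c d).ev A.interp e lv :=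
      (Terms.ev_lin_update (hat e (A.interp.multilinear g))
        ![0, b.ev A.interp e lv, c.ev A.interp e lv, d.ev A.interp e lv] 0 _ _ fun t => by
          rw [Terms.ev_single, Tree.ev]; congr 1; funext j; fin_cases j <;> rfl).trans (by
        rw [iha, Tree.ev]; congr 1; funext j; fin_cases j <;> rfl)
    have h1 : Terms.ev A.interp e lv (Terms.lin b.pushD fun u => [(1, .n4 g a u c d)])
        = (Tree.n4 g a (.n1 .D b) c d).ev A.interp e lv :=
      (Terms.ev_lin_update (hat e (A.interp.multilinear g))
        ![a.ev A.interp e lv, 0, c.ev A.interp e lv, d.ev A.interp e lv] 1 _ _ fun t => by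
          rw [Terms.ev_single, Tree.ev]; congr 1; funext j; fin_cases j <;> rfl).trans (by
        rw [ihb, Tree.ev]; congr 1; funext j; fin_cases j <;> rfl)
    have h2 : Terms.ev A.interp e lv (Terms.lin c.pushD fun u => [(1, .n4 g a b u d)])
        = (Tree.n4 g a b (.n1 .D c) d).ev A.interp e lv :=
      (Terms.ev_lin_update (hat e (A.interp.multilinear g))
        ![a.ev A.interp e lv, b.ev A.interp e lv, 0, d.ev A.interp e lv] 2 _ _ fun t => by
          rw [Terms.ev_single, Tree.ev]; congr 1; funext j; fin_cases j <;> rfl).trans (by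
        rw [ihc, Tree.ev]; congr 1; funext j; fin_cases j <;> rfl)
    have h3 : Terms.ev A.interp e lv (Terms.lin d.pushD fun u => [(1, .n4 g a b c u)])
        = (Tree.n4 g a b c (.n1 .D d)).ev A.interp e lv :=
      (Terms.ev_lin_update (hat e (A.interp.multilinear g))
        ![a.ev A.interp e lv, b.ev A.interp e lv, c.ev A.interp e lv, 0] 3 _ _ fun t => by
          rw [Terms.ev_single, Tree.ev]; congr 1; funext j; fin_cases j <;> rfl).trans (by
        rw [ihd, Tree.ev]; congr 1; funext j; fin_cases j <;> rfl)
    have h : Terms.ev A.interp e lv ((TermFun.op g).bd₄ (Terms.sg g.par) [a, b, c, d])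
        = (Tree.n1 .D (.n4 g a b c d)).ev A.interp e lv
          - Terms.sg g.par • ((Tree.n4 g (.n1 .D a) b c d).ev A.interp e lv
          + Terms.sg a.par • (Tree.n4 g a (.n1 .D b) c d).ev A.interp e lv
          + Terms.sg (a.par + b.par) • (Tree.n4 g a b (.n1 .D c) d).ev A.interp e lv
          + Terms.sg (a.par + b.par + c.par) • (Tree.n4 g a b c (.n1 .D d)).ev A.interp e lv) := by
      simp [TermFun.bd₄, TermFun.sub, TermFun.smul, TermFun.add, TermFun.comp₁, TermFun.comp,
        TermFun.op, Terms.lin, Tree.node, Terms.scale,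
        Terms.ev_cons, Terms.ev_nil, add_assoc, SG0]
      module
    simp only [Terms.ev_append, Terms.ev_scale, h, h0, h1, h2, h3, sub_add_cancel]

end WeakLie3

end WL3

namespace WL3

open Finset

namespace WeakLie3

variable {k : Type} [CommRing k] {L : ℤ → Type} [∀ i, AddCommGroup (L i)] [∀ i, Module k (L i)]
variable {A : WeakLie3 k L} {n : ℕ} {e : Fin n → ZMod 2} {lv : ℕ → Mod L n}

theorem ev_pushTop (hlv : ∀ i, lv i ∈ Homog e L 1) (l : Terms) :
    Terms.ev A.interp e lv l.pushTop = Terms.ev A.interp e lv l := by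
  refine Terms.ev_lin A.interp e lv l _ (AddMonoidHom.id _) fun t => ?_
  split
  · exact ev_pushD hlv _
  · exact Terms.ev_single _ _ _ _

theorem ev_lowDeg (l : Terms) :
    Terms.ev A.interp e lv l.lowDeg = Terms.ev A.interp e lv l := by
  induction l with
  | nil => rfl
  | cons p l ih =>
    rw [Terms.lowDeg, List.filter_cons]
    split_ifs with h
    · rw [Terms.ev_cons, Terms.ev_cons, ← ih, Terms.lowDeg]
    · have h1 : 3 ≤ p.2.deg := by
        rw [Nat.ble_eq] at h; omega
      rw [Terms.ev_cons, Tree.ev_eq_zero_of_deg A.bound h1, smul_zero, zero_add, ← ih,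
        Terms.lowDeg]

theorem ev_boundarySum (hlv : ∀ i, lv i ∈ Homog e L 1) (l : List (ℤ × ℕ)) :
    Terms.ev A.interp e lv (boundarySum l) = 0 := by
  induction l with
  | nil => rfl
  | cons p l ih =>
    rw [boundarySum, List.flatMap_cons, Terms.ev_append]
    refine (congrArg _ ih).trans ((add_zero _).trans ?_)
    dsimp only
    split_ifs with h
    · rw [Terms.ev_scale, ev_lowDeg, ev_pushD hlv, Tree.ev,
        Tree.ev_eq_zero_of_deg A.bound (Nat.le_of_ble_eq_true h)]
      rw [MultilinearMap.map_coord_zero _ 0 rfl, smul_zero]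
    · rfl

theorem ev_rel (hlv : ∀ i, lv i ∈ Homog e L 1) {m : ℕ} (r : Rel m) (ts : List Tree)
    (hts : ts.length = m) : Terms.ev A.interp e lv (r.fn ts) = 0 := by
  cases r with
  | leib =>
    exact Rep.ev_eq_zero hlv (rep_l2.leib₄ hlv rep_l3 rep_l4) A.leib.eqL4.symm ts hts
  | w5 =>
    exact Rep.ev_eq_zero hlv (rep_l211.add hlv (rep_l211.perm hlv _ _ (by decide))) A.w5 ts hts
  | w6 =>
    exact Rep.ev_eq_zero hlv ((rep_l31.sub hlv (rep_l31.perm hlv _ _ (by decide))).sub hlv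
      (rep_l2.comp hlv (m₁ := 0) (m₂ := 1) 2 (by decide) rep_l211 _)) (sub_eq_zero.mpr A.w6) ts hts
  | w7 =>
    refine Rep.ev_eq_zero hlv (Rep.sub hlv ?_ ?_) (sub_eq_zero.mpr A.w7) ts hts
    all_goals repeat' first
      | exact rep_l31
      | exact rep_l32
      | exact rep_l21.comp hlv (m₁ := 0) (m₂ := 1) 1 (by decide) rep_l21 _
      | exact rep_l21.comp hlv (m₁ := 1) (m₂ := 0) 1 (by decide) rep_l21 _
      | exact rep_l211.comp hlv (m₁ := 1) (m₂ := 0) 0 (by decide) rep_l2 _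
      | refine Rep.add hlv ?_ ?_
      | refine Rep.sub hlv ?_ ?_
      | refine Rep.perm hlv _ _ (by decide) ?_
  | w8 =>
    refine Rep.ev_eq_zero hlv (Rep.sub hlv ?_ ?_) (sub_eq_zero.mpr A.w8) ts hts
    all_goals repeat' first
      | exact rep_l32
      | exact rep_l2.comp hlv (m₁ := 1) (m₂ := 0) 2 (by decide) rep_l211 _
      | exact rep_l211.comp hlv (m₁ := 0) (m₂ := 1) 0 (by decide) rep_l2 _
      | exact rep_l211.comp hlv (m₁ := 1) (m₂ := 0) 0 (by decide) rep_l2 _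
      | refine Rep.add hlv ?_ ?_
      | refine Rep.sub hlv ?_ ?_
      | refine Rep.neg hlv ?_
      | refine Rep.perm hlv _ _ (by decide) ?_
  | w9 =>
    refine Rep.ev_eq_zero hlv (Rep.sub hlv ?_ ?_) (sub_eq_zero.mpr A.w9) ts hts
    all_goals repeat' first
      | exact rep_l4
      | exact rep_l2.comp hlv (m₁ := 0) (m₂ := 1) 2 (by decide) rep_l31 _
      | exact rep_l2.comp hlv (m₁ := 1) (m₂ := 0) 2 (by decide) rep_l31 _
      | exact rep_l31.comp hlv (m₁ := 2) (m₂ := 0) 0 (by decide) rep_l2 _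
      | exact rep_l3.comp hlv (m₁ := 0) (m₂ := 2) 1 (by decide) rep_l21 _
      | refine Rep.add hlv ?_ ?_
      | refine Rep.sub hlv ?_ ?_
      | refine Rep.perm hlv _ _ (by decide) ?_
  | w10 =>
    refine Rep.ev_eq_zero hlv (Rep.sub hlv ?_ ?_) (sub_eq_zero.mpr A.w10) ts hts
    all_goals repeat' first
      | exact rep_l4
      | exact rep_l2.comp hlv (m₁ := 0) (m₂ := 1) 2 (by decide) rep_l32 _
      | exact rep_l2.comp hlv (m₁ := 1) (m₂ := 0) 2 (by decide) rep_l31 _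
      | exact rep_l3.comp hlv (m₁ := 1) (m₂ := 1) 1 (by decide) rep_l21 _
      | exact rep_l31.comp hlv (m₁ := 0) (m₂ := 2) 0 (by decide) rep_l2 _
      | exact rep_l31.comp hlv (m₁ := 1) (m₂ := 1) 0 (by decide) rep_l2 _
      | exact rep_l31.comp hlv (m₁ := 2) (m₂ := 0) 0 (by decide) rep_l2 _
      | refine Rep.add hlv ?_ ?_
      | refine Rep.sub hlv ?_ ?_
      | refine Rep.perm hlv _ _ (by decide) ?_
  | w11 =>
    refine Rep.ev_eq_zero hlv (Rep.sub hlv ?_ ?_) (sub_eq_zero.mpr A.w11) ts hts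
    all_goals repeat' first
      | exact rep_l4
      | exact rep_l21.comp hlv (m₁ := 0) (m₂ := 1) 1 (by decide) rep_l3 _
      | exact rep_l21.comp hlv (m₁ := 1) (m₂ := 0) 1 (by decide) rep_l3 _
      | exact rep_l2.comp hlv (m₁ := 1) (m₂ := 0) 2 (by decide) rep_l32 _
      | exact rep_l3.comp hlv (m₁ := 2) (m₂ := 0) 1 (by decide) rep_l21 _
      | exact rep_l32.comp hlv (m₁ := 0) (m₂ := 2) 0 (by decide) rep_l2 _
      | exact rep_l32.comp hlv (m₁ := 1) (m₂ := 1) 0 (by decide) rep_l2 _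
      | exact rep_l32.comp hlv (m₁ := 2) (m₂ := 0) 0 (by decide) rep_l2 _
      | refine Rep.add hlv ?_ ?_
      | refine Rep.sub hlv ?_ ?_
      | refine Rep.perm hlv _ _ (by decide) ?_

theorem ev_relTree (hlv : ∀ i, lv i ∈ Homog e L 1) (t : RelTree) :
    Terms.ev A.interp e lv t.terms = 0 := by
  induction t with
  | @base m r ts =>
    rw [RelTree.terms]
    split_ifs with h
    · exact ev_rel hlv r ts (Nat.eq_of_beq_eq_true h)
    · rfl
  | left t u ih =>
    rw [RelTree.terms, Terms.ev_lin_update (hat e (A.interp.multilinear .l2))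
      ![0, u.ev A.interp e lv] 0, ih, MultilinearMap.map_update_zero]
    intro t
    rw [Terms.ev_single, Tree.ev]; congr 1; funext j; fin_cases j <;> rfl
  | right u t ih =>
    rw [RelTree.terms, Terms.ev_lin_update (hat e (A.interp.multilinear .l2))
      ![u.ev A.interp e lv, 0] 1, ih, MultilinearMap.map_update_zero]
    intro t
    rw [Terms.ev_single, Tree.ev]; congr 1; funext j; fin_cases j <;> rfl

theorem ev_relSum (hlv : ∀ i, lv i ∈ Homog e L 1) {m : ℕ} (r : Rel m) (l : List (ℤ × ℕ)) :
    Terms.ev A.interp e lv (relSum r l) = 0 := by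
  induction l with
  | nil => rfl
  | cons p l ih =>
    rw [relSum, List.flatMap_cons, Terms.ev_append, Terms.ev_scale, ev_relTree hlv, smul_zero,
      zero_add]
    exact ih

end WeakLie3

end WL3

namespace WL3

open Finset

/-! ## Alternating operations and scalar multiples -/

section Scalars

variable {k : Type} [CommRing k] {L : ℤ → Type} [∀ i, AddCommGroup (L i)] [∀ i, Module k (L i)]

theorem pa_add {m : ℕ} {r : ℤ} (σ : Equiv.Perm (Fin m)) (μ ν : MMap L L m r) :
    pa σ (μ + ν) = pa σ μ + pa σ ν := by
  funext d x
  simp only [pa, Pi.add_apply, gcast_add, smul_add]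

theorem pa_smul {m : ℕ} {r : ℤ} (σ : Equiv.Perm (Fin m)) (c : k) (μ : MMap L L m r) :
    pa σ (c • μ) = c • pa σ μ := by
  funext d x
  simp only [pa, Pi.smul_apply, gcast_smul, smul_comm c]

theorem pa_zsmul {m : ℕ} {r : ℤ} (σ : Equiv.Perm (Fin m)) (c : ℤ) (μ : MMap L L m r) :
    pa σ (c • μ) = c • pa σ μ := by
  funext d x
  simp only [pa, Pi.smul_apply, gcast_zsmul, smul_comm c]

theorem pa_sum {ι : Type*} (s : Finset ι) {m : ℕ} {r : ℤ} (σ : Equiv.Perm (Fin m))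
    (μ : ι → MMap L L m r) : pa σ (∑ i ∈ s, μ i) = ∑ i ∈ s, pa σ (μ i) :=
  map_sum (AddMonoidHom.mk' (pa (L := L) (M := L) (r := r) σ) (pa_add σ)) μ s

theorem eq_of_hat_genericArg {m : ℕ} {r : ℤ} {μ ν : MMap L L m r} (hμ : IsMultilinear k μ)
    (hν : IsMultilinear k ν) (h : ∀ d (x : ∀ j, L (d j)), hat (genericPar d) hμ (genericArg d x)
      = hat (genericPar d) hν (genericArg d x)) : μ = ν := by
  refine sub_eq_zero.mp (eq_zero_of_hat_genericArg (hμ.sub hν) fun d x => ?_)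
  have h1 : IsMultilinear k (μ + (-1 : ℤ) • ν) := hμ.add (hν.zsmul _)
  rw [hat_congr (genericPar d) (hμ.sub hν) h1 (by rw [neg_one_zsmul, sub_eq_add_neg]),
    hat_add _ hμ (hν.zsmul _) _ _ _ (genericArg_mem d x),
    hat_zsmul _ hν _ _ _ _ (genericArg_mem d x), h, neg_one_zsmul, add_neg_cancel]

theorem pa_pa {m : ℕ} {r : ℤ} {μ : MMap L L m r} (hμ : IsMultilinear k μ)
    (τ σ : Equiv.Perm (Fin m)) : pa τ (pa σ μ) = pa (σ * τ) μ := by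
  refine eq_of_hat_genericArg ((hμ.pa σ).pa τ) (hμ.pa _) fun d x => ?_
  rw [hat_pa _ (hμ.pa σ) τ _ _ _ (genericArg_mem d x),
    hat_pa _ hμ σ _ _ _ fun j => genericArg_mem d x _,
    hat_pa _ hμ (σ * τ) _ _ _ (genericArg_mem d x), smul_smul, ksgn_one, ksgn_one, ksgn_one,
    Equiv.Perm.sign_mul, Units.val_mul, mul_comm]
  rfl

theorem pa_alt {m : ℕ} {r : ℤ} {μ : MMap L L m r} (hμ : IsMultilinear k μ)
    (τ : Equiv.Perm (Fin m)) : pa τ (alt μ) = (Equiv.Perm.sign τ : ℤ) • alt μ := by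
  unfold alt
  rw [pa_sum, smul_sum]
  refine Fintype.sum_equiv (Equiv.mulRight τ) _ _ fun σ => ?_
  rw [pa_zsmul, pa_pa hμ, smul_smul, Equiv.coe_mulRight, Equiv.Perm.sign_mul, Units.val_mul,
    mul_comm, mul_assoc, ← Units.val_mul, Int.units_mul_self, Units.val_one, mul_one]

theorem alt_add {m : ℕ} {r : ℤ} (μ ν : MMap L L m r) : alt (μ + ν) = alt μ + alt ν := by
  unfold alt
  rw [← sum_add_distrib]
  exact sum_congr rfl fun σ _ => by rw [pa_add, smul_add]

theorem alt_zsmul {m : ℕ} {r : ℤ} (c : ℤ) (μ : MMap L L m r) : alt (c • μ) = c • alt μ := by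
  unfold alt
  rw [smul_sum]
  exact sum_congr rfl fun σ _ => by rw [pa_zsmul, smul_comm]

theorem alt_sub {m : ℕ} {r : ℤ} (μ ν : MMap L L m r) : alt (μ - ν) = alt μ - alt ν := by
  rw [sub_eq_add_neg, sub_eq_add_neg, alt_add, ← neg_one_zsmul, alt_zsmul, neg_one_zsmul]

theorem IsMultilinear.alt {m : ℕ} {r : ℤ} {μ : MMap L L m r} (hμ : IsMultilinear k μ) :
    IsMultilinear k (alt μ) :=
  IsMultilinear.sum _ fun σ => (hμ.pa σ).zsmul _

theorem pcomp_smul {m₁ m₂ n : ℕ} {r s : ℤ} {μ : MMap L L (m₁ + 1 + m₂) r} (ν : MMap L L n s)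
    (hμ : IsMultilinear k μ) (a b : k) :
    pcomp m₁ m₂ (a • μ) (b • ν) = (a * b) • pcomp m₁ m₂ μ ν := by
  funext d x
  have h : ∀ v, outArgs m₁ m₂ n s d x (b • v)
      = Function.update (outArgs m₁ m₂ n s d x v) (Fin.castAdd m₂ (Fin.natAdd m₁ 0))
        (b • gcast (outDeg_mid m₁ m₂ n s d 0).symm v) := by
    intro v
    funext i
    obtain ⟨i, rfl⟩ | ⟨i, rfl⟩ | ⟨i, rfl⟩ := block_cases m₁ 1 m₂ i
    · rw [Function.update_of_ne, outArgs_left, outArgs_left]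
      simp [Fin.ext_iff]; omega
    · obtain rfl := Subsingleton.elim i 0
      rw [Function.update_self, outArgs_mid, gcast_smul]
    · rw [Function.update_of_ne, outArgs_right, outArgs_right]
      simp [Fin.ext_iff]; omega
  have h' : ∀ v, outArgs m₁ m₂ n s d x v
      = Function.update (outArgs m₁ m₂ n s d x v) (Fin.castAdd m₂ (Fin.natAdd m₁ 0))
        (gcast (outDeg_mid m₁ m₂ n s d 0).symm v) := by
    intro v
    rw [← outArgs_mid, Function.update_eq_self]
  rw [Pi.smul_apply, Pi.smul_apply, pcomp_apply, pcomp_apply, Pi.smul_apply, Pi.smul_apply,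
    Pi.smul_apply, Pi.smul_apply, h, (hμ _ _ _).2, ← h', gcast_smul, gcast_smul,
    smul_smul a b, smul_comm]

theorem pc_smul {R : ℤ} {m₁ m₂ n : ℕ} {r s : ℤ} {μ : MMap L L (m₁ + 1 + m₂) r}
    (ν : MMap L L n s) (hμ : IsMultilinear k μ) (a b : k) (h : r + s = R) :
    pc R m₁ m₂ (a • μ) (b • ν) h = (a * b) • pc R m₁ m₂ μ ν h := by
  subst h
  exact pcomp_smul ν hμ a b

theorem fc1_smul {R : ℤ} {n : ℕ} {r s : ℤ} {μ : MMap L L 1 r}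
    (ν : MMap L L n s) (hμ : IsMultilinear k μ) (c : k) (h : r + s = R) :
    fc1 R μ (c • ν) h = c • fc1 R μ ν h := by
  subst h
  funext d x
  have h1 : ∀ v : L (s + ∑ j, d j), (fun _ : Fin 1 => v)
      = Function.update (fun _ : Fin 1 => (0 : L (s + ∑ j, d j))) 0 v := by
    intro v; ext1 i; rw [Subsingleton.elim i 0, Function.update_self]
  change gcast _ (μ _ _) = c • gcast _ (μ _ _)
  rw [← gcast_smul]
  congr 1
  rw [h1 (ν d x), ← (hμ _ _ _).2, ← h1]
  rfl

theorem leib₂_smul {l2 : MMap L L 2 0} (h2 : IsMultilinear k l2) (c : k) :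
    leib₂ (c • l2) = c ^ 2 • leib₂ l2 := by
  unfold leib₂
  simp only [pc_smul (m₁ := 0) (m₂ := 1) _ h2, pc_smul (m₁ := 1) (m₂ := 0) _ h2, pa_smul,
    smul_sub, ← pow_two]

theorem leib₃_smul {l2 : MMap L L 2 0} {l3 : MMap L L 3 1} (h2 : IsMultilinear k l2)
    (h3 : IsMultilinear k l3) (c : k) :
    leib₃ (c • l2) (c ^ 2 • l3) = c ^ 3 • leib₃ l2 l3 := by
  have e1 : c * c ^ 2 = c ^ 3 := by ring
  have e2 : c ^ 2 * c = c ^ 3 := by ring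
  unfold leib₃
  simp only [pc_smul (m₁ := 0) (m₂ := 1) _ h2, pc_smul (m₁ := 1) (m₂ := 0) _ h2,
    pc_smul (m₁ := 0) (m₂ := 2) _ h3, pc_smul (m₁ := 1) (m₂ := 1) _ h3,
    pc_smul (m₁ := 2) (m₂ := 0) _ h3, pa_smul, smul_sub, smul_add, e1, e2]

theorem leib₄_smul {l2 : MMap L L 2 0} {l3 : MMap L L 3 1} {l4 : MMap L L 4 2}
    (h2 : IsMultilinear k l2) (h3 : IsMultilinear k l3) (h4 : IsMultilinear k l4) (c : k) :
    leib₄ (c • l2) (c ^ 2 • l3) (c ^ 3 • l4) = c ^ 4 • leib₄ l2 l3 l4 := by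
  have e1 : c * c ^ 3 = c ^ 4 := by ring
  have e2 : c ^ 2 * c ^ 2 = c ^ 4 := by ring
  have e3 : c ^ 3 * c = c ^ 4 := by ring
  unfold leib₄
  simp only [pc_smul (m₁ := 0) (m₂ := 1) _ h2, pc_smul (m₁ := 1) (m₂ := 0) _ h2,
    pc_smul (m₁ := 0) (m₂ := 2) _ h3, pc_smul (m₁ := 1) (m₂ := 1) _ h3,
    pc_smul (m₁ := 2) (m₂ := 0) _ h3, pc_smul (m₁ := 0) (m₂ := 3) _ h4,
    pc_smul (m₁ := 1) (m₂ := 2) _ h4, pc_smul (m₁ := 2) (m₂ := 1) _ h4,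
    pc_smul (m₁ := 3) (m₂ := 0) _ h4, pa_smul, smul_sub, smul_add, e1, e2, e3]

theorem bd_smul₂ {R r : ℤ} {D : MMap L L 1 (-1)} {μ : MMap L L 2 r} (hD : IsMultilinear k D)
    (hμ : IsMultilinear k μ) (c : k) (h : -1 + r = R) :
    bd R D D (c • μ) h = c • bd R D D μ h := by
  have e : ∀ {m₁ m₂ : ℕ} {μ : MMap L L (m₁ + 1 + m₂) r} (hμ : IsMultilinear k μ)
      (h : r + -1 = R), pc R m₁ m₂ (c • μ) D h = c • pc R m₁ m₂ μ D h := fun hμ h => by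
    simpa using pc_smul D hμ c 1 h
  rw [bd_eq₂, bd_eq₂, fc1_smul _ hD, e (m₁ := 0) (m₂ := 1) hμ, e (m₁ := 1) (m₂ := 0) hμ,
    ← smul_add, smul_comm _ c, ← smul_sub]

theorem bd_smul₃ {R r : ℤ} {D : MMap L L 1 (-1)} {μ : MMap L L 3 r} (hD : IsMultilinear k D)
    (hμ : IsMultilinear k μ) (c : k) (h : -1 + r = R) :
    bd R D D (c • μ) h = c • bd R D D μ h := by
  have e : ∀ {m₁ m₂ : ℕ} {μ : MMap L L (m₁ + 1 + m₂) r} (hμ : IsMultilinear k μ)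
      (h : r + -1 = R), pc R m₁ m₂ (c • μ) D h = c • pc R m₁ m₂ μ D h := fun hμ h => by
    simpa using pc_smul D hμ c 1 h
  rw [bd_eq₃, bd_eq₃, fc1_smul _ hD, e (m₁ := 0) (m₂ := 2) hμ, e (m₁ := 1) (m₂ := 1) hμ,
    e (m₁ := 2) (m₂ := 0) hμ, ← smul_add, ← smul_add, smul_comm _ c, ← smul_sub]

theorem bd_smul₄ {R r : ℤ} {D : MMap L L 1 (-1)} {μ : MMap L L 4 r} (hD : IsMultilinear k D)
    (hμ : IsMultilinear k μ) (c : k) (h : -1 + r = R) :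
    bd R D D (c • μ) h = c • bd R D D μ h := by
  have e : ∀ {m₁ m₂ : ℕ} {μ : MMap L L (m₁ + 1 + m₂) r} (hμ : IsMultilinear k μ)
      (h : r + -1 = R), pc R m₁ m₂ (c • μ) D h = c • pc R m₁ m₂ μ D h := fun hμ h => by
    simpa using pc_smul D hμ c 1 h
  rw [bd_eq₄, bd_eq₄, fc1_smul _ hD, e (m₁ := 0) (m₂ := 3) hμ, e (m₁ := 1) (m₂ := 2) hμ,
    e (m₁ := 2) (m₂ := 1) hμ, e (m₁ := 3) (m₂ := 0) hμ, ← smul_add, ← smul_add, ← smul_add,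
    smul_comm _ c, ← smul_sub]

end Scalars

namespace WeakLie3

variable {k : Type} [CommRing k] {L : ℤ → Type} [∀ i, AddCommGroup (L i)] [∀ i, Module k (L i)]
variable (A : WeakLie3 k L)

/-- Twelve times the skew-symmetrization of the bilinear operation. -/
def sk₂ : MMap L L 2 0 := alt ((6 : ℤ) • A.l2)

/-- The operation whose alternating sum is a multiple of the trilinear skew operation. -/
def preSk₃ : MMap L L 3 1 :=
  (24 : ℤ) • A.l3 - (6 : ℤ) • (pc 1 0 1 A.l21 A.l2 + pc 1 1 0 A.l21 A.l2)

/-- The operation whose alternating sum is a multiple of the quadrilinear skew operation. -/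
def preSk₄ : MMap L L 4 2 :=
  (72 : ℤ) • A.l4 + (36 : ℤ) • (pc 2 0 1 A.l21 A.l3 - pc 2 0 2 A.l31 A.l2 + pc 2 1 1 A.l32 A.l2
    - pc 2 1 0 A.l21 A.l3 - pc 2 1 1 A.l31 A.l2 + pc 2 2 0 A.l32 A.l2)

/-- `12 ^ 2` times the skew-symmetrization of the trilinear operation. -/
def sk₃ : MMap L L 3 1 := alt A.preSk₃

/-- `12 ^ 3` times the skew-symmetrization of the quadrilinear operation. -/
def sk₄ : MMap L L 4 2 := alt A.preSk₄

variable {A} {n : ℕ} {e : Fin n → ZMod 2} {lv : ℕ → Mod L n}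

theorem rep_sk₂ (hlv : ∀ i, lv i ∈ Homog e L 1) :
    Rep A.interp e lv A.sk₂ (TermFun.alt TermFun.perms₂ TermFun.pre₂) :=
  (rep_l2.smul hlv 6).alt hlv _ (by decide +kernel)

theorem rep_preSk₃ (hlv : ∀ i, lv i ∈ Homog e L 1) :
    Rep A.interp e lv A.preSk₃ TermFun.pre₃ :=
  (rep_l3.smul hlv 24).sub hlv
    (((rep_l21.comp hlv (m₁ := 0) (m₂ := 1) 0 (by decide) rep_l2 _).add hlv
      (rep_l21.comp hlv (m₁ := 1) (m₂ := 0) 0 (by decide) rep_l2 _)).smul hlv 6)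

theorem rep_sk₃ (hlv : ∀ i, lv i ∈ Homog e L 1) :
    Rep A.interp e lv A.sk₃ (TermFun.alt TermFun.perms₃ TermFun.pre₃) :=
  (rep_preSk₃ hlv).alt hlv _ (by decide +kernel)

theorem rep_preSk₄ (hlv : ∀ i, lv i ∈ Homog e L 1) :
    Rep A.interp e lv A.preSk₄ TermFun.pre₄ :=
  (rep_l4.smul hlv 72).add hlv
    (((((((rep_l21.comp hlv (m₁ := 0) (m₂ := 1) 1 (by decide) rep_l3 _).sub hlv
      (rep_l31.comp hlv (m₁ := 0) (m₂ := 2) 0 (by decide) rep_l2 _)).add hlv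
      (rep_l32.comp hlv (m₁ := 1) (m₂ := 1) 0 (by decide) rep_l2 _)).sub hlv
      (rep_l21.comp hlv (m₁ := 1) (m₂ := 0) 1 (by decide) rep_l3 _)).sub hlv
      (rep_l31.comp hlv (m₁ := 1) (m₂ := 1) 0 (by decide) rep_l2 _)).add hlv
      (rep_l32.comp hlv (m₁ := 2) (m₂ := 0) 0 (by decide) rep_l2 _)).smul hlv 36)

theorem rep_sk₄ (hlv : ∀ i, lv i ∈ Homog e L 1) :
    Rep A.interp e lv A.sk₄ (TermFun.alt TermFun.perms₄ TermFun.pre₄) :=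
  (rep_preSk₄ hlv).alt hlv _ (by decide +kernel)

variable (A)

theorem multilinear_sk₂ : IsMultilinear k A.sk₂ :=
  (rep_sk₂ (e := fun _ : Fin 0 => 0) (lv := fun _ => 0) fun _ => zero_mem _).multilinear

theorem multilinear_preSk₃ : IsMultilinear k A.preSk₃ :=
  (rep_preSk₃ (e := fun _ : Fin 0 => 0) (lv := fun _ => 0) fun _ => zero_mem _).multilinear

theorem multilinear_preSk₄ : IsMultilinear k A.preSk₄ :=
  (rep_preSk₄ (e := fun _ : Fin 0 => 0) (lv := fun _ => 0) fun _ => zero_mem _).multilinear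

theorem multilinear_sk₃ : IsMultilinear k A.sk₃ := A.multilinear_preSk₃.alt

theorem multilinear_sk₄ : IsMultilinear k A.sk₄ := A.multilinear_preSk₄.alt

section Skew

variable [Invertible (2 : k)] [Invertible (3 : k)]

/-- The inverse of twelve. -/
def invTwelve (k : Type) [CommRing k] [Invertible (2 : k)] [Invertible (3 : k)] : k :=
  ⅟ (2 : k) * ⅟ (2 : k) * ⅟ (3 : k)

theorem skew2_eq : skew2 k A = invTwelve k • A.sk₂ := by
  have h : invTwelve k * ((6 : ℤ) : k) = ⅟ (2 : k) := by
    unfold invTwelve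
    linear_combination (⅟ (2 : k) * ⅟ (3 : k) * 3) * invOf_mul_self (2 : k)
      + ⅟ (2 : k) * invOf_mul_self (3 : k)
  unfold sk₂
  rw [alt_zsmul, ← Int.cast_smul_eq_zsmul k, smul_smul, h]
  rfl

theorem skew3_eq : skew3 k A = invTwelve k ^ 2 • A.sk₃ := by
  have e2 := invOf_mul_self (2 : k)
  have e3 := invOf_mul_self (3 : k)
  have h : invTwelve k ^ 2 * ((24 : ℤ) : k) = ⅟ (2 : k) * ⅟ (3 : k) := by
    unfold invTwelve
    generalize ⅟ (2 : k) = a at *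
    generalize ⅟ (3 : k) = b at *
    push_cast
    have : a ^ 4 * b ^ 2 * 24 = (a * 2) ^ 3 * (b * 3) * (a * b) := by ring
    linear_combination this + (by rw [e2, e3]; ring :
      (a * 2) ^ 3 * (b * 3) * (a * b) = a * b)
  have h' : invTwelve k ^ 2 * ((6 : ℤ) : k)
      = ⅟ (2 : k) * ⅟ (2 : k) * ⅟ (2 : k) * ⅟ (3 : k) := by
    unfold invTwelve
    generalize ⅟ (2 : k) = a at *
    generalize ⅟ (3 : k) = b at *
    push_cast
    have : a ^ 4 * b ^ 2 * 6 = (a * 2) * (b * 3) * (a * a * a * b) := by ring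
    linear_combination this + (by rw [e2, e3]; ring :
      (a * 2) * (b * 3) * (a * a * a * b) = a * a * a * b)
  unfold sk₃ preSk₃
  rw [alt_sub, alt_zsmul, alt_zsmul, ← Int.cast_smul_eq_zsmul k, ← Int.cast_smul_eq_zsmul k,
    smul_sub, smul_smul, smul_smul, h, h']
  rfl

theorem skew4_eq : skew4 k A = invTwelve k ^ 3 • A.sk₄ := by
  have e2 := invOf_mul_self (2 : k)
  have e3 := invOf_mul_self (3 : k)
  have h : invTwelve k ^ 3 * ((72 : ℤ) : k) = ⅟ (2 : k) * ⅟ (2 : k) * ⅟ (2 : k) * ⅟ (3 : k) := by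
    unfold invTwelve
    generalize ⅟ (2 : k) = a at *
    generalize ⅟ (3 : k) = b at *
    push_cast
    have : a ^ 6 * b ^ 3 * 72 = (a * 2) ^ 3 * (b * 3) ^ 2 * (a * a * a * b) := by ring
    linear_combination this + (by rw [e2, e3]; ring :
      (a * 2) ^ 3 * (b * 3) ^ 2 * (a * a * a * b) = a * a * a * b)
  have h' : invTwelve k ^ 3 * ((36 : ℤ) : k)
      = ⅟ (2 : k) * ⅟ (2 : k) * ⅟ (2 : k) * ⅟ (2 : k) * ⅟ (3 : k) := by
    unfold invTwelve
    generalize ⅟ (2 : k) = a at *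
    generalize ⅟ (3 : k) = b at *
    push_cast
    have : a ^ 6 * b ^ 3 * 36 = (a * 2) ^ 2 * (b * 3) ^ 2 * (a * a * a * a * b) := by ring
    linear_combination this + (by rw [e2, e3]; ring :
      (a * 2) ^ 2 * (b * 3) ^ 2 * (a * a * a * a * b) = a * a * a * a * b)
  unfold sk₄ preSk₄
  rw [alt_add, alt_zsmul, alt_zsmul, ← Int.cast_smul_eq_zsmul k, ← Int.cast_smul_eq_zsmul k,
    smul_add, smul_smul, smul_smul, h, h']
  rfl

end Skew

end WeakLie3

end WL3

namespace WL3

open Finset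

section GenericLeaf

variable {L : ℤ → Type} [∀ i, AddCommGroup (L i)] {n : ℕ}

/-- The labelling of the leaves by the elements `genericArg d x`. -/
def genericLeaf (d : Fin n → ℤ) (x : ∀ j, L (d j)) (i : ℕ) : Mod L n :=
  if h : i < n then genericArg d x ⟨i, h⟩ else 0

theorem genericLeaf_mem (d : Fin n → ℤ) (x : ∀ j, L (d j)) (i : ℕ) :
    genericLeaf d x i ∈ Homog (genericPar d) L 1 := by
  unfold genericLeaf
  split_ifs
  · exact genericArg_mem d x _
  · exact zero_mem _

variable {k : Type} [CommRing k] [∀ i, Module k (L i)] {I : Interp k L} {r : ℤ}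
variable {μ ν : MMap L L n r} {f g : TermFun}

theorem Rep.eval_genericLeaf {d : Fin n → ℤ} {x : ∀ j, L (d j)}
    (hf : Rep I (genericPar d) (genericLeaf d x) μ f) :
    Terms.ev I (genericPar d) (genericLeaf d x) (f ((List.range n).map .leaf))
      = hat (genericPar d) hf.multilinear (genericArg d x) := by
  rw [hf.eval _ (by simp)]
  congr 1
  funext j
  simp [List.getD_eq_getElem?_getD, Tree.ev, genericLeaf]

theorem Rep.eq_of_ev
    (hf : ∀ (d : Fin n → ℤ) (x : ∀ j, L (d j)), Rep I (genericPar d) (genericLeaf d x) μ f)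
    (hg : ∀ (d : Fin n → ℤ) (x : ∀ j, L (d j)), Rep I (genericPar d) (genericLeaf d x) ν g)
    (h : ∀ (d : Fin n → ℤ) (x : ∀ j, L (d j)),
      Terms.ev I (genericPar d) (genericLeaf d x) (f ((List.range n).map .leaf))
        = Terms.ev I (genericPar d) (genericLeaf d x) (g ((List.range n).map .leaf))) :
    μ = ν := by
  have x₀ : ∀ j : Fin n, L ((fun _ => 0 : Fin n → ℤ) j) := fun _ => 0
  refine eq_of_hat_genericArg (hf (fun _ => 0) x₀).multilinear (hg (fun _ => 0) x₀).multilinear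
    fun d x => ?_
  rw [← (hf d x).eval_genericLeaf, ← (hg d x).eval_genericLeaf, h]

end GenericLeaf

namespace TermFun

/-- Twelve times the skew-symmetrized bilinear operation. -/
def skew₂ : TermFun := alt perms₂ pre₂

/-- `12 ^ 2` times the skew-symmetrized trilinear operation. -/
def skew₃ : TermFun := alt perms₃ pre₃

/-- `12 ^ 3` times the skew-symmetrized quadrilinear operation. -/
def skew₄ : TermFun := alt perms₄ pre₄

end TermFun

namespace WeakLie3

variable {k : Type} [CommRing k] {L : ℤ → Type} [∀ i, AddCommGroup (L i)] [∀ i, Module k (L i)]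

section

variable {A : WeakLie3 k L} {n : ℕ} {r : ℤ} {μ ν : MMap L L n r} {f g : TermFun}

theorem eq_of_isZero
    (hf : ∀ (d : Fin n → ℤ) (x : ∀ j, L (d j)),
      Rep A.interp (genericPar d) (genericLeaf d x) μ f)
    (hg : ∀ (d : Fin n → ℤ) (x : ∀ j, L (d j)),
      Rep A.interp (genericPar d) (genericLeaf d x) ν g)
    (h : Terms.isZero (Terms.pushTop (f ((List.range n).map .leaf))
      ++ Terms.scale (-1) (g ((List.range n).map .leaf))) = true) : μ = ν := by
  refine Rep.eq_of_ev hf hg fun d x => ?_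
  have h1 := Terms.ev_eq_zero A.interp (genericPar d) (genericLeaf d x) h
  rw [Terms.ev_append, Terms.ev_scale, ev_pushTop (genericLeaf_mem d x), neg_one_zsmul,
    ← sub_eq_add_neg] at h1
  exact sub_eq_zero.mp h1

end

theorem isZero_bd_skew₂ : Terms.isZero (Terms.pushTop
    (TermFun.bd₂ 1 TermFun.skew₂ ((List.range 2).map .leaf))
      ++ Terms.scale (-1) []) = true := by
  decide +kernel

theorem isZero_bd_skew₃ : Terms.isZero (Terms.pushTop
    (TermFun.bd₃ (-1) TermFun.skew₃ ((List.range 3).map .leaf))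
      ++ Terms.scale (-1) (TermFun.leib₂ TermFun.skew₂ ((List.range 3).map .leaf))) = true := by
  decide +kernel

set_option maxRecDepth 100000 in
theorem isZero_bd_skew₄ : Terms.isZero (Terms.pushTop
    (TermFun.bd₄ 1 TermFun.skew₄ ((List.range 4).map .leaf))
      ++ Terms.scale (-1) (TermFun.leib₃ TermFun.skew₂ TermFun.skew₃
        ((List.range 4).map .leaf))) = true := by
  decide +kernel

variable (A : WeakLie3 k L)

theorem bd_sk₂ : bd (-1) A.D A.D A.sk₂ rfl = 0 :=
  eq_of_isZero (fun d x => (rep_sk₂ (genericLeaf_mem d x)).bd₂ (genericLeaf_mem d x) rfl 1 rfl)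
    (fun d x => Rep.zero (genericLeaf_mem d x)) isZero_bd_skew₂

theorem bd_sk₃ : bd 0 A.D A.D A.sk₃ rfl = leib₂ A.sk₂ :=
  eq_of_isZero (fun d x => (rep_sk₃ (genericLeaf_mem d x)).bd₃ (genericLeaf_mem d x) rfl (-1) rfl)
    (fun d x => (rep_sk₂ (genericLeaf_mem d x)).leib₂ (genericLeaf_mem d x)) isZero_bd_skew₃

theorem bd_sk₄ : bd 1 A.D A.D A.sk₄ rfl = leib₃ A.sk₂ A.sk₃ :=
  eq_of_isZero (fun d x => (rep_sk₄ (genericLeaf_mem d x)).bd₄ (genericLeaf_mem d x) rfl 1 rfl)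
    (fun d x => (rep_sk₂ (genericLeaf_mem d x)).leib₃ (genericLeaf_mem d x)
      (rep_sk₃ (genericLeaf_mem d x))) isZero_bd_skew₄

end WeakLie3

end WL3

namespace WL3

open Finset

namespace Tree

/-- Replace the operations of degrees zero, one and two by combinations of trees. -/
def replace (F₂ F₃ F₄ : TermFun) : Tree → Terms
  | leaf i => [(1, leaf i)]
  | n2 .l2 a b => Terms.lin (a.replace F₂ F₃ F₄) fun a => Terms.lin (b.replace F₂ F₃ F₄) fun b =>
      F₂ [a, b]
  | n3 .l3 a b c => Terms.lin (a.replace F₂ F₃ F₄) fun a => Terms.lin (b.replace F₂ F₃ F₄) fun b =>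
      Terms.lin (c.replace F₂ F₃ F₄) fun c => F₃ [a, b, c]
  | n4 .l4 a b c d => Terms.lin (a.replace F₂ F₃ F₄) fun a =>
      Terms.lin (b.replace F₂ F₃ F₄) fun b => Terms.lin (c.replace F₂ F₃ F₄) fun c =>
        Terms.lin (d.replace F₂ F₃ F₄) fun d => F₄ [a, b, c, d]
  | _ => []

end Tree

namespace TermFun

/-- Order two arguments of a skew-symmetric expression. -/
def swap (a b : Tree) (f : Tree → Tree → Terms) : Terms :=
  bif Nat.ble (a.enc 1) (b.enc 1) then f a b
  else Terms.scale (-1 * Terms.sg (a.par * b.par)) (f b a)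

/-- The skew-symmetric bilinear operation with ordered arguments. -/
def sorted₂ : TermFun
  | [a, b] => swap a b fun a b => [(1, .n2 .l2 a b)]
  | _ => []

/-- The skew-symmetric trilinear operation with ordered arguments. -/
def sorted₃ : TermFun
  | [a, b, c] => swap a b fun a b => swap b c fun b c => swap a b fun a b =>
      [(1, .n3 .l3 a b c)]
  | _ => []

/-- The skew-symmetric quadrilinear operation with ordered arguments. -/
def sorted₄ : TermFun
  | [a, b, c, d] => swap a b fun a b => swap b c fun b c => swap c d fun c d =>
      swap a b fun a b => swap b c fun b c => swap a b fun a b => [(1, .n4 .l4 a b c d)]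
  | _ => []

/-- The fourth Leibniz expression for skew-symmetric operations, on given leaves. -/
def jacobi (l : List ℕ) : Terms :=
  Terms.lin (leib₄ (op .l2) (op .l3) (op .l4) (l.map .leaf))
    (Tree.replace sorted₂ sorted₃ sorted₄)

end TermFun

section Replace

variable {k : Type} [CommRing k] {L : ℤ → Type} [∀ i, AddCommGroup (L i)] [∀ i, Module k (L i)]
variable {n : ℕ} {I J : Interp k L} {e : Fin n → ZMod 2} {lv : ℕ → Mod L n}
variable {F₂ F₃ F₄ : TermFun}

theorem Tree.ev_replace (hlv : ∀ i, lv i ∈ Homog e L 1) (h₂ : Rep I e lv (J.op .l2) F₂)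
    (h₃ : Rep I e lv (J.op .l3) F₃) (h₄ : Rep I e lv (J.op .l4) F₄) (hD : J.op .D = 0)
    (h₂₁ : J.op .l21 = 0) (h₂₁₁ : J.op .l211 = 0) (h₃₁ : J.op .l31 = 0) (h₃₂ : J.op .l32 = 0)
    (t : Tree) : Terms.ev I e lv (t.replace F₂ F₃ F₄) = t.ev J e lv := by
  have hz : ∀ {m : ℕ} (g : Op m) (ts : Fin m → Tree), J.op g = 0 →
      hat e (J.multilinear g) (fun j => (ts j).ev J e lv) = 0 := fun g ts h => by
    rw [hat_congr e (J.multilinear g) IsMultilinear.zero h,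
      hat_zero e _ _ _ fun j => Tree.ev_mem_homog hlv _]
  induction t with
  | leaf i => rw [replace, Terms.ev_single, ev, ev]
  | n1 g a iha =>
    cases g
    refine Eq.trans ?_ (hz .D ![a] hD).symm |>.trans ?_
    · rfl
    · rw [ev]; congr 1; funext j; fin_cases j; rfl
  | n2 g a b iha ihb =>
    cases g with
    | l2 =>
      rw [replace]
      refine (Terms.ev_lin_update (hat e (J.multilinear .l2)) ![0, b.ev J e lv] 0 _ _
        fun t => ?_).trans (by rw [iha, Tree.ev]; congr 1; funext j; fin_cases j <;> rfl)
      refine (Terms.ev_lin_update (hat e (J.multilinear .l2)) ![t.ev I e lv, 0] 1 _ _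
        fun u => ?_).trans (by rw [ihb]; congr 1; funext j; fin_cases j <;> rfl)
      rw [h₂.eval _ rfl]
      congr 1; funext j; fin_cases j <;> rfl
    | l21 =>
      refine Eq.trans ?_ (hz .l21 ![a, b] h₂₁).symm |>.trans ?_
      · rfl
      · rw [ev]; congr 1; funext j; fin_cases j <;> rfl
    | l211 =>
      refine Eq.trans ?_ (hz .l211 ![a, b] h₂₁₁).symm |>.trans ?_
      · rfl
      · rw [ev]; congr 1; funext j; fin_cases j <;> rfl
  | n3 g a b c iha ihb ihc =>
    cases g with
    | l3 =>
      rw [replace]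
      refine (Terms.ev_lin_update (hat e (J.multilinear .l3)) ![0, b.ev J e lv, c.ev J e lv] 0 _ _
        fun t => ?_).trans (by rw [iha, Tree.ev]; congr 1; funext j; fin_cases j <;> rfl)
      refine (Terms.ev_lin_update (hat e (J.multilinear .l3)) ![t.ev I e lv, 0, c.ev J e lv] 1 _ _
        fun u => ?_).trans (by rw [ihb]; congr 1; funext j; fin_cases j <;> rfl)
      refine (Terms.ev_lin_update (hat e (J.multilinear .l3)) ![t.ev I e lv, u.ev I e lv, 0] 2 _ _
        fun v => ?_).trans (by rw [ihc]; congr 1; funext j; fin_cases j <;> rfl)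
      rw [h₃.eval _ rfl]
      congr 1; funext j; fin_cases j <;> rfl
    | l31 =>
      refine Eq.trans ?_ (hz .l31 ![a, b, c] h₃₁).symm |>.trans ?_
      · rfl
      · rw [ev]; congr 1; funext j; fin_cases j <;> rfl
    | l32 =>
      refine Eq.trans ?_ (hz .l32 ![a, b, c] h₃₂).symm |>.trans ?_
      · rfl
      · rw [ev]; congr 1; funext j; fin_cases j <;> rfl
  | n4 g a b c d iha ihb ihc ihd =>
    cases g
    rw [replace]
    refine (Terms.ev_lin_update (hat e (J.multilinear .l4))
      ![0, b.ev J e lv, c.ev J e lv, d.ev J e lv] 0 _ _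
      fun t => ?_).trans (by rw [iha, Tree.ev]; congr 1; funext j; fin_cases j <;> rfl)
    refine (Terms.ev_lin_update (hat e (J.multilinear .l4))
      ![t.ev I e lv, 0, c.ev J e lv, d.ev J e lv] 1 _ _
      fun u => ?_).trans (by rw [ihb]; congr 1; funext j; fin_cases j <;> rfl)
    refine (Terms.ev_lin_update (hat e (J.multilinear .l4))
      ![t.ev I e lv, u.ev I e lv, 0, d.ev J e lv] 2 _ _
      fun v => ?_).trans (by rw [ihc]; congr 1; funext j; fin_cases j <;> rfl)
    refine (Terms.ev_lin_update (hat e (J.multilinear .l4))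
      ![t.ev I e lv, u.ev I e lv, v.ev I e lv, 0] 3 _ _
      fun w => ?_).trans (by rw [ihd]; congr 1; funext j; fin_cases j <;> rfl)
    rw [h₄.eval _ rfl]
    congr 1; funext j; fin_cases j <;> rfl

theorem Terms.ev_lin_replace (hlv : ∀ i, lv i ∈ Homog e L 1) (h₂ : Rep I e lv (J.op .l2) F₂)
    (h₃ : Rep I e lv (J.op .l3) F₃) (h₄ : Rep I e lv (J.op .l4) F₄) (hD : J.op .D = 0)
    (h₂₁ : J.op .l21 = 0) (h₂₁₁ : J.op .l211 = 0) (h₃₁ : J.op .l31 = 0) (h₃₂ : J.op .l32 = 0)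
    (l : Terms) : Terms.ev I e lv (l.lin (Tree.replace F₂ F₃ F₄)) = Terms.ev J e lv l := by
  induction l with
  | nil => rfl
  | cons p l ih =>
    rw [lin, List.flatMap_cons, ev_append, ev_scale,
      Tree.ev_replace hlv h₂ h₃ h₄ hD h₂₁ h₂₁₁ h₃₁ h₃₂, ev_cons, ← ih, lin]

theorem TermFun.ev_swap {f : Tree → Tree → Terms} {φ : Tree → Tree → Mod L n}
    (hf : ∀ a b, Terms.ev I e lv (f a b) = φ a b)
    (hφ : ∀ a b, (-1 : ℤ) • φ a b = Terms.sg (a.par * b.par) • φ b a) (a b : Tree) :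
    Terms.ev I e lv (swap a b f) = φ a b := by
  unfold swap
  cases Nat.ble (a.enc 1) (b.enc 1)
  · rw [cond_false, Terms.ev_scale, hf, mul_smul, ← hφ, smul_smul]
    exact one_smul _ _
  · exact hf a b

theorem Rep.ev_perm (hlv : ∀ i, lv i ∈ Homog e L 1) {m : ℕ} (g : Op m)
    (hg : ∀ σ, pa σ (I.op g) = (Equiv.Perm.sign σ : ℤ) • I.op g) (i j : Fin m) (hij : i ≠ j)
    (p : List ℕ × List ℕ) (hp : permData (Equiv.swap i j) = p) (ts : List Tree)
    (hts : ts.length = m) :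
    (-1 : ℤ) • (Tree.node g ts).ev I e lv
      = Terms.ev I e lv ((TermFun.op g).perm p ts) := by
  have := ((Rep.op (e := e) (lv := lv) g).perm hlv _ p hp).ev_eq ((Rep.op g).smul hlv (-1))
    ((hg (Equiv.swap i j)).trans (by rw [Equiv.Perm.sign_swap hij]; rfl)) ts hts
  rw [this, TermFun.smul, Terms.ev_scale, TermFun.op, Terms.ev_single]

end Replace

section Sorted

variable {k : Type} [CommRing k] {L : ℤ → Type} [∀ i, AddCommGroup (L i)] [∀ i, Module k (L i)]
variable {n : ℕ} {I : Interp k L} {e : Fin n → ZMod 2} {lv : ℕ → Mod L n}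

theorem Rep.sorted₂ (hlv : ∀ i, lv i ∈ Homog e L 1)
    (hg : ∀ σ, pa σ (I.op .l2) = (Equiv.Perm.sign σ : ℤ) • I.op .l2) :
    Rep I e lv (I.op .l2) TermFun.sorted₂ := by
  refine ⟨I.multilinear _, fun ts h => (Eq.trans ?_ ((Rep.op .l2).eval ts h))⟩
  match ts, h with
  | [a, b], _ =>
    rw [TermFun.op, Terms.ev_single]
    refine TermFun.ev_swap (I := I) (φ := fun a b => (Tree.n2 .l2 a b).ev I e lv)
      (fun a b => Terms.ev_single _ _ _ _) (fun a b => ?_) a b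
    refine (Rep.ev_perm hlv .l2 hg 0 1 (by decide) _ rfl [a, b] rfl).trans ?_
    rw [TermFun.perm, Terms.ev_scale]
    congr 1
    · congr 1
      simp +decide [TermFun.inv, permData, List.range_succ]
    · exact Terms.ev_single _ _ _ _

theorem Rep.sorted₃ (hlv : ∀ i, lv i ∈ Homog e L 1)
    (hg : ∀ σ, pa σ (I.op .l3) = (Equiv.Perm.sign σ : ℤ) • I.op .l3) :
    Rep I e lv (I.op .l3) TermFun.sorted₃ := by
  refine ⟨I.multilinear _, fun ts h => (Eq.trans ?_ ((Rep.op .l3).eval ts h))⟩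
  have h0 : ∀ a b c : Tree, (-1 : ℤ) • (Tree.n3 .l3 a b c).ev I e lv
      = Terms.sg (a.par * b.par) • (Tree.n3 .l3 b a c).ev I e lv := fun a b c => by
    refine (Rep.ev_perm hlv .l3 hg 0 1 (by decide) _ rfl [a, b, c] rfl).trans ?_
    rw [TermFun.perm, Terms.ev_scale]
    congr 1
    · congr 1
      simp +decide [TermFun.inv, permData, List.range_succ]
    · exact Terms.ev_single _ _ _ _
  have h1 : ∀ a b c : Tree, (-1 : ℤ) • (Tree.n3 .l3 a b c).ev I e lv
      = Terms.sg (b.par * c.par) • (Tree.n3 .l3 a c b).ev I e lv := fun a b c => by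
    refine (Rep.ev_perm hlv .l3 hg 1 2 (by decide) _ rfl [a, b, c] rfl).trans ?_
    rw [TermFun.perm, Terms.ev_scale]
    congr 1
    · congr 1
      simp +decide [TermFun.inv, permData, List.range_succ]
    · exact Terms.ev_single _ _ _ _
  match ts, h with
  | [a, b, c], _ =>
    rw [TermFun.op, Terms.ev_single, TermFun.sorted₃]
    refine TermFun.ev_swap (I := I) (φ := fun a b => (Tree.n3 .l3 a b c).ev I e lv)
      (fun a b => ?_) (fun a b => h0 a b c) a b
    refine TermFun.ev_swap (I := I) (φ := fun b c => (Tree.n3 .l3 a b c).ev I e lv)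
      (fun b c => ?_) (fun b c => h1 a b c) b c
    exact TermFun.ev_swap (I := I) (φ := fun a b => (Tree.n3 .l3 a b c).ev I e lv)
      (fun a b => Terms.ev_single _ _ _ _) (fun a b => h0 a b c) a b

theorem Rep.sorted₄ (hlv : ∀ i, lv i ∈ Homog e L 1)
    (hg : ∀ σ, pa σ (I.op .l4) = (Equiv.Perm.sign σ : ℤ) • I.op .l4) :
    Rep I e lv (I.op .l4) TermFun.sorted₄ := by
  refine ⟨I.multilinear _, fun ts h => (Eq.trans ?_ ((Rep.op .l4).eval ts h))⟩
  have h0 : ∀ a b c d : Tree, (-1 : ℤ) • (Tree.n4 .l4 a b c d).ev I e lv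
      = Terms.sg (a.par * b.par) • (Tree.n4 .l4 b a c d).ev I e lv := fun a b c d => by
    refine (Rep.ev_perm hlv .l4 hg 0 1 (by decide) _ rfl [a, b, c, d] rfl).trans ?_
    rw [TermFun.perm, Terms.ev_scale]
    congr 1
    · congr 1
      simp +decide [TermFun.inv, permData, List.range_succ]
    · exact Terms.ev_single _ _ _ _
  have h1 : ∀ a b c d : Tree, (-1 : ℤ) • (Tree.n4 .l4 a b c d).ev I e lv
      = Terms.sg (b.par * c.par) • (Tree.n4 .l4 a c b d).ev I e lv := fun a b c d => by
    refine (Rep.ev_perm hlv .l4 hg 1 2 (by decide) _ rfl [a, b, c, d] rfl).trans ?_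
    rw [TermFun.perm, Terms.ev_scale]
    congr 1
    · congr 1
      simp +decide [TermFun.inv, permData, List.range_succ]
    · exact Terms.ev_single _ _ _ _
  have h2 : ∀ a b c d : Tree, (-1 : ℤ) • (Tree.n4 .l4 a b c d).ev I e lv
      = Terms.sg (c.par * d.par) • (Tree.n4 .l4 a b d c).ev I e lv := fun a b c d => by
    refine (Rep.ev_perm hlv .l4 hg 2 3 (by decide) _ rfl [a, b, c, d] rfl).trans ?_
    rw [TermFun.perm, Terms.ev_scale]
    congr 1
    · congr 1
      simp +decide [TermFun.inv, permData, List.range_succ]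
    · exact Terms.ev_single _ _ _ _
  match ts, h with
  | [a, b, c, d], _ =>
    rw [TermFun.op, Terms.ev_single, TermFun.sorted₄]
    refine TermFun.ev_swap (I := I) (φ := fun a b => (Tree.n4 .l4 a b c d).ev I e lv)
      (fun a b => ?_) (fun a b => h0 a b c d) a b
    refine TermFun.ev_swap (I := I) (φ := fun b c => (Tree.n4 .l4 a b c d).ev I e lv)
      (fun b c => ?_) (fun b c => h1 a b c d) b c
    refine TermFun.ev_swap (I := I) (φ := fun c d => (Tree.n4 .l4 a b c d).ev I e lv)
      (fun c d => ?_) (fun c d => h2 a b c d) c d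
    refine TermFun.ev_swap (I := I) (φ := fun a b => (Tree.n4 .l4 a b c d).ev I e lv)
      (fun a b => ?_) (fun a b => h0 a b c d) a b
    refine TermFun.ev_swap (I := I) (φ := fun b c => (Tree.n4 .l4 a b c d).ev I e lv)
      (fun b c => ?_) (fun b c => h1 a b c d) b c
    exact TermFun.ev_swap (I := I) (φ := fun a b => (Tree.n4 .l4 a b c d).ev I e lv)
      (fun a b => Terms.ev_single _ _ _ _) (fun a b => h0 a b c d) a b

end Sorted

end WL3

namespace WL3

/-! ## The fourth Leibniz equation as a combination of the structure equations -/

/-- Coefficients of instances of an equation, given by words in hexadecimal digits. -/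
def leibCoeffs : List (ℤ × ℕ) :=
  [(-16, 2162688), (-8, 2097168)]

/-- Coefficients of instances of an equation, given by words in hexadecimal digits. -/
def w5Coeffs : List (ℤ × ℕ) :=
  [(-50, 11015358720), (6, 17222897680), (-6, 12952273409), (26, 17222897665), (-15, 17515581440),
    (16, 17230368784), (12, 11006445825), (-38, 9009991680), (-2, 17247111425)]

/-- Coefficients of instances of an equation, given by words in hexadecimal digits. -/
def w6Coeffs : List (ℤ × ℕ) :=
  [(-28, 546310401), (2, 546345216), (-12, 688455696), (-14, 807993360), (12, 808460544),
    (6, 546410496), (-40, 1075845376), (50, 809508880), (12, 1076429056), (1, 1094721536),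
    (-6, 697303056), (68, 687872256), (18, 1077944576), (-8, 537463056), (-28, 1075875841),
    (48, 687902736), (-6, 546902016), (-36, 687902976), (-6, 1093206016), (30, 538546176),
    (-70, 546314496), (44, 546310416)]

/-- Coefficients of instances of an equation, given by words in hexadecimal digits. -/
def w7Coeffs : List (ℤ × ℕ) :=
  [(26, 697303056), (-2, 546375936), (-32, 554240256), (8, 546897921), (-12, 546310401),
    (42, 1076428816), (6, 688455696), (36, 687868176), (12, 687902976), (-10, 688951296),
    (8, 826286080), (-2, 1093206016), (-36, 687902736), (24, 563087616)]

/-- Coefficients of instances of an equation, given by words in hexadecimal digits. -/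
def w8Coeffs : List (ℤ × ℕ) :=
  [(32, 807405840), (-44, 1075906816), (42, 1075841296), (12, 546314496), (-70, 956309505),
    (16, 808460289), (46, 537497616), (21, 537467136), (6, 1075875856), (-30, 1075875841),
    (-9, 1094721536), (-32, 807440385), (-2, 554240256), (8, 1077944576), (-50, 546375936),
    (-14, 697303041), (34, 538546176), (-8, 687868176)]

/-- Coefficients of instances of an equation, given by words in hexadecimal digits. -/
def w9Coeffs : List (ℤ × ℕ) :=
  [(-8, 43057152), (40, 33622272), (40, 67240192), (14, 34605312), (-18, 34144272),
    (-34, 42991872), (24, 34144257)]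

/-- Coefficients of instances of an equation, given by words in hexadecimal digits. -/
def w10Coeffs : List (ℤ × ℕ) :=
  [(14, 33656832), (30, 34639872), (6, 51511296), (-10, 33591297), (-2, 34144257), (4, 34148352),
    (-8, 34605312), (-40, 33560832), (-22, 42991632), (12, 33591312), (-28, 33622272),
    (-16, 67240192)]

/-- Coefficients of instances of an equation, given by words in hexadecimal digits. -/
def w11Coeffs : List (ℤ × ℕ) :=
  [(-26, 33622272), (-16, 50462721), (12, 33556737), (-10, 68288512), (6, 42991617),
    (-8, 51511296), (42, 42991632), (-10, 34639872), (-12, 33591552)]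

/-- Coefficients of differentials of trees of degree three, given by words in hexadecimal digits. -/
def boundaryCoeffs : List (ℤ × ℕ) :=
  [(4, 45651496960), (-22, 2902526208), (-15, 2698088448), (40, 2429223168), (-6, 3372223233),
    (4, 2430210048), (35, 38839947265), (-28, 2695626753), (7, 3769171984), (8, 45516589825),
    (20, 3785949184), (4, 3758788624), (-39, 45376118800), (22, 2963013633), (25, 47397341440),
    (15, 45911902480), (1, 39074794240), (18, 2962276368), (-3, 3103834113), (3, 38806401040),
    (10, 2698579968), (34, 45645103120), (6, 2919241984), (14, 202182656), (-8, 3221948688),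
    (-36, 3909093904), (1, 46053460225), (-8, 247463952), (10, 234930192), (8, 2428570368),
    (-6, 230686976), (-36, 38823070465), (-28, 168755216), (12, 262209536), (8, 3767640064),
    (8, 3232366848), (57, 43118037505), (-2, 2713755648), (11, 43134814465), (44, 3238725888),
    (-46, 3507130368), (-6, 2864713728), (-5, 2699137024), (8, 252709376), (-6, 2651459584),
    (32, 2962341888), (-10, 230686721), (60, 43101325825), (-16, 2694709504), (-12, 230690816),
    (-24, 2699041024), (-4, 2864709633), (-22, 2426458128), (-75, 38839912705), (10, 183500816),
    (-20, 2963017728), (6, 2903052288), (24, 2836205568), (-6, 2714765568), (2, 2443239424),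
    (-17, 45802393600), (22, 3507095808), (-2, 2711486464), (4, 3415212288), (11, 47422439680),
    (36, 2430601744), (-24, 2850029824), (-8, 2584608784), (12, 3641315328), (13, 47405113600),
    (-20, 49955246080), (17, 2427502848), (-4, 3399548928), (8, 218153216), (36, 43127998720),
    (-48, 3500153088), (7, 2904096768), (-8, 3926919424), (2, 46053464320), (6, 2965375248),
    (42, 45785063680), (35, 2427502593), (-12, 2694647808), (-42, 3759837184), (-12, 2698022913),
    (23, 2694889473), (-8, 3657500928), (-12, 2429591808), (17, 45795573760), (-24, 183566336),
    (7, 50080579585), (-24, 47405113360), (2, 45366349825), (-60, 2693845248), (-39, 47396266000),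
    (23, 47396296960), (-50, 3231383808), (12, 43143661825), (-12, 2597326848), (-10, 218890256),
    (5, 47421952000), (-39, 45375074320), (-8, 2836271104), (8, 3238595328), (-2, 3758727424),
    (-36, 45644581120), (62, 202178816), (-1, 49837768705), (43, 38823112720), (12, 41501655040),
    (-23, 43396403200), (-34, 49946398720), (3, 43101364240), (-10, 3233349648), (-10, 2852913408),
    (42, 2919303424), (32, 219201536), (6, 45559578880), (34, 2427568128), (-6, 2919825424),
    (-57, 47413004560), (65, 43101391120), (20, 3154706448), (-96, 45377163520), (13, 234930177),
    (8, 2651455489), (-4, 218890496), (-29, 2427502608), (20, 3231752208), (-19, 49671634945),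
    (6, 2613051408), (4, 38823235600), (1, 45559644160), (-15, 2963013648), (-8, 2979053568),
    (21, 49661221120), (8, 38834606080), (-1, 45377163280), (-24, 2715848704), (-14, 45643467280),
    (33, 38816231440), (2, 3500183568), (13, 47406157825), (18, 43101303040), (-6, 2928672784),
    (67, 2965440768), (-7, 47406711040), (-8, 3785361664), (8, 43111813120), (11, 41616974080),
    (-6, 3658023168), (24, 2919829504), (-5, 50089426945), (14, 3658022913), (8, 3389657088),
    (36, 3230707728), (-14, 2698575888), (24, 2965966848), (15, 47406710800), (8, 49939021825),
    (6, 41081835520), (-44, 2696978688), (-28, 39091671040), (-8, 3230731008), (38, 47421917440),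
    (1, 3758788609), (4, 47405731840), (-4, 3758754064), (-4, 41758531840), (-6, 45516632080),
    (-29, 235667472), (-12, 183504896), (8, 43396368640), (26, 3768193024), (21, 38823135745),
    (-14, 3926458384), (33, 43110150160), (20, 50089426960), (1, 41082200080), (-40, 49661190400),
    (6, 3154706433), (-43, 2427260928), (4, 3658483968), (64, 3768619024), (16, 2617290768),
    (-26, 3500736528), (-5, 41507491840), (1, 45802389505), (11, 43127967760), (22, 45377716240),
    (-10, 45644550160), (-8, 45903055120), (5, 2852913168), (-8, 45634685200), (-20, 49688412160),
    (-47, 45911937280), (8, 3490318608), (8, 2598371329), (6, 2698575873), (-41, 49661251600),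
    (6, 45377132800), (17, 38839912720), (8, 2716401664), (-38, 2650841344), (-8, 2852176128),
    (13, 45534023680), (8, 3666870273), (24, 202244112), (-8, 2427326464), (3, 38806424080),
    (23, 47413039105), (-12, 169803776), (26, 3775531264), (-14, 218890241), (7, 2965962768),
    (-6, 3154153473), (29, 45383092480), (-28, 3232796673), (-1, 45367398400), (-45, 2426458368),
    (36, 2885722368), (22, 45550209280), (24, 2920321024), (-8, 202248192), (-48, 3758754049),
    (42, 3926953984), (-46, 3658518528), (2, 168755201), (20, 47414053120), (35, 49661217025),
    (4, 3935305744), (24, 49946364160), (-6, 2601259008), (16, 2711666688), (-2, 235667712),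
    (49, 41348542480), (4, 3221983233), (-56, 43143696385), (8, 3499166208), (12, 3658027008),
    (-16, 43112239120), (2, 2447378944), (39, 49661217040), (-22, 39103037440), (-5, 47406710785),
    (-22, 3372265488), (28, 168759296), (33, 45376119040), (-1, 2920873984), (28, 41350600960),
    (22, 47664728320), (8, 38817890560), (-1, 43112796160), (-20, 45377163265), (1, 49661251840),
    (20, 3163553808), (-12, 2644574208), (-30, 2853224448), (22, 2885683728), (-32, 3104882688),
    (-24, 3775565824), (-2, 2710622208), (6, 2698022928), (12, 251699456), (-31, 47421851920),
    (-6, 38849808640), (-42, 38848694800), (40, 234995712), (36, 2714800128), (32, 235671552),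
    (-63, 47396327680), (-6, 2911899648)]

/-- A combination of the structure equations. -/
def structureSum : Terms :=
  Terms.scale 864 (relSum .leib leibCoeffs ++
  relSum .w5 w5Coeffs ++
  relSum .w6 w6Coeffs ++
  relSum .w7 w7Coeffs ++
  relSum .w8 w8Coeffs ++
  relSum .w9 w9Coeffs ++
  relSum .w10 w10Coeffs ++
  relSum .w11 w11Coeffs ++
  boundarySum boundaryCoeffs)

/-- The fourth Leibniz expression for skew-symmetric operations on four copies of the zeroth leaf
and the first leaf. -/
def jacobiDiagonal : Terms :=
  let z := Tree.leaf 0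
  let x := Tree.leaf 1
  [(-4, .n2 .l2 z (.n4 .l4 z z z x)), (-1, .n2 .l2 x (.n4 .l4 z z z z)),
    (6, .n3 .l3 z z (.n3 .l3 z z x)), (4, .n3 .l3 z x (.n3 .l3 z z z)),
    (-4, .n4 .l4 z z z (.n2 .l2 z x)), (-6, .n4 .l4 z z x (.n2 .l2 z z))]

theorem isZero_jacobi_diagonal : Terms.isZero
    (TermFun.jacobi [0, 0, 0, 0, 1] ++ Terms.scale (-1) jacobiDiagonal) = true := by
  decide +kernel

theorem isZero_jacobi_swap_zero : Terms.isZero (TermFun.jacobi [0, 1, 2, 3, 4]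
    ++ Terms.scale (-1) (TermFun.jacobi [1, 0, 2, 3, 4])) = true := by
  decide +kernel

theorem isZero_jacobi_swap_one : Terms.isZero (TermFun.jacobi [0, 1, 2, 3, 4]
    ++ Terms.scale (-1) (TermFun.jacobi [0, 2, 1, 3, 4])) = true := by
  decide +kernel

theorem isZero_jacobi_swap_two : Terms.isZero (TermFun.jacobi [0, 1, 2, 3, 4]
    ++ Terms.scale (-1) (TermFun.jacobi [0, 1, 3, 2, 4])) = true := by
  decide +kernel

set_option maxRecDepth 100000 in
theorem isZero_jacobiDiagonal_add_structureSum : Terms.isZero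
    (Terms.lin jacobiDiagonal (Tree.replace TermFun.skew₂ TermFun.skew₃ TermFun.skew₄)
      ++ structureSum) = true := by
  decide +kernel

end WL3

namespace WL3

open Finset

/-- Polarization in all arguments but the last. -/
theorem polarization_castSucc {k : Type} [CommRing k] {t : ℕ} {V W : Type} [AddCommGroup V]
    [AddCommGroup W] [Module k V] [Module k W]
    (F : MultilinearMap k (fun _ : Fin (t + 2) => V) W) (u : Fin (t + 2) → V) (P : V → Prop)
    (hP : ∀ j, P (u j))
    (hswap : ∀ w : Fin (t + 2) → V, (∀ j, P (w j)) → ∀ i : Fin t,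
      F (fun j => w (Equiv.swap i.castSucc.castSucc i.succ.castSucc j)) = F w)
    (hrep : ∀ g : Fin (t + 2) → Fin (t + 2), ¬ Function.Injective g → F (fun j => u (g j)) = 0)
    (hz : F (Fin.snoc (α := fun _ => V) (fun _ => ∑ j : Fin (t + 1), u j.castSucc)
      (u (Fin.last _))) = 0) : ((t + 1).factorial : ℕ) • F u = 0 := by
  let f : MultilinearMap k (fun _ : Fin (t + 1) => V) W :=
    (LinearMap.applyₗ (u (Fin.last _))).compMultilinearMap F.curryRight
  have hf : ∀ v, f v = F (Fin.snoc (α := fun _ => V) v (u (Fin.last _))) := fun v => rfl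
  have hu : f (fun j => u j.castSucc) = F u := by
    rw [hf]
    congr 1
    exact Fin.snoc_init_self _
  rw [← hu]
  refine polarization f _ ?_ ?_ ?_
  · refine symm_of_adjacent f (fun j => u j.castSucc) fun σ i => ?_
    rw [hf, hf]
    refine Eq.trans ?_ (hswap _ ?_ i)
    · congr 1
      funext j
      refine Fin.lastCases ?_ (fun j => ?_) j
      · rw [Fin.snoc_last, Equiv.swap_apply_of_ne_of_ne, Fin.snoc_last]
        · exact (Fin.castSucc_lt_last _).ne'
        · exact (Fin.castSucc_lt_last _).ne'
      · rw [Fin.snoc_castSucc, (Fin.castSucc_injective _).swap_apply, Fin.snoc_castSucc]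
    · intro j
      refine Fin.lastCases ?_ (fun j => ?_) j
      · rw [Fin.snoc_last]; exact hP _
      · rw [Fin.snoc_castSucc]; exact hP _
  · intro g hg
    rw [hf]
    refine Eq.trans ?_ (hrep
      (Fin.snoc (α := fun _ => Fin (t + 2)) (fun j => (g j).castSucc) (Fin.last _)) fun h => hg ?_)
    · congr 1
      funext j
      refine Fin.lastCases ?_ (fun j => ?_) j
      · rw [Fin.snoc_last, Fin.snoc_last]
      · rw [Fin.snoc_castSucc, Fin.snoc_castSucc]
    · intro a b hab
      have := @h a.castSucc b.castSucc (by rw [Fin.snoc_castSucc, Fin.snoc_castSucc, hab])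
      exact Fin.castSucc_injective _ this
  · rw [hf, hz]

namespace WeakLie3

variable {k : Type} [CommRing k] {L : ℤ → Type} [∀ i, AddCommGroup (L i)] [∀ i, Module k (L i)]

section

variable (A : WeakLie3 k L)

theorem pa_sk₂ (σ : Equiv.Perm (Fin 2)) : pa σ A.sk₂ = (Equiv.Perm.sign σ : ℤ) • A.sk₂ :=
  pa_alt (A.leib.lin2.zsmul _) σ

theorem pa_sk₃ (σ : Equiv.Perm (Fin 3)) : pa σ A.sk₃ = (Equiv.Perm.sign σ : ℤ) • A.sk₃ :=
  pa_alt A.multilinear_preSk₃ σ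

theorem pa_sk₄ (σ : Equiv.Perm (Fin 4)) : pa σ A.sk₄ = (Equiv.Perm.sign σ : ℤ) • A.sk₄ :=
  pa_alt A.multilinear_preSk₄ σ

/-- The interpretation of the operations by the skew-symmetrized operations. -/
def skewInterp : Interp k L where
  op g := match g with
    | .l2 => A.sk₂
    | .l3 => A.sk₃
    | .l4 => A.sk₄
    | .D | .l21 | .l211 | .l31 | .l32 => 0
  multilinear g := match g with
    | .l2 => A.multilinear_sk₂
    | .l3 => A.multilinear_sk₃
    | .l4 => A.multilinear_sk₄
    | .D | .l21 | .l211 | .l31 | .l32 => IsMultilinear.zero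

/-- The fourth Leibniz expression of the skew-symmetrized operations. -/
def jacobiator : MMap L L 5 2 := leib₄ A.sk₂ A.sk₃ A.sk₄

end

variable {A : WeakLie3 k L} {n : ℕ} {e : Fin n → ZMod 2} {lv : ℕ → Mod L n}

theorem rep_jacobiator (hlv : ∀ i, lv i ∈ Homog e L 1) :
    Rep A.skewInterp e lv A.jacobiator
      (TermFun.leib₄ (TermFun.op .l2) (TermFun.op .l3) (TermFun.op .l4)) :=
  Rep.leib₄ (l2 := A.skewInterp.op .l2) (l3 := A.skewInterp.op .l3) (l4 := A.skewInterp.op .l4)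
    hlv (Rep.op _) (Rep.op _) (Rep.op _)

theorem multilinear_jacobiator : IsMultilinear k A.jacobiator :=
  (rep_jacobiator (e := fun _ : Fin 0 => 0) (lv := fun _ => 0) fun _ => zero_mem _).multilinear

theorem ev_jacobi (hlv : ∀ i, lv i ∈ Homog e L 1) (l : List ℕ) (hl : l.length = 5) :
    Terms.ev A.skewInterp e lv (TermFun.jacobi l)
      = hat e A.multilinear_jacobiator fun j : Fin 5 => lv (l.getD j 0) := by
  rw [TermFun.jacobi, Terms.ev_lin_replace hlv (Rep.sorted₂ hlv A.pa_sk₂)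
    (Rep.sorted₃ hlv A.pa_sk₃) (Rep.sorted₄ hlv A.pa_sk₄) rfl rfl rfl rfl rfl,
    (rep_jacobiator hlv).eval _ (by simpa using hl)]
  congr 1
  funext j
  have hj : (j : ℕ) < l.length := by omega
  simp [List.getD_eq_getElem?_getD, Tree.ev, hj]

theorem hat_jacobiator_diagonal {z x : Mod L n} (hz : z ∈ Homog e L 1) (hx : x ∈ Homog e L 1) :
    hat e A.multilinear_jacobiator ![z, z, z, z, x] = 0 := by
  have hlv : ∀ i, (fun i : ℕ => if i = 0 then z else x) i ∈ Homog e L 1 := fun i => by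
    dsimp only
    split_ifs
    exacts [hz, hx]
  have h := Terms.ev_eq_zero A.skewInterp e (fun i => if i = 0 then z else x)
    isZero_jacobi_diagonal
  have h' := Terms.ev_eq_zero A.interp e (fun i => if i = 0 then z else x)
    isZero_jacobiDiagonal_add_structureSum
  have hs : Terms.ev A.interp e (fun i => if i = 0 then z else x) structureSum = 0 := by
    unfold structureSum
    simp only [Terms.ev_scale, Terms.ev_append, ev_relSum hlv, ev_boundarySum hlv, add_zero,
      smul_zero]
  rw [Terms.ev_append, hs, add_zero, Terms.ev_lin_replace (J := A.skewInterp) (F₂ := TermFun.skew₂)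
    (F₃ := TermFun.skew₃) (F₄ := TermFun.skew₄) hlv (rep_sk₂ hlv) (rep_sk₃ hlv) (rep_sk₄ hlv)
    rfl rfl rfl rfl rfl] at h'
  rw [Terms.ev_append, Terms.ev_scale, h', smul_zero, add_zero, ev_jacobi hlv _ rfl] at h
  rw [← h]
  congr 1
  funext j
  fin_cases j <;> rfl

theorem hat_jacobiator_congr (hlv : ∀ i, lv i ∈ Homog e L 1) (l l' : List ℕ) (hl : l.length = 5)
    (hl' : l'.length = 5) (h : Terms.isZero
      (TermFun.jacobi l ++ Terms.scale (-1) (TermFun.jacobi l')) = true) :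
    hat e A.multilinear_jacobiator (fun j : Fin 5 => lv (l.getD j 0))
      = hat e A.multilinear_jacobiator fun j : Fin 5 => lv (l'.getD j 0) := by
  have h1 := Terms.ev_eq_zero A.skewInterp e lv h
  rwa [Terms.ev_append, Terms.ev_scale, ev_jacobi hlv _ hl, ev_jacobi hlv _ hl', neg_one_zsmul,
    add_neg_eq_zero] at h1

theorem hat_jacobiator_swap {w : Fin 5 → Mod L n} (hw : ∀ j, w j ∈ Homog e L 1) (i : Fin 3) :
    hat e A.multilinear_jacobiator
        (fun j => w (Equiv.swap i.castSucc.castSucc i.succ.castSucc j))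
      = hat e A.multilinear_jacobiator w := by
  have hlv : ∀ i, (fun i : ℕ => if h : i < 5 then w ⟨i, h⟩ else 0) i ∈ Homog e L 1 := fun i => by
    dsimp only
    split_ifs
    exacts [hw _, zero_mem _]
  symm
  fin_cases i
  · convert hat_jacobiator_congr (A := A) hlv _ _ rfl rfl isZero_jacobi_swap_zero using 2 <;>
      funext j <;> fin_cases j <;> rfl
  · convert hat_jacobiator_congr (A := A) hlv _ _ rfl rfl isZero_jacobi_swap_one using 2 <;>
      funext j <;> fin_cases j <;> rfl
  · convert hat_jacobiator_congr (A := A) hlv _ _ rfl rfl isZero_jacobi_swap_two using 2 <;>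
      funext j <;> fin_cases j <;> rfl

theorem snoc_const_four {V : Type} (z x : V) :
    (Fin.snoc (α := fun _ => V) (fun _ : Fin 4 => z) x : Fin 5 → V) = ![z, z, z, z, x] := by
  funext j
  fin_cases j <;> rfl

theorem hat_jacobiator_genericArg (d : Fin 5 → ℤ) (x : ∀ j, L (d j)) :
    (24 : ℕ) • hat (genericPar d) A.multilinear_jacobiator (genericArg d x) = 0 := by
  have h := polarization_castSucc (t := 3) (hat (genericPar d) A.multilinear_jacobiator)
    (genericArg d x) (· ∈ Homog (genericPar d) L 1) (genericArg_mem d x)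
    (fun w hw i => hat_jacobiator_swap hw i)
    (hat_genericArg_comp_eq_zero A.multilinear_jacobiator d x)
  refine h ?_
  have h' := hat_jacobiator_diagonal (A := A)
    (sum_mem (t := univ) fun j _ => genericArg_mem d x (Fin.castSucc j))
    (genericArg_mem d x (Fin.last 4))
  exact (congrArg _ (snoc_const_four _ _)).trans h'

section

variable [Invertible (2 : k)] [Invertible (3 : k)]

theorem jacobiator_eq_zero (A : WeakLie3 k L) : A.jacobiator = 0 := by
  refine eq_zero_of_hat_genericArg A.multilinear_jacobiator fun d x => ?_
  have h := hat_jacobiator_genericArg (A := A) d x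
  rw [← Nat.cast_smul_eq_nsmul k] at h
  have h1 := congrArg (fun y => (⅟ (2 : k) * invTwelve k) • y) h
  have h2 : ⅟ (2 : k) * invTwelve k * ((24 : ℕ) : k) = 1 := by
    have e2 := invOf_mul_self (2 : k)
    have e3 := invOf_mul_self (3 : k)
    unfold invTwelve
    generalize ⅟ (2 : k) = a at *
    generalize ⅟ (3 : k) = b at *
    push_cast
    have : a * (a * a * b) * 24 = (a * 2) ^ 3 * (b * 3) := by ring
    rw [this, e2, e3]
    ring
  simpa only [smul_smul, h2, one_smul, smul_zero] using h1

theorem isLeibniz3_skew (A : WeakLie3 k L) :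
    IsLeibniz3 k A.D (skew2 k A) (skew3 k A) (skew4 k A) := by
  rw [skew2_eq, skew3_eq, skew4_eq]
  have h₂ := A.multilinear_sk₂
  have h₃ := A.multilinear_sk₃
  have h₄ := A.multilinear_sk₄
  refine ⟨h₂.smul _, h₃.smul _, h₄.smul _, ?_, ?_, ?_, ?_⟩
  · rw [bd_smul₂ A.linD h₂, A.bd_sk₂, smul_zero]
  · rw [bd_smul₃ A.linD h₃, A.bd_sk₃]
    exact (leib₂_smul h₂ _).symm
  · rw [bd_smul₄ A.linD h₄, A.bd_sk₄]
    exact (leib₃_smul h₂ h₃ _).symm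
  · refine Eq.trans ?_ (leib₄_smul h₂ h₃ h₄ _).symm
    exact ((congrArg _ A.jacobiator_eq_zero).trans (smul_zero _)).symm

end

end WeakLie3

end WL3

namespace WL3

/-- **Skew-symmetrization of a weak Lie 3-algebra is a (semi-strict) Lie 3-algebra**:
if `2` and `3` are invertible in `k`, the maps `λ̄2, λ̄3, λ̄4` are skew-symmetric and
satisfy the Leibniz 3-algebra equations (L1)–(L4). -/
theorem skew_symmetrization_is_Lie3
    (k : Type) [CommRing k] [Invertible (2 : k)] [Invertible (3 : k)]
    {L : ℤ → Type} [∀ i, AddCommGroup (L i)] [∀ i, Module k (L i)]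
    (A : WeakLie3 k L) :
    IsLeibniz3 k A.D (skew2 k A) (skew3 k A) (skew4 k A) ∧
    (∀ σ : Equiv.Perm (Fin 2), pa σ (skew2 k A) = (Equiv.Perm.sign σ : ℤ) • skew2 k A) ∧
    (∀ σ : Equiv.Perm (Fin 3), pa σ (skew3 k A) = (Equiv.Perm.sign σ : ℤ) • skew3 k A) ∧
    (∀ σ : Equiv.Perm (Fin 4), pa σ (skew4 k A) = (Equiv.Perm.sign σ : ℤ) • skew4 k A) := by
  refine ⟨A.isLeibniz3_skew, fun σ => ?_, fun σ => ?_, fun σ => ?_⟩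
  · rw [WeakLie3.skew2_eq, pa_smul, A.pa_sk₂, smul_comm]
  · rw [WeakLie3.skew3_eq, pa_smul, A.pa_sk₃, smul_comm]
  · rw [WeakLie3.skew4_eq, pa_smul, A.pa_sk₄, smul_comm]

end WL3
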